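/- Let p ≥ 1 and let u₀ ∈ C⁰(ℝⁿ) be positive and satisfy u₀(x) ≤ c₀·e^{−α|x|^β} for all x ∈ ℝⁿ, with positive constants c₀, α, β. Then for any δ > 0 there exist t₀ > 0 and C > 0 such that the minimal solution u of the Cauchy problem (0) satisfies ‖u(·,t)‖_{L^∞(ℝⁿ)} ≤ C · t^{−1/p} · (ln t)^{2/(pβ)+δ} for all t ≥ t₀. -/

import Mathlib

open Real Set MeasureTheory Metric Filter

/-- The Laplacian of a function on `ℝⁿ`, written via iterated Fréchet derivatives
in the coordinate directions. -/
noncomputable def lap {n : ℕ} (f : EuclideanSpace ℝ (Fin n) → ℝ)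
    (x : EuclideanSpace ℝ (Fin n)) : ℝ :=
  ∑ i : Fin n, fderiv ℝ (fun y => fderiv ℝ f y (EuclideanSpace.single i 1)) x
    (EuclideanSpace.single i 1)

/-- `u` is a positive classical solution of the Cauchy problem `u_t = u^p Δu`,
`u(·,0) = u₀`, on `ℝⁿ × (0,T)`: it is continuous on `ℝⁿ × [0,T)`, attains the initial
data, is positive and spatially `C²` for `0 < t < T`, and satisfies the PDE pointwise. -/
def IsSolOn (n : ℕ) (p : ℝ) (u₀ : EuclideanSpace ℝ (Fin n) → ℝ)
    (u : EuclideanSpace ℝ (Fin n) → ℝ → ℝ) (T : ℝ) : Prop :=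
  ContinuousOn (fun z : (EuclideanSpace ℝ (Fin n)) × ℝ => u z.1 z.2) {z | 0 ≤ z.2 ∧ z.2 < T} ∧
  (∀ x, u x 0 = u₀ x) ∧
  (∀ x, ∀ t, 0 < t → t < T → 0 < u x t) ∧
  (∀ t, 0 < t → t < T → ContDiff ℝ 2 (fun y => u y t)) ∧
  (∀ x, ∀ t, 0 < t → t < T →
    HasDerivAt (fun s => u x s) (u x t ^ p * lap (fun y => u y t) x) t)

/-- `u` is a global positive classical solution of the Cauchy problem
`u_t = u^p Δu` on `ℝⁿ × (0,∞)`, `u(·,0) = u₀`. -/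
def IsSol (n : ℕ) (p : ℝ) (u₀ : EuclideanSpace ℝ (Fin n) → ℝ)
    (u : EuclideanSpace ℝ (Fin n) → ℝ → ℝ) : Prop :=
  ContinuousOn (fun z : (EuclideanSpace ℝ (Fin n)) × ℝ => u z.1 z.2) {z | 0 ≤ z.2} ∧
  (∀ x, u x 0 = u₀ x) ∧
  (∀ x, ∀ t, 0 < t → 0 < u x t) ∧
  (∀ t, 0 < t → ContDiff ℝ 2 (fun y => u y t)) ∧
  (∀ x, ∀ t, 0 < t →
    HasDerivAt (fun s => u x s) (u x t ^ p * lap (fun y => u y t) x) t)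

/-- `u` is the minimal global positive classical solution of the Cauchy problem:
whenever `T ∈ (0,∞]` and `v` is a positive classical solution on `ℝⁿ × (0,T)`, then
`u ≤ v` there.  (Quantifying over all finite `T > 0` covers `T = ∞`, since the
restriction of a global solution solves the problem on every `(0,T)`.) -/
def IsMinimalSol (n : ℕ) (p : ℝ) (u₀ : EuclideanSpace ℝ (Fin n) → ℝ)
    (u : EuclideanSpace ℝ (Fin n) → ℝ → ℝ) : Prop :=
  IsSol n p u₀ u ∧
  ∀ T > (0:ℝ), ∀ v, IsSolOn n p u₀ v T → ∀ x, ∀ t, 0 ≤ t → t < T → u x t ≤ v x t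


open Real Set MeasureTheory Metric Filter

abbrev Lt (n : ℕ) := Fin n → ℤ
abbrev Dr (n : ℕ) := Fin n × Bool

def sgn {n : ℕ} (e : Dr n) : ℤ := if e.2 then 1 else -1
def st {n : ℕ} (e : Dr n) : Lt n := Pi.single e.1 (sgn e)

noncomputable def Dd {n : ℕ} (h : ℝ) (e : Dr n) (f : Lt n → ℝ) (x : Lt n) : ℝ :=
  (f (x + st e) - f x) / h
noncomputable def lapD {n : ℕ} (h : ℝ) (f : Lt n → ℝ) (x : Lt n) : ℝ :=
  ∑ e : Dr n, (f (x + st e) - f x) / h ^ 2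
noncomputable def dsq {n : ℕ} (h : ℝ) (x y : Lt n) : ℝ :=
  ∑ i, (h * ((x i : ℝ) - (y i : ℝ))) ^ 2

lemma left_deriv_nonneg {g : ℝ → ℝ} {d a t : ℝ} (hd : HasDerivAt g d t) (hat : a < t)
    (hm : ∀ s ∈ Icc a t, g s ≤ g t) : 0 ≤ d := by
  have h1 : Tendsto (slope g t) (nhdsWithin t (Iio t)) (nhds d) :=
    (hasDerivAt_iff_tendsto_slope.mp hd).mono_left
      (nhdsWithin_mono _ (fun x hx => ne_of_lt hx))
  refine ge_of_tendsto h1 ?_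
  filter_upwards [Ioo_mem_nhdsLT hat] with s hs
  rw [slope_def_field]
  have := hm s ⟨hs.1.le, hs.2.le⟩
  exact div_nonneg_of_nonpos (by linarith) (by linarith [hs.2])

lemma exists_max_time {ι : Type*} (S : Finset ι) (hS : S.Nonempty) (g : ι → ℝ → ℝ) {a b : ℝ}
    (hab : a ≤ b) (hc : ∀ i ∈ S, ContinuousOn (g i) (Icc a b)) :
    ∃ i ∈ S, ∃ t ∈ Icc a b, ∀ j ∈ S, ∀ s ∈ Icc a b, g j s ≤ g i t := by
  have h1 : ∀ i : ι, ∃ t, i ∈ S → t ∈ Icc a b ∧ ∀ s ∈ Icc a b, g i s ≤ g i t := by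
    intro i
    by_cases hi : i ∈ S
    · obtain ⟨t, ht, hm⟩ := isCompact_Icc.exists_isMaxOn (nonempty_Icc.mpr hab) (hc i hi)
      exact ⟨t, fun _ => ⟨ht, fun s hs => hm hs⟩⟩
    · exact ⟨a, fun h => absurd h hi⟩
  choose τ hτ using h1
  obtain ⟨i, hi, hm⟩ := S.exists_max_image (fun i => g i (τ i)) hS
  exact ⟨i, hi, τ i, (hτ i hi).1, fun j hj s hs => ((hτ j hj).2 s hs).trans (hm j hj)⟩

/-- Maximum principle for finite systems. -/
lemma max_principle {ι : Type*} (S : Finset ι) (f : ι → ℝ → ℝ) (a b K : ℝ)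
    (hc : ∀ i ∈ S, ContinuousOn (f i) (Icc a b)) (h0 : ∀ i ∈ S, f i a ≤ 0)
    (hd : ∀ i ∈ S, ∀ t, a < t → t ≤ b → 0 < f i t → (∀ j ∈ S, f j t ≤ f i t) →
      ∃ f', HasDerivAt (f i) f' t ∧ f' ≤ K * f i t) :
    ∀ i ∈ S, ∀ t ∈ Icc a b, f i t ≤ 0 := by
  intro i0 hi0 t0 ht0
  by_contra hcon
  push Not at hcon
  have hab : a ≤ b := ht0.1.trans ht0.2
  let E : ℝ → ℝ := fun t => Real.exp (-(K + 1) * (t - a))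
  have hEc : Continuous E := by fun_prop
  obtain ⟨i, hi, t, ht, hm⟩ := exists_max_time S ⟨i0, hi0⟩ (fun i t => E t * f i t) hab
    (fun i hi => hEc.continuousOn.mul (hc i hi))
  have hEp : ∀ t, 0 < E t := fun t => Real.exp_pos _
  have hpos : 0 < E t * f i t := lt_of_lt_of_le (mul_pos (hEp t0) hcon) (hm i0 hi0 t0 ht0)
  have hfpos : 0 < f i t := by
    rcases pos_and_pos_or_neg_and_neg_of_mul_pos hpos with h | h
    · exact h.2
    · exact absurd h.1 (not_lt.mpr (hEp t).le)
  have hat : a < t := by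
    rcases ht.1.lt_or_eq with h | h
    · exact h
    · exact absurd (h ▸ h0 i hi) (not_le.mpr (h ▸ hfpos))
  have hmj : ∀ j ∈ S, f j t ≤ f i t := fun j hj => by
    have := hm j hj t ht
    exact le_of_mul_le_mul_left this (hEp t)
  obtain ⟨f', hf', hle⟩ := hd i hi t hat ht.2 hfpos hmj
  have hE : HasDerivAt E (-(K + 1) * E t) t := by
    have h1 : HasDerivAt (fun t : ℝ => -(K + 1) * (t - a)) (-(K + 1)) t := by
      simpa using ((hasDerivAt_id t).sub_const a).const_mul (-(K + 1))
    have h2 := h1.exp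
    simpa [E, mul_comm] using h2
  have hg : HasDerivAt (fun t => E t * f i t) (-(K + 1) * E t * f i t + E t * f') t := hE.mul hf'
  have := left_deriv_nonneg hg hat (fun s hs => hm i hi s ⟨hs.1, hs.2.trans ht.2⟩)
  have h3 : E t * (f' - K * f i t) ≤ 0 :=
    mul_nonpos_of_nonneg_of_nonpos (hEp t).le (by linarith)
  nlinarith

/-- Elliptic maximum principle. -/
lemma elliptic_mp {n : ℕ} {h : ℝ} (hh : 0 < h) (S : Finset (Lt n)) (f : Lt n → ℝ)
    (hf : ∀ x ∈ S, 0 < f x → 0 < lapD h f x)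
    (hb : ∀ x ∈ S, 0 < f x → ∀ e, x + st e ∈ S ∨ f (x + st e) ≤ f x) :
    ∀ x ∈ S, f x ≤ 0 := by
  intro x0 hx0
  by_contra hcon
  push Not at hcon
  obtain ⟨x, hx, hm⟩ := S.exists_max_image f ⟨x0, hx0⟩
  have hxp : 0 < f x := hcon.trans_le (hm x0 hx0)
  have h1 := hf x hx hxp
  have h2 : lapD h f x ≤ 0 := by
    refine Finset.sum_nonpos (fun e _ => ?_)
    have : f (x + st e) ≤ f x := by
      rcases hb x hx hxp e with h | h
      · exact hm _ h
      · exact h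
    exact div_nonpos_of_nonpos_of_nonneg (by linarith) (by positivity)
  linarith

lemma lapD_nonpos_of_max {n : ℕ} {h : ℝ} (f : Lt n → ℝ) (x : Lt n)
    (hm : ∀ e, f (x + st e) ≤ f x) : lapD h f x ≤ 0 :=
  Finset.sum_nonpos (fun e _ => div_nonpos_of_nonpos_of_nonneg (by linarith [hm e]) (by positivity))

lemma lapD_add {n : ℕ} (h : ℝ) (f g : Lt n → ℝ) (x : Lt n) :
    lapD h (fun y => f y + g y) x = lapD h f x + lapD h g x := by
  unfold lapD; rw [← Finset.sum_add_distrib]; congr 1; ext e; ring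
lemma lapD_sub {n : ℕ} (h : ℝ) (f g : Lt n → ℝ) (x : Lt n) :
    lapD h (fun y => f y - g y) x = lapD h f x - lapD h g x := by
  unfold lapD; rw [← Finset.sum_sub_distrib]; congr 1; ext e; ring
lemma lapD_mul_const {n : ℕ} (h c : ℝ) (f : Lt n → ℝ) (x : Lt n) :
    lapD h (fun y => c * f y) x = c * lapD h f x := by
  unfold lapD; rw [Finset.mul_sum]; congr 1; ext e; ring
lemma lapD_const {n : ℕ} (h c : ℝ) (x : Lt n) : lapD h (fun _ => c) x = 0 := by
  simp [lapD]
lemma lapD_neg {n : ℕ} (h : ℝ) (f : Lt n → ℝ) (x : Lt n) :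
    lapD h (fun y => - f y) x = - lapD h f x := by
  unfold lapD; rw [← Finset.sum_neg_distrib]; congr 1; ext e; ring

lemma sum_Dr {n : ℕ} (F : Dr n → ℝ) : ∑ e, F e = ∑ i, (F (i, true) + F (i, false)) := by
  rw [Fintype.sum_prod_type]; simp

lemma dsq_step_eq {n : ℕ} (h : ℝ) (x y : Lt n) (e : Dr n) :
    dsq h (x + st e) y = dsq h x y + (2 * h * (sgn e : ℝ) * (h * ((x e.1 : ℝ) - y e.1)) + h ^ 2) := by
  have hs : ((sgn e : ℤ) : ℝ) ^ 2 = 1 := by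
    unfold sgn; split_ifs <;> norm_num
  unfold dsq
  rw [← Finset.add_sum_erase _ _ (Finset.mem_univ e.1), ← Finset.add_sum_erase _ _ (Finset.mem_univ e.1)]
  have : ∑ i ∈ Finset.univ.erase e.1, (h * (((x + st e) i : ℤ) - (y i : ℝ))) ^ 2
      = ∑ i ∈ Finset.univ.erase e.1, (h * ((x i : ℝ) - (y i : ℝ))) ^ 2 := by
    refine Finset.sum_congr rfl (fun i hi => ?_)
    have : st e i = 0 := by
      unfold st; exact Pi.single_eq_of_ne (Finset.ne_of_mem_erase hi) _
    simp [this]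
  rw [this]
  have h2 : (((x + st e) e.1 : ℤ) : ℝ) = x e.1 + sgn e := by simp [st]
  rw [h2]
  linear_combination (h ^ 2) * hs

lemma lapD_dsq {n : ℕ} {h : ℝ} (hh : 0 < h) (x y : Lt n) :
    lapD h (fun z => dsq h z y) x = 2 * n := by
  unfold lapD
  simp only [dsq_step_eq]
  rw [sum_Dr]
  have : ∀ i : Fin n, ((dsq h x y + (2 * h * (sgn ((i, true) : Dr n) : ℝ) * (h * ((x i : ℝ) - y i)) + h ^ 2) - dsq h x y) / h ^ 2
     + (dsq h x y + (2 * h * (sgn ((i, false) : Dr n) : ℝ) * (h * ((x i : ℝ) - y i)) + h ^ 2) - dsq h x y) / h ^ 2) = 2 := by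
    intro i
    simp [sgn]
    field_simp
    ring
  simp only [this]
  simp [mul_comm]

lemma dsq_nonneg {n : ℕ} (h : ℝ) (x y : Lt n) : 0 ≤ dsq h x y :=
  Finset.sum_nonneg (fun _ _ => sq_nonneg _)
lemma dsq_self {n : ℕ} (h : ℝ) (x : Lt n) : dsq h x x = 0 := by simp [dsq]
lemma dsq_comm {n : ℕ} (h : ℝ) (x y : Lt n) : dsq h x y = dsq h y x := by
  unfold dsq; congr 1; ext i; ring

lemma dsq_tri {n : ℕ} {h : ℝ} {x y z : Lt n} {a b : ℝ} (ha : 0 ≤ a) (hb : 0 ≤ b)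
    (h1 : dsq h x y ≤ a ^ 2) (h2 : dsq h y z ≤ b ^ 2) : dsq h x z ≤ (a + b) ^ 2 := by
  have hcs := Finset.sum_mul_sq_le_sq_mul_sq Finset.univ
    (fun i => h * ((x i : ℝ) - (y i : ℝ))) (fun i => h * ((y i : ℝ) - (z i : ℝ)))
  have e1 : dsq h x z = dsq h x y + 2 * (∑ i, (h * ((x i : ℝ) - (y i : ℝ))) * (h * ((y i : ℝ) - (z i : ℝ)))) + dsq h y z := by
    unfold dsq
    rw [Finset.mul_sum, ← Finset.sum_add_distrib, ← Finset.sum_add_distrib]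
    congr 1; ext i; ring
  set P := ∑ i, (h * ((x i : ℝ) - (y i : ℝ))) * (h * ((y i : ℝ) - (z i : ℝ)))
  have h3 : P ^ 2 ≤ (a * b) ^ 2 := by
    calc P ^ 2 ≤ dsq h x y * dsq h y z := hcs
      _ ≤ a ^ 2 * b ^ 2 := mul_le_mul h1 h2 (dsq_nonneg _ _ _) (sq_nonneg a)
      _ = (a * b) ^ 2 := by ring
  have h4 : P ≤ a * b := (abs_le_of_sq_le_sq' h3 (by positivity)).2
  rw [e1]; nlinarith

lemma dsq_st {n : ℕ} (h : ℝ) (x : Lt n) (e : Dr n) : dsq h (x + st e) x = h ^ 2 := by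
  rw [dsq_step_eq, dsq_self]; simp

lemma dsq_step_le {n : ℕ} {h : ℝ} (hh : 0 ≤ h) {x y : Lt n} {r : ℝ} (hr : 0 ≤ r)
    (h1 : dsq h x y ≤ r ^ 2) (e : Dr n) : dsq h (x + st e) y ≤ (r + h) ^ 2 := by
  have := dsq_tri hh hr (dsq_st h x e).le h1
  rwa [add_comm h r] at this

lemma dsq_coord {n : ℕ} (h : ℝ) (x y : Lt n) (i : Fin n) :
    (h * ((x i : ℝ) - (y i : ℝ))) ^ 2 ≤ dsq h x y :=
  Finset.single_le_sum (f := fun i => (h * ((x i : ℝ) - (y i : ℝ))) ^ 2)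
    (fun _ _ => sq_nonneg _) (Finset.mem_univ i)

lemma ball_finite {n : ℕ} {h : ℝ} (hh : 0 < h) (y : Lt n) (r : ℝ) :
    {x : Lt n | dsq h x y < r}.Finite := by
  have hsub : {x : Lt n | dsq h x y < r} ⊆
      ((Fintype.piFinset (fun i => Finset.Icc (y i - ⌈(|r| + 1) / h⌉) (y i + ⌈(|r| + 1) / h⌉)) : Finset (Lt n)) : Set (Lt n)) := by
    intro x hx
    simp only [Set.mem_ofPred_eq] at hx
    rw [Finset.mem_coe, Fintype.mem_piFinset]
    intro i
    rw [Finset.mem_Icc]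
    have h1 := (dsq_coord h x y i).trans_lt hx
    have h2 : (h * ((x i : ℝ) - (y i : ℝ))) ^ 2 ≤ (|r| + 1) ^ 2 := by
      have := le_abs_self r
      nlinarith [abs_nonneg r]
    have h3 := abs_le_of_sq_le_sq h2 (by positivity)
    rw [abs_mul, abs_of_pos hh] at h3
    have h4 : |(x i : ℝ) - y i| ≤ (|r| + 1) / h := by
      rw [le_div_iff₀ hh]; linarith
    have h5 : |(x i : ℝ) - y i| ≤ (⌈(|r| + 1) / h⌉ : ℝ) := h4.trans (Int.le_ceil _)
    have h6 := abs_le.mp h5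
    constructor
    · have : ((y i - ⌈(|r| + 1) / h⌉ : ℤ) : ℝ) ≤ x i := by push_cast; linarith [h6.1]
      exact_mod_cast this
    · have : (x i : ℝ) ≤ ((y i + ⌈(|r| + 1) / h⌉ : ℤ) : ℝ) := by push_cast; linarith [h6.2]
      exact_mod_cast this
  exact (Finset.finite_toSet _).subset hsub

noncomputable def lball {n : ℕ} {h : ℝ} (hh : 0 < h) (y : Lt n) (r : ℝ) : Finset (Lt n) :=
  (ball_finite hh y (r ^ 2)).toFinset
lemma mem_lball {n : ℕ} {h : ℝ} (hh : 0 < h) (y : Lt n) (r : ℝ) (x : Lt n) :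
    x ∈ lball hh y r ↔ dsq h x y < r ^ 2 := by simp [lball]

open Real Set MeasureTheory Metric Filter

lemma rpow_conv {p a b : ℝ} (hp : 1 ≤ p) (ha : 0 ≤ a) (hb : 0 ≤ b) :
    p * b ^ (p - 1) * (a - b) ≤ a ^ p - b ^ p := by
  rcases hb.eq_or_lt with rfl | hb
  · rcases hp.eq_or_lt with rfl | hp'
    · simp
    · rw [Real.zero_rpow (by linarith), Real.zero_rpow (by linarith)]
      simp; positivity
  · have h1 := one_add_mul_self_le_rpow_one_add (s := a / b - 1) (by have := div_nonneg ha hb.le; linarith) hp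
    have h2 : (1 + (a / b - 1)) ^ p = a ^ p / b ^ p := by
      rw [← Real.div_rpow ha hb.le]; congr 1; ring
    rw [h2, le_div_iff₀ (by positivity)] at h1
    have h3 : b ^ p = b ^ (p - 1) * b := by
      rw [← Real.rpow_add_one hb.ne']; congr 1; ring
    have h4 : (1 + p * (a / b - 1)) * b ^ p = b ^ p + p * b ^ (p - 1) * (a - b) := by
      rw [h3]; field_simp
    linarith

lemma rpow_lip {p a b M : ℝ} (hp : 1 ≤ p) (hb : 0 ≤ b) (hab : b ≤ a) (haM : a ≤ M) :
    a ^ p - b ^ p ≤ p * M ^ (p - 1) * (a - b) := by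
  have h1 := rpow_conv hp hb (hb.trans hab)
  have h2 : a ^ (p - 1) ≤ M ^ (p - 1) := Real.rpow_le_rpow (hb.trans hab) haM (by linarith)
  have h3 : p * a ^ (p - 1) * (a - b) ≤ p * M ^ (p - 1) * (a - b) := by
    apply mul_le_mul_of_nonneg_right _ (by linarith)
    apply mul_le_mul_of_nonneg_left h2 (by linarith)
  linarith

lemma rpow_lip_abs {p a b M : ℝ} (hp : 1 ≤ p) (hb : 0 ≤ b) (ha : 0 ≤ a) (haM : a ≤ M) (hbM : b ≤ M) :
    |a ^ p - b ^ p| ≤ p * M ^ (p - 1) * |a - b| := by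
  rcases le_total b a with h | h
  · have h1 := rpow_lip hp hb h haM
    have h2 : b ^ p ≤ a ^ p := Real.rpow_le_rpow hb h (by linarith)
    rw [abs_of_nonneg (by linarith), abs_of_nonneg (by linarith)]; exact h1
  · have h1 := rpow_lip hp ha h hbM
    have h2 : a ^ p ≤ b ^ p := Real.rpow_le_rpow ha h (by linarith)
    rw [abs_of_nonpos (by linarith), abs_of_nonpos (by linarith)]; linarith

/-- Global solutions for bounded Lipschitz autonomous fields. -/
lemma ode_global {ι : Type*} [Fintype ι] (F : (ι → ℝ) → (ι → ℝ)) (B K : ℝ)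
    (hB : ∀ w i, |F w i| ≤ B) (hK : ∀ w w' i, |F w i - F w' i| ≤ K * dist w w') (w0 : ι → ℝ)
    (T : ℝ) (hT : 0 ≤ T) (hB0 : 0 ≤ B) (hK0 : 0 ≤ K) :
    ∃ w : ℝ → ι → ℝ, w 0 = w0 ∧ ∀ t ∈ Icc (0:ℝ) T, ∀ i, HasDerivAt (fun s => w s i) (F (w t) i) t := by
  let t0 : Icc (-1 : ℝ) (T + 1) := ⟨0, by constructor <;> linarith⟩
  have hP : IsPicardLindelof (fun _ => F) t0 w0 (Real.toNNReal (B * (T + 1))) 0 (Real.toNNReal B) (Real.toNNReal K) := by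
    apply IsPicardLindelof.of_time_independent
    · intro x _
      rw [Real.coe_toNNReal _ hB0, pi_norm_le_iff_of_nonneg hB0]
      intro i; exact hB x i
    · apply LipschitzOnWith.of_dist_le_mul
      intro x _ y _
      rw [Real.coe_toNNReal _ hK0, dist_pi_le_iff (by positivity)]
      intro i; rw [Real.dist_eq]; exact hK x y i
    · rw [Real.coe_toNNReal _ hB0, Real.coe_toNNReal _ (by positivity)]
      have : max (T + 1 - (t0 : ℝ)) ((t0 : ℝ) - -1) = T + 1 := by
        simp [t0, hT]
      rw [this]; simp
  obtain ⟨w, hw0, hw⟩ := hP.exists_eq_forall_mem_Icc_hasDerivWithinAt₀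
  refine ⟨w, hw0, fun t ht i => ?_⟩
  have h1 := (hw t ⟨by linarith [ht.1], by linarith [ht.2]⟩).hasDerivAt
    (Icc_mem_nhds (by linarith [ht.1]) (by linarith [ht.2]))
  exact (hasDerivAt_pi.mp h1) i

/-- Lattice solutions. -/
structure LatSol (n : ℕ) (h p M T : ℝ) (S : Finset (Lt n)) (u : Lt n → ℝ → ℝ) : Prop where
  hd : ∀ x t, 0 ≤ t → t ≤ T → HasDerivAt (u x) (u x t ^ p * lapD h (fun y => u y t) x) t
  nonneg : ∀ x t, 0 ≤ t → t ≤ T → 0 ≤ u x t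
  le : ∀ x t, 0 ≤ t → t ≤ T → u x t ≤ M
  zero : ∀ x t, x ∉ S → u x t = 0

noncomputable def clampM (M r : ℝ) : ℝ := max 0 (min M r)

lemma clampM_nonneg (M r : ℝ) : 0 ≤ clampM M r := le_max_left _ _
lemma clampM_le {M : ℝ} (hM : 0 ≤ M) (r : ℝ) : clampM M r ≤ M := max_le hM (min_le_left _ _)
lemma clampM_lip (M a b : ℝ) : |clampM M a - clampM M b| ≤ |a - b| := by
  unfold clampM
  have h1 := abs_max_sub_max_le_max 0 (min M a) 0 (min M b)
  have h2 := abs_min_sub_min_le_max M a M b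
  simp only [sub_self, abs_zero] at h1 h2
  rw [max_eq_right (abs_nonneg (min M a - min M b))] at h1
  rw [max_eq_right (abs_nonneg (a - b))] at h2
  exact h1.trans h2

lemma card_Dr (n : ℕ) : (Finset.univ : Finset (Dr n)).card = 2 * n := by
  simp [mul_comm]

lemma abs_lapD_le {n : ℕ} (h : ℝ) (f : Lt n → ℝ) (x : Lt n) {A : ℝ}
    (hA : ∀ e, |f (x + st e) - f x| ≤ A) : |lapD h f x| ≤ 2 * n * A / h ^ 2 := by
  unfold lapD
  refine (Finset.abs_sum_le_sum_abs _ _).trans ?_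
  have : ∀ e ∈ (Finset.univ : Finset (Dr n)), |(f (x + st e) - f x) / h ^ 2| ≤ A / h ^ 2 := by
    intro e _
    rw [abs_div, abs_of_nonneg (sq_nonneg h)]
    exact div_le_div_of_nonneg_right (hA e) (sq_nonneg h)
  refine (Finset.sum_le_card_nsmul _ _ _ this).trans ?_
  rw [card_Dr, nsmul_eq_mul]; push_cast; apply le_of_eq; ring

lemma latsol_exists {n : ℕ} {h p M : ℝ} (hh : 0 < h) (hp : 1 ≤ p) (hM : 0 ≤ M) (T : ℝ) (hT : 0 ≤ T)
    (S : Finset (Lt n)) (u0 : Lt n → ℝ) (h0 : ∀ x, 0 ≤ u0 x) (h1 : ∀ x, u0 x ≤ M)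
    (hS : ∀ x ∉ S, u0 x = 0) : ∃ u, LatSol n h p M T S u ∧ ∀ x, u x 0 = u0 x := by
  classical
  let ext : (S → ℝ) → Lt n → ℝ := fun w x => if hx : x ∈ S then clampM M (w ⟨x, hx⟩) else 0
  have e0 : ∀ w x, 0 ≤ ext w x := fun w x => by
    simp only [ext]; split_ifs
    · exact clampM_nonneg _ _
    · exact le_rfl
  have eM : ∀ w x, ext w x ≤ M := fun w x => by
    simp only [ext]; split_ifs
    · exact clampM_le hM _
    · exact hM
  have eL : ∀ w w' x, |ext w x - ext w' x| ≤ dist w w' := fun w w' x => by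
    simp only [ext]; split_ifs with hx
    · exact (clampM_lip _ _ _).trans (by rw [← Real.dist_eq]; exact dist_le_pi_dist w w' _)
    · simp
  let F : (S → ℝ) → (S → ℝ) := fun w i => ext w i ^ p * lapD h (ext w) i
  have hlap : ∀ w x, |lapD h (ext w) x| ≤ 2 * n * M / h ^ 2 := fun w x => by
    apply abs_lapD_le; intro e
    rw [abs_le]; constructor <;> linarith [e0 w x, eM w x, e0 w (x + st e), eM w (x + st e)]
  have hpow : ∀ w x, |ext w x ^ p| ≤ M ^ p := fun w x => by
    rw [abs_of_nonneg (Real.rpow_nonneg (e0 w x) p)]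
    exact Real.rpow_le_rpow (e0 w x) (eM w x) (by linarith)
  have hMp : 0 ≤ M ^ p := Real.rpow_nonneg hM p
  have hMp1 : 0 ≤ M ^ (p - 1) := Real.rpow_nonneg hM _
  obtain ⟨w, hw0, hw⟩ := ode_global F (M ^ p * (2 * n * M / h ^ 2))
    (M ^ p * (2 * n * 2 / h ^ 2) + p * M ^ (p - 1) * (2 * n * M / h ^ 2))
    (fun w i => by
      simp only [F]; rw [abs_mul]
      exact mul_le_mul (hpow w i) (hlap w i) (abs_nonneg _) hMp)
    (fun w w' i => by
      simp only [F]
      have a1 : ext w i ^ p * lapD h (ext w) i - ext w' i ^ p * lapD h (ext w') i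
        = ext w i ^ p * (lapD h (fun y => ext w y - ext w' y) i)
          + (ext w i ^ p - ext w' i ^ p) * lapD h (ext w') i := by rw [lapD_sub]; ring
      rw [a1]
      have a2 : |lapD h (fun y => ext w y - ext w' y) i| ≤ 2 * n * (2 * dist w w') / h ^ 2 := by
        apply abs_lapD_le; intro e
        have b1 := abs_le.mp (eL w w' i)
        have b2 := abs_le.mp (eL w w' (i + st e))
        rw [abs_le]; constructor <;> linarith [b1.1, b1.2, b2.1, b2.2]
      have a3 := rpow_lip_abs hp (e0 w' i) (e0 w i) (eM w i) (eM w' i)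
      have a4 : p * M ^ (p - 1) * |ext w i - ext w' i| ≤ p * M ^ (p - 1) * dist w w' :=
        mul_le_mul_of_nonneg_left (eL w w' i) (by positivity)
      refine (abs_add_le _ _).trans ?_
      rw [abs_mul, abs_mul, add_mul]
      refine add_le_add ?_ ?_
      · calc _ ≤ M ^ p * (2 * n * (2 * dist w w') / h ^ 2) :=
              mul_le_mul (hpow w i) a2 (abs_nonneg _) hMp
          _ = _ := by ring
      · calc _ ≤ (p * M ^ (p - 1) * dist w w') * (2 * n * M / h ^ 2) :=
              mul_le_mul (a3.trans a4) (hlap w' i) (abs_nonneg _) (by positivity)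
          _ = _ := by ring)
    (fun i => u0 i) T hT (by positivity) (by positivity)
  have hcont : ∀ i : S, ContinuousOn (fun t => w t i) (Icc 0 T) := fun i t ht =>
    (hw t ht i).continuousAt.continuousWithinAt
  have hnn : ∀ i : S, ∀ t ∈ Icc (0:ℝ) T, -(w t i) ≤ 0 := by
    intro i
    refine max_principle (Finset.univ : Finset S) (fun i t => -(w t i)) 0 T 0 (fun i _ => (hcont i).neg) ?_ ?_ i (Finset.mem_univ i)
    · intro i _; simp only [hw0]; linarith [h0 i]
    · intro i _ t ht htT hpos _
      refine ⟨_, (hw t ⟨ht.le, htT⟩ i).neg, ?_⟩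
      have : ext (w t) i = 0 := by
        simp only [ext, i.2, dite_true, clampM]
        exact max_eq_left ((min_le_right _ _).trans (by simpa using hpos.le))
      simp only [F, this]
      rw [Real.zero_rpow (by linarith)]; simp
  have hle : ∀ i : S, ∀ t ∈ Icc (0:ℝ) T, w t i - M ≤ 0 := by
    intro i
    refine max_principle (Finset.univ : Finset S) (fun i t => w t i - M) 0 T 0 (fun i _ => (hcont i).sub continuousOn_const) ?_ ?_ i (Finset.mem_univ i)
    · intro i _; simp only [hw0]; linarith [h1 i]
    · intro i _ t ht htT hpos _
      refine ⟨_, (hw t ⟨ht.le, htT⟩ i).sub_const M, ?_⟩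
      have : ext (w t) i = M := by
        simp only [ext, i.2, dite_true, clampM]
        rw [min_eq_left (by linarith), max_eq_right hM]
      have h2 : lapD h (ext (w t)) i ≤ 0 := lapD_nonpos_of_max _ _ (fun e => by rw [this]; exact eM _ _)
      simp only [F, zero_mul]
      exact mul_nonpos_of_nonneg_of_nonpos (Real.rpow_nonneg (e0 _ _) _) h2
  refine ⟨fun x t => if hx : x ∈ S then w t ⟨x, hx⟩ else 0, ⟨?_, ?_, ?_, ?_⟩, ?_⟩
  · intro x t ht htT
    have hext : (fun y => if hy : y ∈ S then w t ⟨y, hy⟩ else 0) = ext (w t) := by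
      funext y; simp only [ext]
      split_ifs with hy
      · have := hnn ⟨y, hy⟩ t ⟨ht, htT⟩
        have := hle ⟨y, hy⟩ t ⟨ht, htT⟩
        unfold clampM
        rw [min_eq_right (by linarith), max_eq_right (by linarith)]
      · rfl
    by_cases hx : x ∈ S
    · have h2 := hw t ⟨ht, htT⟩ ⟨x, hx⟩
      simp only [F] at h2
      rw [hext]
      have h3 : (if hy : x ∈ S then w t ⟨x, hy⟩ else 0) = ext (w t) x := congrFun hext x
      simp only [h3]
      simpa only [hx, dite_true] using h2
    · simp only [hx, dite_false]
      rw [Real.zero_rpow (by linarith), zero_mul]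
      exact hasDerivAt_const _ _
  · intro x t ht htT
    by_cases hx : x ∈ S
    · simp only [hx, dite_true]; linarith [hnn ⟨x, hx⟩ t ⟨ht, htT⟩]
    · simp [hx]
  · intro x t ht htT
    by_cases hx : x ∈ S
    · simp only [hx, dite_true]; linarith [hle ⟨x, hx⟩ t ⟨ht, htT⟩]
    · simp [hx, hM]
  · intro x t hx; simp [hx]
  · intro x
    by_cases hx : x ∈ S
    · simp [hx, hw0]
    · simp [hx, hS x hx]

namespace LatSol
variable {n : ℕ} {h p M T : ℝ} {S : Finset (Lt n)} {u v : Lt n → ℝ → ℝ}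

lemma contOn (hu : LatSol n h p M T S u) (x : Lt n) : ContinuousOn (u x) (Icc 0 T) :=
  fun t ht => (hu.hd x t ht.1 ht.2).continuousAt.continuousWithinAt

lemma lap_bound (hu : LatSol n h p M T S u) (x : Lt n) {t : ℝ} (h0 : 0 ≤ t) (h1 : t ≤ T) :
    |lapD h (fun y => u y t) x| ≤ 2 * n * M / h ^ 2 := by
  apply abs_lapD_le; intro e
  rw [abs_le]
  constructor <;> linarith [hu.nonneg x t h0 h1, hu.le x t h0 h1, hu.nonneg (x + st e) t h0 h1, hu.le (x + st e) t h0 h1]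

lemma compare (hp : 1 ≤ p) (hu : LatSol n h p M T S u) (hv : LatSol n h p M T S v)
    (h0 : ∀ x, u x 0 ≤ v x 0) (x : Lt n) {t : ℝ} (ht : 0 ≤ t) (htT : t ≤ T) : u x t ≤ v x t := by
  by_cases hx : x ∈ S
  swap
  · rw [hu.zero x t hx, hv.zero x t hx]
  have := max_principle S (fun x t => u x t - v x t) 0 T (p * M ^ (p - 1) * (2 * n * M / h ^ 2))
    (fun i _ => (hu.contOn i).sub (hv.contOn i)) (fun i _ => by linarith [h0 i]) ?_ x hx t ⟨ht, htT⟩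
  · linarith
  intro i hi s hs hsT hpos hmax
  refine ⟨_, (hu.hd i s hs.le hsT).sub (hv.hd i s hs.le hsT), ?_⟩
  have h1 : lapD h (fun y => u y s - v y s) i ≤ 0 := lapD_nonpos_of_max _ _ (fun e => by
    by_cases he : i + st e ∈ S
    · exact hmax _ he
    · simp only [hu.zero _ s he, hv.zero _ s he]; linarith)
  have a1 : u i s ^ p * lapD h (fun y => u y s) i - v i s ^ p * lapD h (fun y => v y s) i
        = u i s ^ p * (lapD h (fun y => u y s - v y s) i)
          + (u i s ^ p - v i s ^ p) * lapD h (fun y => v y s) i := by rw [lapD_sub]; ring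
  rw [a1]
  have h2 := mul_nonpos_of_nonneg_of_nonpos (Real.rpow_nonneg (hu.nonneg i s hs.le hsT) p) h1
  have h3 := rpow_lip hp (hv.nonneg i s hs.le hsT) (by linarith) (hu.le i s hs.le hsT)
  have h4 : v i s ^ p ≤ u i s ^ p := Real.rpow_le_rpow (hv.nonneg i s hs.le hsT) (by linarith) (by linarith)
  have h5 := (abs_le.mp (hv.lap_bound i hs.le hsT)).2
  have hL : 0 ≤ 2 * n * M / h ^ 2 := (abs_nonneg _).trans (hv.lap_bound i hs.le hsT)
  have h6 : (u i s ^ p - v i s ^ p) * lapD h (fun y => v y s) i ≤ (u i s ^ p - v i s ^ p) * (2 * n * M / h ^ 2) :=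
    mul_le_mul_of_nonneg_left h5 (by linarith)
  have h7 := mul_le_mul_of_nonneg_right h3 hL
  nlinarith

lemma scale (hp : 1 ≤ p) (hu : LatSol n h p M T S u) {l : ℝ} (hl : 0 < l) (hl1 : l ≤ 1) :
    LatSol n h p M T S (fun x t => l * u x (l ^ p * t)) := by
  have hlp : 0 < l ^ p := Real.rpow_pos_of_pos hl p
  have hlp1 : l ^ p ≤ 1 := Real.rpow_le_one hl.le hl1 (by linarith)
  have hr : ∀ t, 0 ≤ t → t ≤ T → 0 ≤ l ^ p * t ∧ l ^ p * t ≤ T := fun t h0 h1 =>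
    ⟨by positivity, by nlinarith⟩
  refine ⟨?_, ?_, ?_, ?_⟩
  · intro x t h0 h1
    obtain ⟨a, b⟩ := hr t h0 h1
    have h2 := hu.hd x _ a b
    have h3 : HasDerivAt (fun s : ℝ => l ^ p * s) (l ^ p) t := by
      simpa using (hasDerivAt_id t).const_mul (l ^ p)
    have h4 := (h2.comp t h3).const_mul l
    have h5 : (l * u x (l ^ p * t)) ^ p * lapD h (fun y => l * u y (l ^ p * t)) x
        = l * (u x (l ^ p * t) ^ p * lapD h (fun y => u y (l ^ p * t)) x * l ^ p) := by
      rw [lapD_mul_const, Real.mul_rpow hl.le (hu.nonneg x _ a b)]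
      ring
    rw [h5]; exact h4
  · intro x t h0 h1
    obtain ⟨a, b⟩ := hr t h0 h1
    exact mul_nonneg hl.le (hu.nonneg x _ a b)
  · intro x t h0 h1
    obtain ⟨a, b⟩ := hr t h0 h1
    have := hu.nonneg x _ a b
    have := hu.le x _ a b
    nlinarith
  · intro x t hx
    simp [hu.zero x _ hx]

/-- Aronson–Bénilan. -/
lemma ab (hp : 1 ≤ p) (hu : LatSol n h p M T S u) (x : Lt n) {s t : ℝ} (hs : 0 < s) (hst : s ≤ t)
    (htT : t ≤ T) : (s / t) ^ (1 / p) * u x s ≤ u x t := by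
  have ht : 0 < t := hs.trans_le hst
  have hl : 0 < (s / t) ^ (1 / p) := Real.rpow_pos_of_pos (div_pos hs ht) _
  have hl1 : (s / t) ^ (1 / p) ≤ 1 := Real.rpow_le_one (div_pos hs ht).le ((div_le_one ht).mpr hst) (by positivity)
  have h1 := (hu.scale hp hl hl1).compare hp hu (fun x => by
    have := hu.nonneg x 0 le_rfl (ht.le.trans htT)
    simp only [mul_zero]; nlinarith) x ht.le htT
  have h2 : ((s / t) ^ (1 / p)) ^ p = s / t := by
    rw [← Real.rpow_mul (div_pos hs ht).le, one_div_mul_cancel (by linarith), Real.rpow_one]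
  simp only [h2] at h1
  rwa [div_mul_cancel₀ _ ht.ne'] at h1

lemma ab_lin (hp : 1 ≤ p) (hu : LatSol n h p M T S u) (x : Lt n) {s t : ℝ} (hs : 0 < s) (hst : s ≤ t)
    (htT : t ≤ T) : (s / t) * u x s ≤ u x t := by
  have ht : 0 < t := hs.trans_le hst
  refine le_trans ?_ (hu.ab hp x hs hst htT)
  apply mul_le_mul_of_nonneg_right _ (hu.nonneg x s hs.le (hst.trans htT))
  have h1 : (s / t) ^ (1:ℝ) ≤ (s / t) ^ (1 / p) :=
    Real.rpow_le_rpow_of_exponent_ge (div_pos hs ht) ((div_le_one ht).mpr hst)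
      (by rw [div_le_one (by linarith)]; exact hp)
  simpa using h1

/-- Quasi-monotonicity in time. -/
lemma quasi (hp : 1 ≤ p) (hu : LatSol n h p M T S u) (x : Lt n) {τ s t : ℝ} (hτ : 0 < τ) (hs : τ ≤ s)
    (hst : s ≤ t) (htT : t ≤ T) : u x s - M / τ * (t - s) ≤ u x t := by
  have hs0 := hτ.trans_le hs
  have ht : 0 < t := hs0.trans_le hst
  have h1 := hu.ab_lin hp x hs0 hst htT
  have h2 := hu.le x s hs0.le (hst.trans htT)
  have h3 := hu.nonneg x s hs0.le (hst.trans htT)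
  have h4 : s / t = 1 - (t - s) / t := by field_simp; ring
  have h5 : (t - s) / t * u x s ≤ (t - s) / τ * M := by
    apply mul_le_mul _ h2 h3 (div_nonneg (by linarith) hτ.le)
    exact div_le_div_of_nonneg_left (by linarith) hτ (by linarith)
  rw [h4] at h1
  have : M / τ * (t - s) = (t - s) / τ * M := by ring
  rw [this]; linarith

/-- q = u^p: t q nondecreasing -/
lemma ab_pow (hp : 1 ≤ p) (hu : LatSol n h p M T S u) (x : Lt n) {s t : ℝ} (hs : 0 < s) (hst : s ≤ t)
    (htT : t ≤ T) : s * u x s ^ p ≤ t * u x t ^ p := by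
  have ht : 0 < t := hs.trans_le hst
  have h1 := hu.ab hp x hs hst htT
  have h0 := hu.nonneg x s hs.le (hst.trans htT)
  have h2 := Real.rpow_le_rpow (mul_nonneg (Real.rpow_nonneg (div_pos hs ht).le _) h0) h1 (by linarith : 0 ≤ p)
  rw [Real.mul_rpow (Real.rpow_nonneg (div_pos hs ht).le _) h0, ← Real.rpow_mul (div_pos hs ht).le,
    one_div_mul_cancel (by linarith), Real.rpow_one, div_mul_eq_mul_div, div_le_iff₀ ht] at h2
  linarith

/-- any constant sup bound persists -/
lemma sup_mono (hp : 1 ≤ p) (hu : LatSol n h p M T S u) {s t A : ℝ} (hs : 0 ≤ s) (hst : s ≤ t)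
    (htT : t ≤ T) (hA0 : 0 ≤ A) (hA : ∀ x, u x s ≤ A) (x : Lt n) : u x t ≤ A := by
  by_cases hx : x ∈ S
  swap
  · rw [hu.zero x t hx]; exact hA0
  have := max_principle S (fun x t => u x t - A) s T 0
    (fun i _ => ((hu.contOn i).mono (Icc_subset_Icc_left hs)).sub continuousOn_const) (fun i _ => by linarith [hA i]) ?_ x hx t ⟨hst, htT⟩
  · linarith
  intro i hi r hr hrT hpos hmax
  refine ⟨_, (hu.hd i r (by linarith) hrT).sub_const A, ?_⟩
  have h1 : lapD h (fun y => u y r) i ≤ 0 := lapD_nonpos_of_max _ _ (fun e => by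
    by_cases he : i + st e ∈ S
    · linarith [hmax _ he]
    · simp only [hu.zero _ r he]; linarith)
  have := mul_nonpos_of_nonneg_of_nonpos (Real.rpow_nonneg (hu.nonneg i r (by linarith) hrT) p) h1
  linarith

end LatSol

open Real Set MeasureTheory Metric Filter

namespace LatSol
variable {n : ℕ} {h p M T : ℝ} {S : Finset (Lt n)} {u v : Lt n → ℝ → ℝ}

lemma lower (hh : 0 < h) (hp : 1 ≤ p) (hM : 0 ≤ M) (hu : LatSol n h p M T S u) (y : Lt n) {R ε : ℝ} (hε : 0 ≤ ε)
    (h0 : ∀ x, dsq h x y < R ^ 2 → ε * R ^ 2 ≤ u x 0) (x : Lt n) {t : ℝ} (ht : 0 ≤ t) (htT : t ≤ T) :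
    ε * Real.exp (-(2 * n * ε * M ^ (p - 1)) * t) * (R ^ 2 - dsq h x y) ≤ u x t := by
  set lam := 2 * n * ε * M ^ (p - 1) with hlam
  have hex : ∀ t, 0 < Real.exp (-lam * t) := fun t => Real.exp_pos _
  by_cases hx : x ∈ lball hh y R
  swap
  · rw [mem_lball] at hx
    have h1 := hu.nonneg x t ht htT
    have : ε * Real.exp (-lam * t) * (R ^ 2 - dsq h x y) ≤ 0 :=
      mul_nonpos_of_nonneg_of_nonpos (mul_nonneg hε (hex t).le) (by linarith)
    linarith
  have hder : ∀ i t, HasDerivAt (fun t => ε * Real.exp (-lam * t) * (R ^ 2 - dsq h i y))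
      (-lam * (ε * Real.exp (-lam * t) * (R ^ 2 - dsq h i y))) t := by
    intro i t
    have h1 : HasDerivAt (fun t : ℝ => -lam * t) (-lam) t := by
      simpa using (hasDerivAt_id t).const_mul (-lam)
    have h2 := (h1.exp.const_mul ε).mul_const (R ^ 2 - dsq h i y)
    have h3 : -lam * (ε * Real.exp (-lam * t) * (R ^ 2 - dsq h i y)) = ε * (Real.exp (-lam * t) * -lam) * (R ^ 2 - dsq h i y) := by ring
    rw [h3]; exact h2
  have := max_principle (lball hh y R) (fun x t => ε * Real.exp (-lam * t) * (R ^ 2 - dsq h x y) - u x t) 0 T 0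
    (fun i _ => (ContinuousOn.sub (fun t _ => (hder i t).continuousAt.continuousWithinAt) (hu.contOn i))) ?_ ?_ x hx t ⟨ht, htT⟩
  · linarith
  · intro i hi
    rw [mem_lball] at hi
    have h1 := h0 i hi
    have h2 := dsq_nonneg h i y
    simp only [mul_zero, Real.exp_zero, mul_one]
    nlinarith
  · intro i hi s hs hsT hpos hmax
    refine ⟨_, (hder i s).sub (hu.hd i s hs.le hsT), ?_⟩
    have hui := hu.nonneg i s hs.le hsT
    have h1 : lapD h (fun z => (-(ε * Real.exp (-lam * s))) * dsq h z y + (ε * Real.exp (-lam * s)* R ^ 2) - u z s) i ≤ 0 :=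
      lapD_nonpos_of_max _ _ (fun e => by
        by_cases he : i + st e ∈ lball hh y R
        · have := hmax _ he
          linarith
        · rw [mem_lball] at he
          have h3 := hu.nonneg (i + st e) s hs.le hsT
          have : ε * Real.exp (-lam * s) * (R ^ 2 - dsq h (i + st e) y) ≤ 0 :=
            mul_nonpos_of_nonneg_of_nonpos (mul_nonneg hε (hex s).le) (by linarith)
          linarith)
    rw [lapD_sub, lapD_add, lapD_mul_const, lapD_dsq hh, lapD_const] at h1
    set E := Real.exp (-lam * s) with hE
    have hEp : 0 < E := hex s
    set b := ε * E * (R ^ 2 - dsq h i y) with hb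
    have h2 : u i s ^ p * (-(ε * E) * (2 * n)) ≤ u i s ^ p * lapD h (fun y => u y s) i :=
      mul_le_mul_of_nonneg_left (by linarith) (Real.rpow_nonneg hui p)
    have h3 : u i s ^ p ≤ M ^ (p - 1) * u i s := by
      rcases hui.eq_or_lt with h | h
      · rw [← h, Real.zero_rpow (by linarith)]; simp
      · have : u i s ^ p = u i s ^ (p - 1) * u i s := by
          rw [← Real.rpow_add_one h.ne']; congr 1; ring
        rw [this]
        exact mul_le_mul_of_nonneg_right (Real.rpow_le_rpow hui (hu.le i s hs.le hsT) (by linarith)) hui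
    have h4 : M ^ (p - 1) * u i s ≤ M ^ (p - 1) * b :=
      mul_le_mul_of_nonneg_left (by linarith) (Real.rpow_nonneg hM _)
    have hE1 : E ≤ 1 := by
      rw [hE]; apply Real.exp_le_one_iff.mpr
      have : 0 ≤ lam := by rw [hlam]; have := Real.rpow_nonneg hM (p-1); positivity
      nlinarith
    have h5 : u i s ^ p * (ε * E * (2 * n)) ≤ (M ^ (p - 1) * b) * (ε * 1 * (2 * n)) := by
      apply mul_le_mul (h3.trans h4) _ (by positivity) _
      · gcongr
      · exact mul_nonneg (Real.rpow_nonneg hM _) (by linarith)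
    have h6 : lam * b = (M ^ (p - 1) * b) * (ε * 1 * (2 * n)) := by rw [hlam]; ring
    linarith

lemma init_upper (hh : 0 < h) (hp : 1 ≤ p) (hu : LatSol n h p M T S u) (y : Lt n) {A C : ℝ}
    (hA : 0 ≤ A) (hC : 0 ≤ C) (hM : 0 ≤ M)
    (h0 : ∀ x, u x 0 ≤ A + C * dsq h x y) (x : Lt n) {t : ℝ} (ht : 0 ≤ t) (htT : t ≤ T) :
    u x t ≤ A + C * dsq h x y + 2 * n * C * M ^ p * t := by
  have hMp := Real.rpow_nonneg hM p
  by_cases hx : x ∈ S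
  swap
  · rw [hu.zero x t hx]
    have := dsq_nonneg h x y
    positivity
  have hder : ∀ i t, HasDerivAt (fun t => A + C * dsq h i y + 2 * n * C * M ^ p * t) (2 * n * C * M ^ p) t := by
    intro i t
    simpa using ((hasDerivAt_id t).const_mul (2 * n * C * M ^ p)).const_add (A + C * dsq h i y)
  have := max_principle S (fun x t => u x t - (A + C * dsq h x y + 2 * n * C * M ^ p * t)) 0 T 0
    (fun i _ => (ContinuousOn.sub (hu.contOn i) (fun t _ => (hder i t).continuousAt.continuousWithinAt))) ?_ ?_ x hx t ⟨ht, htT⟩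
  · linarith
  · intro i hi
    simp only [mul_zero]
    linarith [h0 i]
  · intro i hi s hs hsT hpos hmax
    refine ⟨_, (hu.hd i s hs.le hsT).sub (hder i s), ?_⟩
    have hui := hu.nonneg i s hs.le hsT
    have h1 : lapD h (fun z => u z s - (C * dsq h z y + (A + 2 * n * C * M ^ p * s))) i ≤ 0 :=
      lapD_nonpos_of_max _ _ (fun e => by
        by_cases he : i + st e ∈ S
        · have := hmax _ he
          linarith
        · rw [hu.zero _ s he]
          have := dsq_nonneg h (i + st e) y
          have : 0 ≤ C * dsq h (i + st e) y + (A + 2 * n * C * M ^ p * s) := by positivity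
          linarith)
    rw [lapD_sub, lapD_add, lapD_mul_const, lapD_dsq hh, lapD_const] at h1
    have h2 : u i s ^ p * lapD h (fun y => u y s) i ≤ u i s ^ p * (C * (2 * n)) :=
      mul_le_mul_of_nonneg_left (by linarith) (Real.rpow_nonneg hui p)
    have h3 : u i s ^ p * (C * (2 * n)) ≤ M ^ p * (C * (2 * n)) :=
      mul_le_mul_of_nonneg_right (Real.rpow_le_rpow hui (hu.le i s hs.le hsT) (by linarith)) (by positivity)
    linarith

lemma init_lower (hh : 0 < h) (hp : 1 ≤ p) (hu : LatSol n h p M T S u) (y : Lt n) {A C : ℝ}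
    (hA : 0 ≤ A) (hC : 0 < C) (hM : 0 ≤ M)
    (h0 : ∀ x, A - C * dsq h x y ≤ u x 0) (x : Lt n) {t : ℝ} (ht : 0 ≤ t) (htT : t ≤ T) :
    A - C * dsq h x y - 2 * n * C * M ^ p * t ≤ u x t := by
  have hMp := Real.rpow_nonneg hM p
  set r := Real.sqrt (A / C) with hr
  have hr2 : C * r ^ 2 = A := by
    rw [hr, Real.sq_sqrt (by positivity)]; field_simp
  have hout : ∀ x, x ∉ lball hh y r → ∀ t, 0 ≤ t → A - C * dsq h x y - 2 * n * C * M ^ p * t ≤ 0 := by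
    intro x hx t ht
    rw [mem_lball, not_lt] at hx
    have := mul_le_mul_of_nonneg_left hx hC.le
    have : 0 ≤ 2 * n * C * M ^ p * t := by positivity
    linarith
  by_cases hx : x ∈ lball hh y r
  swap
  · exact (hout x hx t ht).trans (hu.nonneg x t ht htT)
  have hder : ∀ i t, HasDerivAt (fun t => A - C * dsq h i y - 2 * n * C * M ^ p * t) (-(2 * n * C * M ^ p)) t := by
    intro i t
    simpa using ((hasDerivAt_id t).const_mul (2 * n * C * M ^ p)).const_sub (A - C * dsq h i y)
  have := max_principle (lball hh y r) (fun x t => (A - C * dsq h x y - 2 * n * C * M ^ p * t) - u x t) 0 T 0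
    (fun i _ => (ContinuousOn.sub (fun t _ => (hder i t).continuousAt.continuousWithinAt) (hu.contOn i))) ?_ ?_ x hx t ⟨ht, htT⟩
  · linarith
  · intro i hi
    simp only [mul_zero]
    linarith [h0 i]
  · intro i hi s hs hsT hpos hmax
    refine ⟨_, (hder i s).sub (hu.hd i s hs.le hsT), ?_⟩
    have hui := hu.nonneg i s hs.le hsT
    have h1 : lapD h (fun z => ((-C) * dsq h z y + (A - 2 * n * C * M ^ p * s)) - u z s) i ≤ 0 :=
      lapD_nonpos_of_max _ _ (fun e => by
        by_cases he : i + st e ∈ lball hh y r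
        · have := hmax _ he
          linarith
        · have := hout _ he s hs.le
          have := hu.nonneg (i + st e) s hs.le hsT
          linarith)
    rw [lapD_sub, lapD_add, lapD_mul_const, lapD_dsq hh, lapD_const] at h1
    have h2 : u i s ^ p * (-C * (2 * n)) ≤ u i s ^ p * lapD h (fun y => u y s) i :=
      mul_le_mul_of_nonneg_left (by linarith) (Real.rpow_nonneg hui p)
    have h3 : u i s ^ p * (C * (2 * n)) ≤ M ^ p * (C * (2 * n)) :=
      mul_le_mul_of_nonneg_right (Real.rpow_le_rpow hui (hu.le i s hs.le hsT) (by linarith)) (by positivity)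
    linarith

/-! ### Decay -/

lemma q_deriv (hh : 0 < h) (hp : 1 ≤ p) (hu : LatSol n h p M T S u) (x : Lt n) {t : ℝ} (ht : 0 ≤ t) (htT : t ≤ T) :
    ∃ d, HasDerivAt (fun t => u x t ^ p) d t ∧ d ≤ u x t ^ p * lapD h (fun y => u y t ^ p) x := by
  refine ⟨_, (hu.hd x t ht htT).rpow_const (Or.inr hp), ?_⟩
  have h0 := hu.nonneg x t ht htT
  have h1 : p * u x t ^ (p - 1) * lapD h (fun y => u y t) x ≤ lapD h (fun y => u y t ^ p) x := by
    unfold lapD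
    rw [Finset.mul_sum]
    refine Finset.sum_le_sum (fun e _ => ?_)
    rw [← mul_div_assoc]
    exact div_le_div_of_nonneg_right (rpow_conv hp (hu.nonneg _ t ht htT) h0) (sq_nonneg h)
  have h2 := mul_le_mul_of_nonneg_left h1 (Real.rpow_nonneg h0 p)
  linarith

end LatSol

lemma prim_deriv {g : ℝ → ℝ} {T t : ℝ} (hg : ContinuousOn g (Icc 0 T)) (h0 : 0 < t) (h1 : t < T) :
    HasDerivAt (fun t => ∫ s in (0:ℝ)..t, g s) (g t) t := by
  have hi : IntervalIntegrable g volume 0 t :=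
    (hg.mono (Icc_subset_Icc_right h1.le)).intervalIntegrable_of_Icc h0.le
  have hn : Icc (0:ℝ) T ∈ nhds t := Icc_mem_nhds h0 h1
  exact intervalIntegral.integral_hasDerivAt_right hi
    (ContinuousOn.stronglyMeasurableAtFilter_nhdsWithin (s := Ioo 0 T) (hg.mono Ioo_subset_Icc_self) measurableSet_Ioo t
      |>.filter_mono (by rw [isOpen_Ioo.nhdsWithin_eq ⟨h0, h1⟩]))
    (hg.continuousAt hn)

lemma prim_cont {g : ℝ → ℝ} {T : ℝ} (hT : 0 ≤ T) (hg : ContinuousOn g (Icc 0 T)) :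
    ContinuousOn (fun t => ∫ s in (0:ℝ)..t, g s) (Icc 0 T) := by
  have := intervalIntegral.continuousOn_primitive_interval (μ := volume) (f := g) (a := 0) (b := T)
    (by rw [uIcc_of_le hT]; exact hg.integrableOn_Icc)
  rwa [uIcc_of_le hT] at this

open Real Set MeasureTheory Metric Filter

/-- time-monotone: nonpositive derivative -/
lemma le_of_deriv_nonpos {g : ℝ → ℝ} {a b : ℝ} (hab : a ≤ b) (hc : ContinuousOn g (Icc a b))
    (hd : ∀ t, a < t → t < b → ∃ d, HasDerivAt g d t ∧ d ≤ 0) : g b ≤ g a := by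
  have := antitoneOn_of_deriv_nonpos (convex_Icc a b) hc
    (fun t ht => by
      rw [interior_Icc] at ht
      obtain ⟨d, h1, _⟩ := hd t ht.1 ht.2
      exact h1.differentiableAt.differentiableWithinAt)
    (fun t ht => by
      rw [interior_Icc] at ht
      obtain ⟨d, h1, h2⟩ := hd t ht.1 ht.2
      rw [h1.deriv]; exact h2)
  exact this ⟨le_rfl, hab⟩ ⟨hab, le_rfl⟩ hab

lemma lapD_hasDerivAt {n : ℕ} (h : ℝ) (f : Lt n → ℝ → ℝ) (f' : Lt n → ℝ) (x : Lt n) (t : ℝ)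
    (hf : ∀ y, HasDerivAt (f y) (f' y) t) :
    HasDerivAt (fun t => lapD h (fun y => f y t) x) (lapD h f' x) t := by
  unfold lapD
  apply HasDerivAt.fun_sum
  intro e _
  exact ((hf (x + st e)).sub (hf x)).div_const _

lemma lapD_contOn {n : ℕ} (h : ℝ) (f : Lt n → ℝ → ℝ) (x : Lt n) (s : Set ℝ)
    (hf : ∀ y, ContinuousOn (f y) s) : ContinuousOn (fun t => lapD h (fun y => f y t) x) s := by
  unfold lapD
  apply continuousOn_finsetSum
  intro e _
  exact ((hf (x + st e)).sub (hf x)).div_const _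

namespace LatSol
variable {n : ℕ} {h p M T : ℝ} {S : Finset (Lt n)} {u v : Lt n → ℝ → ℝ}

noncomputable def W (p : ℝ) (u : Lt n → ℝ → ℝ) (x : Lt n) (t : ℝ) : ℝ := ∫ s in (0:ℝ)..t, u x s ^ p

lemma q_cont (hp : 1 ≤ p) (hu : LatSol n h p M T S u) (x : Lt n) :
    ContinuousOn (fun t => u x t ^ p) (Icc 0 T) :=
  (hu.contOn x).rpow_const (fun _ _ => Or.inr (by linarith))

lemma W_deriv (hp : 1 ≤ p) (hu : LatSol n h p M T S u) (x : Lt n) {t : ℝ} (ht : 0 < t) (htT : t < T) :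
    HasDerivAt (W p u x) (u x t ^ p) t := prim_deriv (hu.q_cont hp x) ht htT

lemma W_cont (hp : 1 ≤ p) (hu : LatSol n h p M T S u) (hT : 0 ≤ T) (x : Lt n) :
    ContinuousOn (W p u x) (Icc 0 T) := prim_cont hT (hu.q_cont hp x)

lemma W_zero (x : Lt n) : W p u x 0 = 0 := by simp [W]

lemma q_le_exp (hh : 0 < h) (hp : 1 ≤ p) (hu : LatSol n h p M T S u) (x : Lt n) {t : ℝ} (ht : 0 ≤ t)
    (htT : t ≤ T) : u x t ^ p ≤ u x 0 ^ p * Real.exp (lapD h (fun y => W p u y t) x) := by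
  have hT : 0 ≤ T := ht.trans htT
  set L : ℝ → ℝ := fun t => lapD h (fun y => W p u y t) x with hL
  have hLc : ContinuousOn L (Icc 0 T) := lapD_contOn h _ x _ (fun y => hu.W_cont hp hT y)
  have h1 := le_of_deriv_nonpos (g := fun t => u x t ^ p * Real.exp (- L t)) ht
    (((hu.q_cont hp x).mul (hLc.neg.rexp)).mono (Icc_subset_Icc_right htT)) ?_
  · have hL0 : L 0 = 0 := by simp [hL, W_zero, lapD]
    rw [hL0] at h1
    simp only [neg_zero, Real.exp_zero, mul_one] at h1
    have h2 := mul_le_mul_of_nonneg_right h1 (Real.exp_pos (L t)).le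
    rw [mul_assoc, ← Real.exp_add] at h2
    simpa using h2
  · intro s hs hst
    obtain ⟨d, hd, hle⟩ := hu.q_deriv hh hp x hs.le (by linarith)
    have hLd : HasDerivAt L (lapD h (fun y => u y s ^ p) x) s :=
      lapD_hasDerivAt h _ _ x s (fun y => hu.W_deriv hp y hs (by linarith))
    refine ⟨_, hd.mul hLd.neg.exp, ?_⟩
    have := Real.exp_pos (- L s)
    simp only [Pi.neg_apply]
    nlinarith

lemma W_le_log (hp : 1 ≤ p) (hu : LatSol n h p M T S u) (x : Lt n) {t A t1 : ℝ} (ht : 0 ≤ t)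
    (ht1 : t ≤ t1) (htT : t1 < T) (hA : ∀ s, 0 ≤ s → s ≤ t1 → (1 + s) * u x s ^ p ≤ A) :
    W p u x t ≤ A * Real.log (1 + t) := by
  have h1 := le_of_deriv_nonpos (g := fun t => W p u x t - A * Real.log (1 + t)) ht
    (((hu.W_cont hp (by linarith) x).mono (Icc_subset_Icc_right (by linarith))).sub
      (continuousOn_const.mul (ContinuousOn.log (by fun_prop) (fun s hs => by have := hs.1; positivity)))) ?_
  · simp [W_zero] at h1; linarith
  · intro s hs hst
    have hl : HasDerivAt (fun s : ℝ => Real.log (1 + s)) (1 / (1 + s)) s :=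
      ((hasDerivAt_id s).const_add 1).log (by simp; positivity)
    refine ⟨_, (hu.W_deriv hp x hs (by linarith)).sub (hl.const_mul A), ?_⟩
    have := hA s hs.le (by linarith)
    rw [mul_one_div, sub_nonpos, le_div_iff₀ (by positivity)]
    linarith

lemma far (hh : 0 < h) (hp : 1 ≤ p) (hu : LatSol n h p M T S u) {Θ R ts : ℝ} (hΘ : 1 ≤ Θ)
    (hΘT : 2 * Θ < T) (hR : 0 < R)
    (htail : ∀ x, R ^ 2 ≤ dsq h x 0 → u x 0 ^ p * (1 + 2 * Θ) ^ (20 * n : ℕ) * Θ ≤ 1)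
    (hts0 : 0 < ts) (hts : ts ≤ Θ) (hb : ∀ x s, 0 ≤ s → s ≤ 2 * ts → (1 + s) * u x s ^ p ≤ 10 * R ^ 2)
    (y0 : Lt n) (hy0 : (2 * R) ^ 2 ≤ dsq h y0 0) : u y0 ts ^ p ≤ 4 / Θ := by
  have hq : ∀ x s, 0 ≤ s → s ≤ T → 0 ≤ u x s ^ p := fun x s h0 h1 => Real.rpow_nonneg (hu.nonneg x s h0 h1) p
  have key : ∀ x ∈ lball hh y0 R, ∀ t ∈ Icc (0:ℝ) (2 * ts),
      W p u x t - (10 * Real.log (1 + t) * dsq h x y0 + t / Θ) ≤ 0 := by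
    have hder : ∀ i t, 0 ≤ t → HasDerivAt (fun t => 10 * Real.log (1 + t) * dsq h i y0 + t / Θ) (10 * (1 / (1 + t)) * dsq h i y0 + 1 / Θ) t := by
      intro i t ht
      have hl : HasDerivAt (fun s : ℝ => Real.log (1 + s)) (1 / (1 + t)) t :=
        ((hasDerivAt_id t).const_add 1).log (by simp; positivity)
      exact ((hl.const_mul 10).mul_const _).add ((hasDerivAt_id t).div_const Θ)
    refine max_principle (lball hh y0 R) (fun x t => W p u x t - (10 * Real.log (1 + t) * dsq h x y0 + t / Θ)) 0 (2 * ts) 0 ?_ ?_ ?_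
    · intro i _
      exact ((hu.W_cont hp (by linarith) i).mono (Icc_subset_Icc_right (by linarith))).sub
        (fun t ht => (hder i t ht.1).continuousAt.continuousWithinAt)
    · intro i _; simp [W_zero]
    · intro i hi s hs hsT hpos hmax
      refine ⟨_, (hu.W_deriv hp i hs (by linarith)).sub (hder i s hs.le), ?_⟩
      rw [mem_lball] at hi
      have hlog : 0 ≤ Real.log (1 + s) := Real.log_nonneg (by linarith)
      have h1 : lapD h (fun z => W p u z s - ((10 * Real.log (1 + s)) * dsq h z y0 + s / Θ)) i ≤ 0 :=
        lapD_nonpos_of_max _ _ (fun e => by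
          by_cases he : i + st e ∈ lball hh y0 R
          · exact hmax _ he
          · rw [mem_lball, not_lt] at he
            have h2 := hu.W_le_log hp (i + st e) hs.le hsT (by linarith) (hb (i + st e))
            have h3 : 0 ≤ s / Θ := by positivity
            have h4 := mul_le_mul_of_nonneg_left he hlog
            nlinarith)
      rw [lapD_sub, lapD_add, lapD_mul_const, lapD_dsq hh, lapD_const] at h1
      have h2 := hu.q_le_exp hh hp i hs.le (by linarith)
      have h3 : Real.exp (lapD h (fun y => W p u y s) i) ≤ (1 + s) ^ (20 * n : ℕ) := by
        have : (1 + s) ^ (20 * n : ℕ) = Real.exp ((20 * n : ℕ) * Real.log (1 + s)) := by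
          rw [Real.exp_nat_mul, Real.exp_log (by linarith)]
        rw [this]; apply Real.exp_le_exp.mpr; push_cast; linarith
      have h4 : (1 + s) ^ (20 * n : ℕ) ≤ (1 + 2 * Θ) ^ (20 * n : ℕ) := by
        apply pow_le_pow_left₀ (by linarith); linarith
      have hfar : R ^ 2 ≤ dsq h i 0 := by
        by_contra hc
        push Not at hc
        have h5 := dsq_tri hR.le hR.le (by rw [dsq_comm]; exact hi.le) hc.le
        have h6 : dsq h y0 0 < (2 * R) ^ 2 := by
          have h7 : dsq h i y0 ≤ R ^ 2 := hi.le
          -- strict version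
          have h8 : Real.sqrt (dsq h i y0) < R := by
            rw [Real.sqrt_lt' hR]; exact hi
          have h9 := dsq_tri (x := y0) (y := i) (z := 0) (h := h) (Real.sqrt_nonneg (dsq h i y0)) hR.le
            (by rw [Real.sq_sqrt (dsq_nonneg _ _ _), dsq_comm]) hc.le
          have h10 : (Real.sqrt (dsq h i y0) + R) ^ 2 < (2 * R) ^ 2 := by
            apply pow_lt_pow_left₀ (by linarith) (by positivity) (by norm_num)
          linarith
        linarith
      have h5 := htail i hfar
      have h6 : u i s ^ p ≤ 1 / Θ := by
        rw [le_div_iff₀ (by linarith)]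
        have h7 : u i s ^ p ≤ u i 0 ^ p * (1 + 2 * Θ) ^ (20 * n : ℕ) :=
          h2.trans (mul_le_mul_of_nonneg_left (h3.trans h4) (hq i 0 le_rfl (by linarith)))
        exact (mul_le_mul_of_nonneg_right h7 (by linarith)).trans h5
      have h7 : 0 ≤ 10 * (1 / (1 + s)) * dsq h i y0 := by
        have := dsq_nonneg h i y0; positivity
      linarith
  have h1 := key y0 (by rw [mem_lball, dsq_self]; positivity) (2 * ts) ⟨by linarith, le_rfl⟩
  rw [dsq_self] at h1
  have h2 : W p u y0 (2 * ts) - W p u y0 ts ≥ ts * (u y0 ts ^ p / 2) := by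
    have := le_of_deriv_nonpos (g := fun t => (u y0 ts ^ p / 2) * t - W p u y0 t) (a := ts) (b := 2 * ts) (by linarith)
      ((by fun_prop : Continuous (fun t : ℝ => (u y0 ts ^ p / 2) * t)).continuousOn.sub
        ((hu.W_cont hp (by linarith) y0).mono (Icc_subset_Icc hts0.le (by linarith)))) ?_
    · linarith
    · intro t ht1 ht2
      have h3 : HasDerivAt (fun t : ℝ => (u y0 ts ^ p / 2) * t) (u y0 ts ^ p / 2) t := by
        simpa using (hasDerivAt_id t).const_mul (u y0 ts ^ p / 2)
      refine ⟨_, h3.sub (hu.W_deriv hp y0 (by linarith) (by linarith)), ?_⟩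
      have h4 := hu.ab_pow hp y0 hts0 ht1.le (by linarith)
      have h5 := hq y0 t (by linarith) (by linarith)
      have h6 : t * u y0 t ^ p ≤ (2 * ts) * u y0 t ^ p := mul_le_mul_of_nonneg_right ht2.le h5
      have h7 : ts * u y0 ts ^ p ≤ ts * (2 * u y0 t ^ p) := by linarith
      have h8 := le_of_mul_le_mul_left h7 hts0
      linarith
  have h3 : 0 ≤ W p u y0 ts := by
    unfold W
    apply intervalIntegral.integral_nonneg hts0.le
    intro s hs; exact hq y0 s hs.1 (by linarith [hs.2])
  have h4 : ts * (u y0 ts ^ p / 2) ≤ ts * (2 / Θ) := by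
    have : ts * (2 / Θ) = 2 * ts / Θ := by ring
    rw [this]; linarith
  have h5 := le_of_mul_le_mul_left h4 hts0
  have : 4 / Θ = 2 * (2 / Θ) := by ring
  rw [this]; linarith

lemma inner (hn : 1 ≤ n) (hh : 0 < h) (hp : 1 ≤ p) (hM : 0 ≤ M) (hu : LatSol n h p M T S u) {Θ R ts : ℝ} (hΘ : 1 ≤ Θ)
    (hΘT : 2 * Θ < T) (hR : 0 < R) (hR2 : 6 ≤ R ^ 2) (hMR : M ^ p ≤ 2 * R ^ 2) (h4R : 4 * h ≤ R)
    (hts0 : 0 ≤ ts) (hts : ts ≤ Θ)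
    (hfar : ∀ y s, 0 ≤ s → s ≤ ts → (2 * R) ^ 2 ≤ dsq h y 0 → u y s ^ p ≤ 4 / Θ ∨ s = 0)
    (x : Lt n) : (1 + ts) * u x ts ^ p ≤ 4 * R ^ 2 := by
  have hq : ∀ x s, 0 ≤ s → s ≤ T → 0 ≤ u x s ^ p := fun x s h0 h1 => Real.rpow_nonneg (hu.nonneg x s h0 h1) p
  have hqM : ∀ x s, 0 ≤ s → s ≤ T → u x s ^ p ≤ M ^ p := fun x s h0 h1 =>
    Real.rpow_le_rpow (hu.nonneg x s h0 h1) (hu.le x s h0 h1) (by linarith)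
  rcases hts0.eq_or_lt with rfl | hts1
  · have := hqM x 0 le_rfl (by linarith); nlinarith
  have hΘ2 : ∀ s, 0 ≤ s → s ≤ Θ → 4 / Θ ≤ 8 / (1 + s) := by
    intro s h0 h1
    rw [div_le_div_iff₀ (by linarith) (by linarith)]; linarith
  by_cases hx : x ∈ lball hh (0 : Lt n) (2 * R)
  swap
  · rw [mem_lball, not_lt] at hx
    rcases hfar x ts hts1.le le_rfl hx with h1 | h1
    · have h2 := h1.trans (hΘ2 ts hts1.le hts)
      rw [le_div_iff₀ (by linarith)] at h2
      nlinarith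
    · linarith
  have hder : ∀ (i : Lt n) t, 0 ≤ t → HasDerivAt (fun t => (1 + t)⁻¹ * (4 * R ^ 2 - dsq h i 0 / 2)) (-(1 + t)⁻¹ * ((1 + t)⁻¹ * (4 * R ^ 2 - dsq h i 0 / 2))) t := by
    intro i t ht
    have h1 : HasDerivAt (fun t : ℝ => (1 + t)⁻¹) (-1 / (1 + t) ^ 2) t :=
      ((hasDerivAt_id t).const_add 1).inv (by simp; positivity)
    have h2 := h1.mul_const (4 * R ^ 2 - dsq h i 0 / 2)
    have : -1 / (1 + t) ^ 2 = -(1 + t)⁻¹ * (1 + t)⁻¹ := by field_simp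
    rw [this, mul_assoc] at h2
    exact h2
  have := max_principle (lball hh (0 : Lt n) (2 * R)) (fun x t => u x t ^ p - (1 + t)⁻¹ * (4 * R ^ 2 - dsq h x 0 / 2)) 0 ts 0 ?_ ?_ ?_ x hx ts ⟨hts0, le_rfl⟩
  · have h1 : (1 + ts)⁻¹ * (4 * R ^ 2 - dsq h x 0 / 2) ≤ (1 + ts)⁻¹ * (4 * R ^ 2) :=
      mul_le_mul_of_nonneg_left (by linarith [dsq_nonneg h x 0]) (by positivity)
    have h2 : u x ts ^ p ≤ (1 + ts)⁻¹ * (4 * R ^ 2) := by linarith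
    have h3 := mul_le_mul_of_nonneg_left h2 (by linarith : 0 ≤ 1 + ts)
    rw [← mul_assoc, mul_inv_cancel₀ (by linarith), one_mul] at h3
    exact h3
  · intro i _
    exact ((hu.q_cont hp i).mono (Icc_subset_Icc_right (by linarith))).sub
        (fun t ht => (hder i t ht.1).continuousAt.continuousWithinAt)
  · intro i hi
    rw [mem_lball] at hi
    have := hqM i 0 le_rfl (by linarith)
    simp only [add_zero, inv_one, one_mul]
    nlinarith
  · intro i hi s hs hsT hpos hmax
    obtain ⟨d, hd, hle⟩ := hu.q_deriv hh hp i hs.le (by linarith)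
    refine ⟨_, hd.sub (hder i s hs.le), ?_⟩
    rw [mem_lball] at hi
    have hinv : 0 < (1 + s)⁻¹ := by positivity
    have h1 : lapD h (fun z => u z s ^ p - ((-((1 + s)⁻¹ / 2)) * dsq h z 0 + (1 + s)⁻¹ * (4 * R ^ 2))) i ≤ 0 :=
        lapD_nonpos_of_max _ _ (fun e => by
          by_cases he : i + st e ∈ lball hh (0 : Lt n) (2 * R)
          · have := hmax _ he
            linarith
          · rw [mem_lball, not_lt] at he
            have h2 : u (i + st e) s ^ p ≤ 8 * (1 + s)⁻¹ := by
              rcases hfar _ s hs.le hsT he with h3 | h3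
              · exact h3.trans ((hΘ2 s hs.le (by linarith)).trans (by rw [div_eq_mul_inv]))
              · linarith
            have h3 := dsq_step_le hh.le (by linarith : 0 ≤ 2 * R) hi.le e
            have h4 : (2 * R + h) ^ 2 ≤ 6 * R ^ 2 - 4 := by nlinarith
            have h5 : (1 + s)⁻¹ * dsq h (i + st e) 0 ≤ (1 + s)⁻¹ * (6 * R ^ 2 - 4) :=
              mul_le_mul_of_nonneg_left (h3.trans h4) hinv.le
            have h6 : (1 + s)⁻¹ * 6 ≤ (1 + s)⁻¹ * R ^ 2 := mul_le_mul_of_nonneg_left hR2 hinv.le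
            nlinarith)
    rw [lapD_sub, lapD_add, lapD_mul_const, lapD_dsq hh, lapD_const] at h1
    have hqi := hq i s hs.le (by linarith)
    have hn' : (1 : ℝ) ≤ n := by exact_mod_cast hn
    have h2 : lapD h (fun z => u z s ^ p) i ≤ - (1 + s)⁻¹ := by nlinarith
    have h3 := mul_le_mul_of_nonneg_left h2 hqi
    nlinarith

lemma decay (hn : 1 ≤ n) (hh : 0 < h) (hp : 1 ≤ p) (hM : 0 ≤ M) (hu : LatSol n h p M T S u) {Θ R : ℝ} (hΘ : 1 ≤ Θ)
    (hΘT : 2 * Θ < T) (hR : 0 < R) (hR2 : 6 ≤ R ^ 2) (hMR : M ^ p ≤ 2 * R ^ 2) (h4R : 4 * h ≤ R)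
    (htail : ∀ x, R ^ 2 ≤ dsq h x 0 → u x 0 ^ p * (1 + 2 * Θ) ^ (20 * n : ℕ) * Θ ≤ 1) (x : Lt n) :
    (1 + Θ) * u x Θ ^ p ≤ 4 * R ^ 2 := by
  have hq : ∀ x s, 0 ≤ s → s ≤ T → 0 ≤ u x s ^ p := fun x s h0 h1 => Real.rpow_nonneg (hu.nonneg x s h0 h1) p
  have hqM : ∀ x s, 0 ≤ s → s ≤ T → u x s ^ p ≤ M ^ p := fun x s h0 h1 =>
    Real.rpow_le_rpow (hu.nonneg x s h0 h1) (hu.le x s h0 h1) (by linarith)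
  -- monotone sup for q
  have hmono : ∀ s t A, 0 ≤ s → s ≤ t → t ≤ T → 0 ≤ A → (∀ x, u x s ^ p ≤ A) → ∀ x, u x t ^ p ≤ A := by
    intro s t A h0 h1 h2 hA h3 x
    have h4 : ∀ x, u x s ≤ A ^ (1 / p) := fun x => by
      have := Real.rpow_le_rpow (hq x s h0 (by linarith)) (h3 x) (by positivity : 0 ≤ 1 / p)
      rwa [← Real.rpow_mul (hu.nonneg x s h0 (by linarith)), mul_one_div_cancel (by linarith), Real.rpow_one] at this
    have h5 := hu.sup_mono hp h0 h1 h2 (Real.rpow_nonneg hA _) h4 x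
    have h6 := Real.rpow_le_rpow (hu.nonneg x t (by linarith) h2) h5 (by linarith : 0 ≤ p)
    rwa [← Real.rpow_mul hA, one_div_mul_cancel (by linarith), Real.rpow_one] at h6
  have step : ∀ ts, 0 ≤ ts → ts ≤ Θ → (∀ s, 0 ≤ s → s ≤ ts → ∀ x, (1 + s) * u x s ^ p ≤ 5 * R ^ 2) →
      ∀ x, (1 + ts) * u x ts ^ p ≤ 4 * R ^ 2 := by
    intro ts h0 h1 hC x
    refine hu.inner hn hh hp hM hΘ hΘT hR hR2 hMR h4R h0 h1 ?_ x
    intro y s hs hst hy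
    rcases hs.eq_or_lt with h2 | h2
    · exact Or.inr h2.symm
    left
    refine hu.far hh hp hΘ hΘT hR htail h2 (by linarith) ?_ y hy
    intro z r hr hr2
    rcases le_total r s with h3 | h3
    · have := hC r hr (by linarith) z; nlinarith
    · have h4 : ∀ x, u x s ^ p ≤ 5 * R ^ 2 / (1 + s) := fun x => by
        rw [le_div_iff₀ (by linarith)]; linarith [hC s hs hst x]
      have h5 := hmono s r _ hs h3 (by linarith) (by positivity) h4 z
      rw [le_div_iff₀ (by linarith)] at h5
      have h6 := hq z r hr (by linarith)
      nlinarith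
  have claim : ∀ k : ℕ, ∀ s, 0 ≤ s → s ≤ Θ → s ≤ k / 4 → ∀ x, (1 + s) * u x s ^ p ≤ 5 * R ^ 2 := by
    intro k
    induction k with
    | zero =>
      intro s h0 h1 h2 x
      have : s = 0 := by simp at h2; linarith
      subst this
      have := hqM x 0 le_rfl (by linarith)
      nlinarith
    | succ k ih =>
      intro s h0 h1 h2 x
      rcases le_total s (k / 4) with h3 | h3
      · exact ih s h0 h1 h3 x
      · have hk0 : (0:ℝ) ≤ k / 4 := by positivity
        have h4 := step (k / 4) hk0 (by linarith) (fun r hr hr2 => ih r hr (by linarith) hr2)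
        have h5 : ∀ x, u x (k / 4) ^ p ≤ 4 * R ^ 2 / (1 + k / 4) := fun x => by
          rw [le_div_iff₀ (by linarith)]; linarith [h4 x]
        have h6 := hmono (k / 4) s _ hk0 h3 (by linarith) (by positivity) h5 x
        rw [le_div_iff₀ (by linarith)] at h6
        have h7 := hq x s h0 (by linarith)
        push_cast at h2
        nlinarith
  obtain ⟨k, hk⟩ := exists_nat_ge (Θ * 4)
  exact step Θ (by linarith) le_rfl (fun s h0 h1 => claim k s h0 h1 (by linarith)) x

end LatSol

open Real Set MeasureTheory Metric Filter

section GradEst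
variable {n : ℕ}

/-- flip direction in coordinate i -/
def flipDr (i : Fin n) (e : Dr n) : Dr n := if e.1 = i then (e.1, !e.2) else e

lemma flipDr_invol (i : Fin n) : Function.Involutive (flipDr i) := by
  intro e
  unfold flipDr
  by_cases h1 : e.1 = i <;> simp [h1]
  rw [← h1]

/-- reflection across the hyperplane x_i = c + 1/2 -/
def rfx (i : Fin n) (c : ℤ) (x : Lt n) : Lt n := Function.update x i (2 * c + 1 - x i)

lemma rfx_st (i : Fin n) (c : ℤ) (x : Lt n) (e : Dr n) :
    rfx i c (x + st e) = rfx i c x + st (flipDr i e) := by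
  funext j
  unfold rfx flipDr st
  by_cases hj : j = i
  · subst hj
    by_cases he : e.1 = j
    · subst he
      rcases e with ⟨k, b⟩
      cases b <;> simp [sgn] <;> ring
    · have : (Pi.single e.1 (sgn e) : Lt n) j = 0 := Pi.single_eq_of_ne (Ne.symm he) _
      simp [he, this]
  · by_cases he : e.1 = i
    · have h1 : (Pi.single e.1 (sgn e) : Lt n) j = 0 := Pi.single_eq_of_ne (by rw [he]; exact hj) _
      simp only [Function.update_of_ne hj, Pi.add_apply, he, if_true] at h1 ⊢
      rw [h1, Pi.single_eq_of_ne hj]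
    · simp only [Function.update_of_ne hj, Pi.add_apply, he, if_false]

lemma lapD_rfx (h : ℝ) (i : Fin n) (c : ℤ) (V : Lt n → ℝ) (x : Lt n) :
    lapD h (fun y => V (rfx i c y)) x = lapD h V (rfx i c x) := by
  unfold lapD
  simp only [rfx_st]
  exact Equiv.sum_comp (flipDr_invol i).toPerm (fun e => (V (rfx i c x + st e) - V (rfx i c x)) / h ^ 2)

lemma lapD_coord (h : ℝ) (i : Fin n) (F : ℤ → ℝ) (x : Lt n) :
    lapD h (fun y => F (y i)) x = (F (x i + 1) + F (x i - 1) - 2 * F (x i)) / h ^ 2 := by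
  unfold lapD
  rw [sum_Dr, Finset.sum_eq_single i]
  · have h1 : (x + st ((i, true) : Dr n)) i = x i + 1 := by simp [st, sgn]
    have h2 : (x + st ((i, false) : Dr n)) i = x i - 1 := by simp [st, sgn]; ring
    beta_reduce
    rw [h1, h2]; ring
  · intro j _ hj
    have h1 : ∀ b, (x + st ((j, b) : Dr n)) i = x i := fun b => by
      simp only [Pi.add_apply, st]
      rw [Pi.single_eq_of_ne (Ne.symm hj)]; simp
    beta_reduce
    rw [h1, h1]; ring
  · intro hi; exact absurd (Finset.mem_univ i) hi

/-- squared distance to midpoint -/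
noncomputable def dmid (h : ℝ) (i : Fin n) (c x : Lt n) : ℝ :=
  dsq h x c + (h ^ 2 / 4 - h * (h * ((x i : ℝ) - c i)))

lemma dsq_rfx (h : ℝ) (i : Fin n) (c x : Lt n) :
    dsq h (rfx i (c i) x) c = dsq h x c + (h ^ 2 - 2 * h * (h * ((x i : ℝ) - c i))) := by
  unfold dsq
  rw [← Finset.add_sum_erase _ _ (Finset.mem_univ i), ← Finset.add_sum_erase _ _ (Finset.mem_univ i)]
  have : ∑ j ∈ Finset.univ.erase i, (h * ((rfx i (c i) x j : ℝ) - (c j : ℝ))) ^ 2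
      = ∑ j ∈ Finset.univ.erase i, (h * ((x j : ℝ) - (c j : ℝ))) ^ 2 := by
    refine Finset.sum_congr rfl (fun j hj => ?_)
    simp only [rfx]
    rw [Function.update_of_ne (Finset.ne_of_mem_erase hj)]
  rw [this]
  simp only [rfx, Function.update_self]
  push_cast
  ring

lemma dmid_rfx (h : ℝ) (i : Fin n) (c x : Lt n) : dmid h i c (rfx i (c i) x) = dmid h i c x := by
  unfold dmid
  rw [dsq_rfx]
  simp only [rfx, Function.update_self]
  push_cast; ring

lemma dmid_ge (h : ℝ) (i : Fin n) (c x : Lt n) : (h * ((x i : ℝ) - c i) - h / 2) ^ 2 ≤ dmid h i c x := by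
  have := dsq_coord h x c i
  unfold dmid; linarith

lemma dsq_le_of_dmid {h : ℝ} (hh : 0 ≤ h) {i : Fin n} {c x : Lt n} {r : ℝ} (hr : 0 ≤ r)
    (hx : dmid h i c x ≤ r ^ 2) : dsq h x c ≤ (r + h / 2) ^ 2 := by
  have h1 := abs_le_of_sq_le_sq' ((dmid_ge h i c x).trans hx) hr
  unfold dmid at hx
  nlinarith [h1.2]

lemma lapD_dmid {h : ℝ} (hh : 0 < h) (i : Fin n) (c x : Lt n) :
    lapD h (fun y => dmid h i c y) x = 2 * n := by
  unfold dmid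
  rw [lapD_add, lapD_dsq hh, lapD_coord h i (fun z => h ^ 2 / 4 - h * (h * ((z : ℝ) - c i)))]
  push_cast
  ring

/-- Interior gradient estimate, one direction. -/
lemma grad_pos {h ρ A B : ℝ} (hh : 0 < h) (hhρ : h ≤ ρ) (hA : 0 < A) (hB : 0 ≤ B) (V : Lt n → ℝ)
    (c : Lt n) (i : Fin n) (hosc : ∀ x y, dsq h x c ≤ (3 * ρ) ^ 2 → dsq h y c ≤ (3 * ρ) ^ 2 → V x - V y ≤ A)
    (hlap : ∀ x, dsq h x c ≤ (3 * ρ) ^ 2 → |lapD h V x| ≤ B) :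
    V (c + st (i, true)) - V c ≤ h * (B * ρ + (n + 2) * A / ρ) := by
  have hρ : 0 < ρ := hh.trans_le hhρ
  set a := A / ρ ^ 2 with ha
  have ha0 : 0 < a := by positivity
  have haρ : a * ρ ^ 2 = A := by rw [ha]; field_simp
  set K := B + (n + 1) * a with hK
  have hK0 : 0 < K := by positivity
  let σ := rfx i (c i)
  let s : Lt n → ℝ := fun x => h * ((x i : ℝ) - c i) - h / 2
  let bar : Lt n → ℝ := fun x => a * dmid h i c x + K * (2 * ρ * s x - s x ^ 2 + h ^ 2 / 4)
  let f : Lt n → ℝ := fun x => (V x - V (σ x)) - bar x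
  let D : Finset (Lt n) := (lball hh c (2 * ρ)).filter (fun x => c i < x i ∧ dmid h i c x < ρ ^ 2)
  have memD : ∀ x, x ∈ D ↔ c i < x i ∧ dmid h i c x < ρ ^ 2 := by
    intro x
    simp only [D, Finset.mem_filter, mem_lball]
    refine ⟨fun h => h.2, fun h2 => ⟨?_, h2⟩⟩
    refine (dsq_le_of_dmid hh.le hρ.le h2.2.le).trans_lt ?_
    apply pow_lt_pow_left₀ (by linarith) (by positivity) (by norm_num)
  have hlb : ∀ x, lapD h bar x = 2 * n * a - 2 * K := by
    intro x
    have e1 : lapD h bar x = a * (2 * n) + K * (-2) := by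
      simp only [bar]
      rw [lapD_add, lapD_mul_const, lapD_dmid hh, lapD_mul_const]
      rw [lapD_coord h i (fun z => 2 * ρ * (h * ((z : ℝ) - c i) - h / 2) - (h * ((z : ℝ) - c i) - h / 2) ^ 2 + h ^ 2 / 4)]
      push_cast
      congr 1
      field_simp
      ring
    rw [e1]; ring
  have main := elliptic_mp hh D f ?_ ?_ (c + st (i, true)) ?_
  · have e1 : σ (c + st (i, true)) = c := by
      funext j
      simp only [σ, rfx]
      by_cases hj : j = i
      · subst hj; simp [st, sgn]; ring
      · rw [Function.update_of_ne hj]; simp [st, hj]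
    have e2 : ((c + st (i, true)) i : ℤ) = c i + 1 := by simp [st, sgn]
    simp only [f, e1, bar, s, dmid, dsq_st, e2] at main
    push_cast at main
    have h1 : h * a * h ≤ h * a * ρ := mul_le_mul_of_nonneg_left hhρ (by positivity)
    have h2 : (n + 2) * A / ρ = (n + 2) * a * ρ := by rw [← haρ]; field_simp
    rw [h2]
    have : a * (h ^ 2 / 4) + K * ρ * h ≤ h * (B * ρ + (n + 2) * a * ρ) := by
      rw [hK]; nlinarith
    nlinarith
  · intro x hx _
    rw [memD] at hx
    simp only [f]
    rw [lapD_sub, lapD_sub, lapD_rfx, hlb]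
    have d1 : dsq h x c ≤ (3 * ρ) ^ 2 := by
      refine (dsq_le_of_dmid hh.le hρ.le hx.2.le).trans ?_
      apply pow_le_pow_left₀ (by positivity); linarith
    have d2 : dsq h (σ x) c ≤ (3 * ρ) ^ 2 := by
      refine (dsq_le_of_dmid (i := i) hh.le hρ.le (by rw [dmid_rfx]; exact hx.2.le)).trans ?_
      apply pow_le_pow_left₀ (by positivity); linarith
    have h1 := (abs_le.mp (hlap x d1)).1
    have h2 := (abs_le.mp (hlap _ d2)).2
    rw [hK]
    simp only [σ] at h2 ⊢
    nlinarith
  · intro x hx hfx e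
    rw [memD] at hx
    by_cases hD : x + st e ∈ D
    · exact Or.inl hD
    right
    have dx := dsq_le_of_dmid hh.le hρ.le hx.2.le
    have dσ : dsq h (σ x) c ≤ (ρ + h / 2) ^ 2 := dsq_le_of_dmid (i := i) hh.le hρ.le (by rw [dmid_rfx]; exact hx.2.le)
    by_cases hc : c i < (x + st e) i
    · have hdm : ρ ^ 2 ≤ dmid h i c (x + st e) := by
        by_contra hcon
        exact hD ((memD _).mpr ⟨hc, not_le.mp hcon⟩)
      have d1 := dsq_step_le hh.le (by linarith : 0 ≤ ρ + h / 2) dx e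
      have d2 : dsq h (σ (x + st e)) c ≤ (ρ + h / 2 + h) ^ 2 := by
        have := dsq_step_le hh.le (by linarith : 0 ≤ ρ + h / 2) dσ (flipDr i e)
        rw [← rfx_st] at this; exact this
      have h3 : (ρ + h / 2 + h) ^ 2 ≤ (3 * ρ) ^ 2 := by
        apply pow_le_pow_left₀ (by positivity); linarith
      have h4 := hosc _ _ (d1.trans h3) (d2.trans h3)
      have hs0 : 0 ≤ s (x + st e) := by
        have : (c i : ℝ) + 1 ≤ ((x + st e) i : ℤ) := by exact_mod_cast hc
        simp only [s]; nlinarith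
      have hs1 : s (x + st e) ≤ 2 * ρ := by
        have := abs_le_of_sq_le_sq' ((dsq_coord h (x + st e) c i).trans d1) (by positivity)
        simp only [s]; linarith [this.2]
      have h5 : 0 ≤ 2 * ρ * s (x + st e) - s (x + st e) ^ 2 + h ^ 2 / 4 := by nlinarith
      have h6 := mul_nonneg hK0.le h5
      have h7 := mul_le_mul_of_nonneg_left hdm ha0.le
      have : f (x + st e) ≤ 0 := by
        simp only [f, bar]; linarith
      linarith
    · have hst : (st e) i = -1 ∧ x i = c i + 1 ∧ e = (i, false) := by
        rcases e with ⟨j, b⟩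
        by_cases hj : j = i
        · subst hj
          cases b
          · have : st ((j, false) : Dr n) j = -1 := by simp [st, sgn]
            simp only [Pi.add_apply, this] at hc
            exact ⟨this, by omega, rfl⟩
          · have : st ((j, true) : Dr n) j = 1 := by simp [st, sgn]
            simp only [Pi.add_apply, this] at hc
            omega
        · have : st ((j, b) : Dr n) i = 0 := by
            simp only [st]; exact Pi.single_eq_of_ne (Ne.symm hj) _
          simp only [Pi.add_apply, this] at hc
          omega
      have hσ : x + st e = σ x := by
        funext j
        by_cases hj : j = i
        · subst hj
          simp only [Pi.add_apply, σ, rfx, Function.update_self, hst.1, hst.2.1]; ring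
        · simp only [σ, rfx]
          rw [Function.update_of_ne hj, hst.2.2]
          simp [st, hj]
      have hσσ : σ (σ x) = x := by
        funext j
        by_cases hj : j = i
        · subst hj; simp [σ, rfx]
        · simp only [σ, rfx]; rw [Function.update_of_ne hj, Function.update_of_ne hj]
      have hx1 : s x = h / 2 := by simp only [s, hst.2.1]; push_cast; ring
      have hx2 : s (σ x) = -h / 2 := by
        simp only [s, σ, rfx, Function.update_self, hst.2.1]; push_cast; ring
      rw [hσ]
      simp only [f, bar] at hfx ⊢
      rw [hσσ, hx2, hx1]
      rw [hx1] at hfx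
      have e1 : dmid h i c (σ x) = dmid h i c x := dmid_rfx h i c x
      rw [e1]
      have h8 : 0 ≤ a * dmid h i c x := mul_nonneg ha0.le ((sq_nonneg _).trans (dmid_ge h i c x))
      nlinarith
  · rw [memD]
    have e2 : ((c + st (i, true)) i : ℤ) = c i + 1 := by simp [st, sgn]
    refine ⟨by omega, ?_⟩
    simp only [dmid, dsq_st, e2]
    push_cast
    nlinarith

/-- Interior gradient estimate. -/
lemma grad_est {h ρ A B : ℝ} (hh : 0 < h) (hhρ : h ≤ ρ) (hA : 0 < A) (hB : 0 ≤ B) (V : Lt n → ℝ)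
    (c : Lt n) (e : Dr n) (hosc : ∀ x y, dsq h x c ≤ (4 * ρ) ^ 2 → dsq h y c ≤ (4 * ρ) ^ 2 → V x - V y ≤ A)
    (hlap : ∀ x, dsq h x c ≤ (4 * ρ) ^ 2 → |lapD h V x| ≤ B) :
    |V (c + st e) - V c| ≤ h * (B * ρ + (n + 2) * A / ρ) := by
  have hρ : 0 < ρ := hh.trans_le hhρ
  have h34 : (3 * ρ) ^ 2 ≤ (4 * ρ) ^ 2 := by nlinarith
  have hlap' : ∀ x, lapD h (fun y => - V y) x = - lapD h V x := fun x => lapD_neg h V x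
  rcases e with ⟨i, b⟩
  cases b
  · set c' := c + st ((i, false) : Dr n) with hc'
    have e1 : c' + st ((i, true) : Dr n) = c := by
      funext j
      simp only [hc', Pi.add_apply, st, sgn]
      by_cases hj : j = i
      · subst hj; simp
      · simp [hj]
    have hd : ∀ x, dsq h x c' ≤ (3 * ρ) ^ 2 → dsq h x c ≤ (4 * ρ) ^ 2 := by
      intro x hx
      have := dsq_tri (by positivity) hh.le hx (dsq_st h c (i, false)).le
      refine this.trans ?_
      apply pow_le_pow_left₀ (by positivity); linarith
    have h1 := grad_pos hh hhρ hA hB V c' i (fun x y hx hy => hosc x y (hd x hx) (hd y hy)) (fun x hx => hlap x (hd x hx))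
    have h2 := grad_pos hh hhρ hA hB (fun y => - V y) c' i (fun x y hx hy => by linarith [hosc y x (hd y hy) (hd x hx)])
      (fun x hx => by rw [hlap', abs_neg]; exact hlap x (hd x hx))
    rw [e1] at h1 h2
    rw [abs_le]; constructor <;> linarith
  · have h1 := grad_pos hh hhρ hA hB V c i (fun x y hx hy => hosc x y (hx.trans h34) (hy.trans h34)) (fun x hx => hlap x (hx.trans h34))
    have h2 := grad_pos hh hhρ hA hB (fun y => - V y) c i (fun x y hx hy => by linarith [hosc y x (hy.trans h34) (hx.trans h34)])
      (fun x hx => by rw [hlap', abs_neg]; exact hlap x (hx.trans h34))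
    rw [abs_le]; constructor <;> linarith

end GradEst

open Real Set MeasureTheory Metric Filter

section PathL
variable {n : ℕ}

/-- coordinatewise betweenness -/
def betw (z x y : Lt n) : Prop := ∀ i, z i ∈ Set.uIcc (x i) (y i)

lemma path_nat (f : Lt n → ℝ) (L : ℝ) (y : Lt n) : ∀ N : ℕ, ∀ x : Lt n,
    (∑ i, (x i - y i).natAbs = N) →
    (∀ z e, betw z x y → betw (z + st e) x y → |f (z + st e) - f z| ≤ L) →
    |f x - f y| ≤ L * N := by
  intro N
  induction N with
  | zero =>
    intro x hx _
    have : x = y := by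
      funext i
      have := (Finset.sum_eq_zero_iff.mp hx) i (Finset.mem_univ i)
      omega
    simp [this]
  | succ N ih =>
    intro x hx hf
    have hex : ∃ i, x i ≠ y i := by
      by_contra hcon
      push Not at hcon
      simp [hcon] at hx
    obtain ⟨i, hi⟩ := hex
    have key : ∃ e : Dr n, e.1 = i ∧ ((x i < y i ∧ sgn e = 1) ∨ (y i < x i ∧ sgn e = -1)) := by
      rcases lt_or_gt_of_ne hi with h | h
      · exact ⟨(i, true), rfl, Or.inl ⟨h, by simp [sgn]⟩⟩
      · exact ⟨(i, false), rfl, Or.inr ⟨h, by simp [sgn]⟩⟩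
    obtain ⟨e, hei, hs⟩ := key
    have hci : (x + st e) i = x i + sgn e := by simp [st, hei]
    have hcj : ∀ j, j ≠ i → (x + st e) j = x j := fun j hj => by
      simp only [Pi.add_apply, st]
      rw [Pi.single_eq_of_ne (by rw [hei]; exact hj)]; simp
    have hb : ∀ z, betw z (x + st e) y → betw z x y := by
      intro z hz j
      have h1 := hz j
      by_cases hj : j = i
      · subst hj
        rw [hci] at h1
        rw [Set.mem_uIcc] at h1 ⊢
        omega
      · rw [hcj j hj] at h1; exact h1
    have hsum : ∑ j, ((x + st e) j - y j).natAbs = N := by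
      rw [← Finset.add_sum_erase _ _ (Finset.mem_univ i)] at hx ⊢
      have h2 : ∑ j ∈ Finset.univ.erase i, ((x + st e) j - y j).natAbs
        = ∑ j ∈ Finset.univ.erase i, (x j - y j).natAbs :=
        Finset.sum_congr rfl (fun j hj => by rw [hcj j (Finset.ne_of_mem_erase hj)])
      rw [h2, hci]
      omega
    have h1 := ih (x + st e) hsum (fun z e' hz hz' => hf z e' (hb z hz) (hb _ hz'))
    have h2 := hf x e (fun j => Set.left_mem_uIcc) (hb _ (fun j => Set.left_mem_uIcc))
    have h3 : |f x - f y| ≤ |f (x + st e) - f x| + |f (x + st e) - f y| := by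
      have := abs_sub_le (f x) (f (x + st e)) (f y)
      rw [abs_sub_comm (f (x + st e)) (f x)]; exact this
    push_cast
    linarith

lemma path_lemma (f : Lt n → ℝ) (L : ℝ) (x y : Lt n)
    (hf : ∀ z e, betw z x y → betw (z + st e) x y → |f (z + st e) - f z| ≤ L) :
    |f x - f y| ≤ L * ∑ i, |(x i : ℝ) - y i| := by
  have := path_nat f L y _ x rfl hf
  refine this.trans (le_of_eq ?_)
  push_cast
  congr 1
  refine Finset.sum_congr rfl (fun i _ => ?_)
  rw [Nat.cast_natAbs]; push_cast; rfl

lemma betw_dsq {h : ℝ} {z x y : Lt n} (hz : betw z x y) : dsq h z y ≤ dsq h x y := by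
  unfold dsq
  refine Finset.sum_le_sum (fun i _ => ?_)
  rw [mul_pow, mul_pow]
  refine mul_le_mul_of_nonneg_left ?_ (sq_nonneg h)
  have h1 := hz i
  rw [Set.mem_uIcc] at h1
  rcases h1 with ⟨a, b⟩ | ⟨a, b⟩
  · have a' : (x i : ℝ) ≤ z i := by exact_mod_cast a
    have b' : (z i : ℝ) ≤ y i := by exact_mod_cast b
    nlinarith
  · have a' : (y i : ℝ) ≤ z i := by exact_mod_cast a
    have b' : (z i : ℝ) ≤ x i := by exact_mod_cast b
    nlinarith

/-- Lipschitz estimate to the center of a ball. -/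
lemma path_center {h r L : ℝ} (hh : 0 < h) (hr : 0 ≤ r) (hL : 0 ≤ L) (f : Lt n → ℝ) (c x : Lt n)
    (hx : dsq h x c ≤ r ^ 2)
    (hf : ∀ z e, dsq h z c ≤ r ^ 2 → |f (z + st e) - f z| ≤ h * L) :
    |f x - f c| ≤ L * (n * r) := by
  have h1 := path_lemma f (h * L) x c (fun z e hz _ => hf z e ((betw_dsq hz).trans hx))
  refine h1.trans ?_
  have h2 : ∀ i, h * |(x i : ℝ) - c i| ≤ r := fun i => by
    have := abs_le_of_sq_le_sq ((dsq_coord h x c i).trans hx) hr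
    rwa [abs_mul, abs_of_pos hh] at this
  have h3 : h * ∑ i, |(x i : ℝ) - c i| ≤ n * r := by
    rw [Finset.mul_sum]
    refine (Finset.sum_le_sum (fun i _ => h2 i)).trans ?_
    simp
  calc h * L * ∑ i, |(x i : ℝ) - c i| = L * (h * ∑ i, |(x i : ℝ) - c i|) := by ring
    _ ≤ _ := mul_le_mul_of_nonneg_left h3 hL

end PathL

open Real Set MeasureTheory Metric Filter

section OscA
variable {n : ℕ}

lemma exists_prim {g : ℝ → ℝ} {a b : ℝ} (hab : a ≤ b) (hg : ContinuousOn g (Icc a b)) :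
    ∃ G : ℝ → ℝ, ∀ t ∈ Icc a b, HasDerivAt G (g t) t := by
  have hc : Continuous (Set.IccExtend hab (Set.domRestrict (Icc a b) g)) :=
    (continuousOn_iff_continuous_domRestrict.mp hg).Icc_extend'
  refine ⟨fun t => ∫ s in a..t, Set.IccExtend hab (Set.domRestrict (Icc a b) g) s, fun t ht => ?_⟩
  have h1 : Set.IccExtend hab (Set.domRestrict (Icc a b) g) t = g t := by
    rw [Set.IccExtend_of_mem _ _ ht]; rfl
  rw [← h1]
  exact intervalIntegral.integral_hasDerivAt_right (hc.intervalIntegrable _ _)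
    hc.stronglyMeasurable.stronglyMeasurableAtFilter hc.continuousAt

lemma prim_ge {G g : ℝ → ℝ} {s t c : ℝ} (hst : s ≤ t) (hG : ∀ r ∈ Icc s t, HasDerivAt G (g r) r)
    (hg : ∀ r ∈ Icc s t, c ≤ g r) : c * (t - s) ≤ G t - G s := by
  have := le_of_deriv_nonpos (g := fun r => c * r - G r) hst
    (fun r hr => (((continuousAt_const.mul continuousAt_id).sub (hG r hr).continuousAt)).continuousWithinAt)
    (fun r h1 h2 => ⟨c * 1 - g r, ((hasDerivAt_id r).const_mul c).sub (hG r ⟨h1.le, h2.le⟩), by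
      linarith [hg r ⟨h1.le, h2.le⟩]⟩)
  linarith

lemma prim_le {G g : ℝ → ℝ} {s t c : ℝ} (hst : s ≤ t) (hG : ∀ r ∈ Icc s t, HasDerivAt G (g r) r)
    (hg : ∀ r ∈ Icc s t, g r ≤ c) : G t - G s ≤ c * (t - s) := by
  have := prim_ge (G := fun r => - G r) (g := fun r => - g r) (c := -c) hst
    (fun r hr => (hG r hr).neg) (fun r hr => by linarith [hg r hr])
  linarith

lemma prim_ex_ge {G g : ℝ → ℝ} {s t c : ℝ} (hst' : s < t) (hG : ∀ r ∈ Icc s t, HasDerivAt G (g r) r)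
    (hc : c * (t - s) ≤ G t - G s) : ∃ r ∈ Icc s t, c ≤ g r := by
  obtain ⟨r, hr, h⟩ := exists_hasDerivAt_eq_slope G g hst'
    (fun r hr => (hG r hr).continuousAt.continuousWithinAt) (fun r hr => hG r ⟨hr.1.le, hr.2.le⟩)
  refine ⟨r, ⟨hr.1.le, hr.2.le⟩, ?_⟩
  rw [h, le_div_iff₀ (by linarith)]; exact hc

lemma prim_ex_le {G g : ℝ → ℝ} {s t c : ℝ} (hst' : s < t) (hG : ∀ r ∈ Icc s t, HasDerivAt G (g r) r)
    (hc : G t - G s ≤ c * (t - s)) : ∃ r ∈ Icc s t, g r ≤ c := by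
  obtain ⟨r, hr, h⟩ := exists_hasDerivAt_eq_slope G g hst'
    (fun r hr => (hG r hr).continuousAt.continuousWithinAt) (fun r hr => hG r ⟨hr.1.le, hr.2.le⟩)
  refine ⟨r, ⟨hr.1.le, hr.2.le⟩, ?_⟩
  rw [h, div_le_iff₀ (by linarith)]; exact hc

lemma exists_phi (p : ℝ) : ∃ Φ : ℝ → ℝ, ∀ r, 0 < r → HasDerivAt Φ (r ^ (-p)) r := by
  by_cases hp : p = 1
  · refine ⟨Real.log, fun r hr => ?_⟩
    rw [hp, Real.rpow_neg_one]
    exact Real.hasDerivAt_log hr.ne'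
  · refine ⟨fun r => r ^ (1 - p) / (1 - p), fun r hr => ?_⟩
    have hne : 1 - p ≠ 0 := fun h => hp (by linarith)
    have := (Real.hasDerivAt_rpow_const (p := 1 - p) (Or.inl hr.ne')).div_const (1 - p)
    have e : (1 - p) * r ^ (1 - p - 1) / (1 - p) = r ^ (-p) := by
      rw [mul_div_assoc, mul_div_cancel₀ _ hne]
      congr 1; ring
    rwa [e] at this

lemma U_lap {h p m M a b : ℝ} {u U : Lt n → ℝ → ℝ} (hp : 1 ≤ p)
    (hd : ∀ x, ∀ t ∈ Icc a b, HasDerivAt (u x) (u x t ^ p * lapD h (fun y => u y t) x) t)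
    (hU : ∀ x, ∀ t ∈ Icc a b, HasDerivAt (U x) (u x t) t) (hm : 0 < m) (x : Lt n)
    (hlo : ∀ r ∈ Icc a b, m ≤ u x r) (hhi : ∀ r ∈ Icc a b, u x r ≤ M) {s t : ℝ} (hs : a ≤ s) (hst : s ≤ t) (ht : t ≤ b) :
    ∃ κ, M ^ (-p) ≤ κ ∧ κ ≤ m ^ (-p) ∧ lapD h (fun y => U y t - U y s) x = κ * (u x t - u x s) := by
  obtain ⟨Φ, hΦ⟩ := exists_phi p
  have hsub : Icc s t ⊆ Icc a b := Icc_subset_Icc hs ht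
  have hder : ∀ r ∈ Icc s t, HasDerivAt (fun r => Φ (u x r) - lapD h (fun y => U y r) x) 0 r := by
    intro r hr
    have hpos : 0 < u x r := hm.trans_le (hlo r (hsub hr))
    have h1 := (hΦ _ hpos).comp r (hd x r (hsub hr))
    have h2 := lapD_hasDerivAt h U (fun y => u y r) x r (fun y => hU y r (hsub hr))
    have h3 := h1.sub h2
    have e : u x r ^ (-p) * (u x r ^ p * lapD h (fun y => u y r) x) - lapD h (fun y => u y r) x = 0 := by
      rw [← mul_assoc, ← Real.rpow_add hpos]; simp
    rw [e] at h3
    exact h3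
  have hconst : Φ (u x t) - lapD h (fun y => U y t) x = Φ (u x s) - lapD h (fun y => U y s) x := by
    have h1 := prim_ge (c := 0) (g := fun _ => 0) hst hder (fun _ _ => le_rfl)
    have h2 := prim_le (c := 0) (g := fun _ => 0) hst hder (fun _ _ => le_rfl)
    linarith
  have hl : lapD h (fun y => U y t - U y s) x = Φ (u x t) - Φ (u x s) := by
    rw [lapD_sub]; linarith
  rw [hl]
  have hut := hlo t ⟨hs.trans hst, ht⟩
  have hus := hlo s ⟨hs, hst.trans ht⟩
  have hut' := hhi t ⟨hs.trans hst, ht⟩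
  have hus' := hhi s ⟨hs, hst.trans ht⟩
  have hM : 0 < M := by linarith
  have rp : ∀ ξ, m ≤ ξ → ξ ≤ M → M ^ (-p) ≤ ξ ^ (-p) ∧ ξ ^ (-p) ≤ m ^ (-p) := fun ξ h1 h2 =>
    ⟨Real.rpow_le_rpow_of_nonpos (hm.trans_le h1) h2 (by linarith), Real.rpow_le_rpow_of_nonpos hm h1 (by linarith)⟩
  have mvt : ∀ c d, m ≤ c → d ≤ M → c < d → ∃ κ, M ^ (-p) ≤ κ ∧ κ ≤ m ^ (-p) ∧ Φ d - Φ c = κ * (d - c) := by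
    intro c d hc hd' hcd
    obtain ⟨ξ, hξ, he⟩ := exists_hasDerivAt_eq_slope Φ (fun r => r ^ (-p)) hcd
      (fun r hr => (hΦ r (by linarith [hr.1])).continuousAt.continuousWithinAt) (fun r hr => hΦ r (by linarith [hr.1]))
    obtain ⟨h1, h2⟩ := rp ξ (by linarith [hξ.1]) (by linarith [hξ.2])
    refine ⟨_, h1, h2, ?_⟩
    rw [he, div_mul_cancel₀ _ (sub_pos.mpr hcd).ne']
  rcases lt_trichotomy (u x s) (u x t) with hlt | heq | hgt
  · exact mvt _ _ hus hut' hlt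
  · obtain ⟨h1, h2⟩ := rp _ hus hus'
    exact ⟨_, h1, h2, by rw [heq]; ring⟩
  · obtain ⟨κ, h1, h2, h3⟩ := mvt _ _ hut hus' hgt
    exact ⟨κ, h1, h2, by linarith⟩

end OscA

open Real Set MeasureTheory Metric Filter

section OscB
variable {n : ℕ}

lemma lapD_mul {h : ℝ} (hh : h ≠ 0) (f g : Lt n → ℝ) (x : Lt n) :
    lapD h (fun y => f y * g y) x = f x * lapD h g x + g x * lapD h f x + ∑ e, Dd h e f x * Dd h e g x := by
  unfold lapD Dd
  rw [Finset.mul_sum, Finset.mul_sum, ← Finset.sum_add_distrib, ← Finset.sum_add_distrib]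
  refine Finset.sum_congr rfl (fun e _ => ?_)
  field_simp
  ring

lemma Dd_dsq {h : ℝ} (hh : h ≠ 0) (x y : Lt n) (e : Dr n) :
    Dd h e (fun z => dsq h z y) x = 2 * (sgn e : ℝ) * (h * ((x e.1 : ℝ) - y e.1)) + h := by
  unfold Dd
  beta_reduce
  rw [dsq_step_eq]; field_simp; ring

lemma sum_Dd_dsq_sq {h : ℝ} (hh : h ≠ 0) (x y : Lt n) :
    ∑ e, Dd h e (fun z => dsq h z y) x * Dd h e (fun z => dsq h z y) x = 8 * dsq h x y + 2 * n * h ^ 2 := by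
  simp only [Dd_dsq hh]
  rw [sum_Dr]
  simp only [sgn]
  simp only [if_true, Bool.false_eq_true, if_false]
  push_cast
  have : ∀ i : Fin n, (2 * 1 * (h * ((x i : ℝ) - y i)) + h) * (2 * 1 * (h * ((x i : ℝ) - y i)) + h)
     + (2 * (-1) * (h * ((x i : ℝ) - y i)) + h) * (2 * (-1) * (h * ((x i : ℝ) - y i)) + h)
     = 8 * (h * ((x i : ℝ) - y i)) ^ 2 + 2 * h ^ 2 := by
    intro i; ring
  rw [Finset.sum_congr rfl (fun i _ => this i), Finset.sum_add_distrib, ← Finset.mul_sum]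
  simp [dsq]; ring

lemma lapD_g2 {h : ℝ} (hh : 0 < h) (q : ℝ) (x y : Lt n) :
    lapD h (fun z => (q - dsq h z y) * (q - dsq h z y)) x
      = -4 * n * (q - dsq h x y) + 8 * dsq h x y + 2 * n * h ^ 2 := by
  have hD : ∀ e, Dd h e (fun z => q - dsq h z y) x = - Dd h e (fun z => dsq h z y) x := by
    intro e; unfold Dd; ring
  have hl : lapD h (fun z => q - dsq h z y) x = - (2 * n) := by
    rw [lapD_sub, lapD_const, lapD_dsq hh]; ring
  rw [lapD_mul hh.ne', hl]
  simp only [hD, neg_mul_neg]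
  rw [sum_Dd_dsq_sq hh.ne']
  ring

/-- parabolic lower barrier -/
lemma par_barrier {h e κ2 σ B0 ts te : ℝ} (hh : 0 < h) (hhe : h ≤ e) (hκ2 : 0 < κ2) (hB0 : 0 ≤ B0) (hσ : 0 ≤ σ)
    (hte : ts ≤ te) (F : Lt n → ℝ → ℝ) (x0 : Lt n)
    (hF : ∀ x, dsq h x x0 < e ^ 2 → ∀ t ∈ Icc ts te, ∃ F' κ, HasDerivAt (F x) F' t ∧ 0 ≤ κ ∧ κ ≤ κ2 ∧
      κ * lapD h (fun y => F y t) x - 4 * σ ≤ F')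
    (hpos : ∀ x, dsq h x x0 ≤ (2 * e) ^ 2 → ∀ t ∈ Icc ts te, 0 ≤ F x t)
    (hini : ∀ x, dsq h x x0 < e ^ 2 → B0 ≤ F x ts) (z : Lt n) (hz : dsq h z x0 ≤ (e / 2) ^ 2) :
    B0 * Real.exp (-(κ2 * (4 * n + 8) ^ 2 / (8 * e ^ 2)) * (te - ts)) / 2 - 4 * σ * (te - ts) - B0 * (9 * h ^ 2 / e ^ 2)
      ≤ F z te := by
  have he : 0 < e := hh.trans_le hhe
  set lam := κ2 * (4 * n + 8) ^ 2 / (8 * e ^ 2) with hlam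
  have hlam0 : 0 < lam := by positivity
  have hlame : lam * (8 * e ^ 2) = κ2 * (4 * n + 8) ^ 2 := by rw [hlam]; field_simp
  let g : Lt n → ℝ := fun x => e ^ 2 - dsq h x x0
  let E : ℝ → ℝ := fun t => B0 * Real.exp (-lam * (t - ts)) / e ^ 4
  have hE0 : ∀ t, 0 ≤ E t := fun t => by positivity
  have hE1 : ∀ t, ts ≤ t → E t ≤ B0 / e ^ 4 := by
    intro t ht
    have : Real.exp (-lam * (t - ts)) ≤ 1 := Real.exp_le_one_iff.mpr (by nlinarith)
    simp only [E]
    gcongr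
    nlinarith
  let b : Lt n → ℝ → ℝ := fun x t => E t * (g x * g x) - 4 * σ * (t - ts) - B0 * (9 * h ^ 2 / e ^ 2)
  have hbd : ∀ x t, HasDerivAt (b x) (-lam * E t * (g x * g x) - 4 * σ) t := by
    intro x t
    have h1 : HasDerivAt (fun t => Real.exp (-lam * (t - ts))) (Real.exp (-lam * (t - ts)) * (-lam * 1)) t :=
      (((hasDerivAt_id t).sub_const ts).const_mul (-lam)).exp
    have h2 := ((((h1.const_mul B0).div_const (e ^ 4)).mul_const (g x * g x)).sub
      (((hasDerivAt_id t).sub_const ts).const_mul (4 * σ))).sub_const (B0 * (9 * h ^ 2 / e ^ 2))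
    have e1 : B0 * (Real.exp (-lam * (t - ts)) * (-lam * 1)) / e ^ 4 * (g x * g x) - 4 * σ * 1
      = -lam * E t * (g x * g x) - 4 * σ := by simp only [E]; ring
    rw [e1] at h2
    exact h2
  have main := max_principle (lball hh x0 e) (fun x t => b x t - F x t) ts te 0 ?_ ?_ ?_ z ?_ te ⟨hte, le_rfl⟩
  · have hg : 3 / 4 * e ^ 2 ≤ g z := by simp only [g]; nlinarith
    have hg2 : 1 / 2 * e ^ 4 ≤ g z * g z := by nlinarith [sq_nonneg (e ^ 2)]
    have h3 : B0 * Real.exp (-lam * (te - ts)) / 2 ≤ E te * (g z * g z) := by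
      calc B0 * Real.exp (-lam * (te - ts)) / 2 = E te * (1 / 2 * e ^ 4) := by simp only [E]; field_simp
        _ ≤ _ := mul_le_mul_of_nonneg_left hg2 (hE0 te)
    simp only [b] at main
    linarith
  · intro x hx t ht
    rw [mem_lball] at hx
    obtain ⟨F', κ, h1, _⟩ := hF x hx t ht
    exact ((hbd x t).sub h1).continuousAt.continuousWithinAt
  · intro x hx
    rw [mem_lball] at hx
    have h1 := hini x hx
    have h2 : g x * g x ≤ e ^ 4 := by
      have a1 : 0 ≤ g x := by simp only [g]; linarith
      have a2 : g x ≤ e ^ 2 := by simp only [g]; linarith [dsq_nonneg h x x0]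
      nlinarith
    have h3 : E ts * (g x * g x) ≤ B0 := by
      calc E ts * (g x * g x) ≤ E ts * e ^ 4 := mul_le_mul_of_nonneg_left h2 (hE0 ts)
        _ = B0 := by simp only [E]; simp; field_simp
    have h4 : 0 ≤ B0 * (9 * h ^ 2 / e ^ 2) := by positivity
    simp only [b]
    linarith
  · intro x hx t ht1 ht2 hpos' hmax
    rw [mem_lball] at hx
    obtain ⟨F', κ, h1, hκ0, hκ, h2⟩ := hF x hx t ⟨ht1.le, ht2⟩
    refine ⟨_, (hbd x t).sub h1, ?_⟩
    have hlap : lapD h (fun y => b y t - F y t) x ≤ 0 := by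
      apply lapD_nonpos_of_max
      intro e'
      by_cases hin : x + st e' ∈ lball hh x0 e
      · exact hmax _ hin
      · rw [mem_lball, not_lt] at hin
        have hle := dsq_step_le hh.le he.le hx.le e'
        have hF0 := hpos (x + st e') (hle.trans (pow_le_pow_left₀ (by positivity) (by linarith) 2)) t ⟨ht1.le, ht2⟩
        have g1 : g (x + st e') ≤ 0 := by simp only [g]; linarith
        have g2 : -(3 * e * h) ≤ g (x + st e') := by simp only [g]; nlinarith
        have g3 : g (x + st e') * g (x + st e') ≤ 9 * e ^ 2 * h ^ 2 := by nlinarith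
        have g4 : E t * (g (x + st e') * g (x + st e')) ≤ B0 / e ^ 4 * (9 * e ^ 2 * h ^ 2) :=
          mul_le_mul (hE1 t ht1.le) g3 (mul_self_nonneg _) (by positivity)
        have g5 : B0 / e ^ 4 * (9 * e ^ 2 * h ^ 2) = B0 * (9 * h ^ 2 / e ^ 2) := by field_simp
        have g6 : 0 ≤ 4 * σ * (t - ts) := by
          have := sub_nonneg.mpr ht1.le; positivity
        simp only [b] at hpos' ⊢
        linarith
    rw [lapD_sub] at hlap
    have hb : lapD h (fun y => b y t) x = E t * (-4 * n * g x + 8 * dsq h x x0 + 2 * n * h ^ 2) := by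
      simp only [b, sub_sub]
      rw [lapD_sub, lapD_const, lapD_mul_const]
      simp only [g]
      rw [lapD_g2 hh]; ring
    rw [hb] at hlap
    have h5 := mul_nonneg hκ0 (by linarith : 0 ≤ lapD h (fun y => F y t) x - E t * (-4 * n * g x + 8 * dsq h x x0 + 2 * n * h ^ 2))
    have hkey : 0 ≤ lam * (g x * g x) + κ * (-4 * n * g x + 8 * dsq h x x0 + 2 * n * h ^ 2) := by
      have e1 : dsq h x x0 = e ^ 2 - g x := by simp only [g]; ring
      rw [e1]
      have hn0 : (0:ℝ) ≤ n := Nat.cast_nonneg n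
      have k1 : 0 ≤ κ * (2 * n * h ^ 2) := by positivity
      set G := g x
      set N : ℝ := 4 * n + 8 with hN
      have hl2 : κ * N ^ 2 ≤ lam * (8 * e ^ 2) := by rw [hlame]; gcongr
      have k2 : 0 ≤ lam * G ^ 2 + κ * (8 * e ^ 2 - N * G) := by
        have : 0 ≤ (lam * G ^ 2 + κ * (8 * e ^ 2 - N * G)) * (8 * e ^ 2) := by
          nlinarith [mul_nonneg hκ0 (sq_nonneg (N * G - 4 * e ^ 2)), mul_nonneg (sub_nonneg.mpr hl2) (sq_nonneg G), mul_nonneg hκ0 (sq_nonneg (e ^ 2))]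
        exact nonneg_of_mul_nonneg_left this (by positivity)
      have : -4 * n * G + 8 * (e ^ 2 - G) + 2 * n * h ^ 2 = (8 * e ^ 2 - N * G) + 2 * n * h ^ 2 := by rw [hN]; ring
      rw [this, mul_add, ← sq]; linarith
    have h6 := mul_nonneg (hE0 t) hkey
    rw [zero_mul]
    linarith
  · rw [mem_lball]
    refine hz.trans_lt ?_
    nlinarith

end OscB

open Real Set MeasureTheory Metric Filter

section OscC
variable {n : ℕ}

/-- local cylinder data -/
structure Cyl (h p m M C1 : ℝ) (u : Lt n → ℝ → ℝ) (x0 : Lt n) (tc ρ : ℝ) : Prop where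
  hd : ∀ x, ∀ t ∈ Icc (tc - 4 * ρ ^ 2) (tc + 4 * ρ ^ 2), HasDerivAt (u x) (u x t ^ p * lapD h (fun y => u y t) x) t
  lo : ∀ x, dsq h x x0 ≤ ρ ^ 2 → ∀ t ∈ Icc (tc - 4 * ρ ^ 2) (tc + 4 * ρ ^ 2), m ≤ u x t
  nn : ∀ x, ∀ t ∈ Icc (tc - 4 * ρ ^ 2) (tc + 4 * ρ ^ 2), 0 ≤ u x t
  hi : ∀ x, ∀ t ∈ Icc (tc - 4 * ρ ^ 2) (tc + 4 * ρ ^ 2), u x t ≤ M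
  qu : ∀ x s t, tc - 4 * ρ ^ 2 ≤ s → s ≤ t → t ≤ tc + 4 * ρ ^ 2 → u x s - C1 * (t - s) ≤ u x t

namespace Cyl
variable {h p m M C1 : ℝ} {u : Lt n → ℝ → ℝ} {x0 : Lt n} {tc ρ : ℝ}

lemma sub (hC : Cyl h p m M C1 u x0 tc ρ) {r : ℝ} (hr : 0 ≤ r) (hrρ : r ≤ ρ) : Cyl h p m M C1 u x0 tc r := by
  have h1 : r ^ 2 ≤ ρ ^ 2 := pow_le_pow_left₀ hr hrρ 2
  have h2 : Icc (tc - 4 * r ^ 2) (tc + 4 * r ^ 2) ⊆ Icc (tc - 4 * ρ ^ 2) (tc + 4 * ρ ^ 2) :=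
    Icc_subset_Icc (by linarith) (by linarith)
  exact ⟨fun x t ht => hC.hd x t (h2 ht), fun x hx t ht => hC.lo x (hx.trans h1) t (h2 ht),
    fun x t ht => hC.nn x t (h2 ht), fun x t ht => hC.hi x t (h2 ht),
    fun x s t a1 a2 a3 => hC.qu x s t (by linarith) a2 (by linarith)⟩

lemma winLip (hh : 0 < h) (hp : 1 ≤ p) (hm : 0 < m) (hM : 0 < M) (hC : Cyl h p m M C1 u x0 tc ρ)
    {U : Lt n → ℝ → ℝ} (hU : ∀ x, ∀ t ∈ Icc (tc - 4 * ρ ^ 2) (tc + 4 * ρ ^ 2), HasDerivAt (U x) (u x t) t)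
    {r ε s : ℝ} (hr : 0 < r) (hrρ : r ≤ ρ) (h8 : 8 * h ≤ r) (hs : tc - 4 * ρ ^ 2 ≤ s) (hs' : s + r ^ 2 ≤ tc + 4 * ρ ^ 2)
    (hε : 0 ≤ ε) (hε2 : ε ≤ 1 / 2) (y : Lt n) (hy : dsq h y x0 ≤ (ε * r) ^ 2) :
    |(U y (s + r ^ 2) - U y s) - (U x0 (s + r ^ 2) - U x0 s)| ≤ (n * (m ^ (-p) * M / 8 + 8 * (n + 2) * M)) * ε * r ^ 2 := by
  set a := tc - 4 * ρ ^ 2 with ha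
  set b := tc + 4 * ρ ^ 2 with hb
  have hr2 : 0 < r ^ 2 := by positivity
  have hst : s ≤ s + r ^ 2 := by linarith
  have hsub : Icc s (s + r ^ 2) ⊆ Icc a b := Icc_subset_Icc hs hs'
  have hρ2 : r ^ 2 ≤ ρ ^ 2 := pow_le_pow_left₀ hr.le hrρ 2
  have hmp : 0 < m ^ (-p) := Real.rpow_pos_of_pos hm _
  set V : Lt n → ℝ := fun y => U y (s + r ^ 2) - U y s with hV
  have hosc : ∀ x y, V x - V y ≤ M * r ^ 2 := by
    intro x y
    have h1 := prim_le (c := M) hst (fun q hq => hU x q (hsub hq)) (fun q hq => hC.hi x q (hsub hq))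
    have h2 := prim_ge (c := 0) hst (fun q hq => hU y q (hsub hq)) (fun q hq => hC.nn y q (hsub hq))
    simp only [hV]
    have : s + r ^ 2 - s = r ^ 2 := by ring
    rw [this] at h1
    linarith
  have hlap : ∀ x, dsq h x x0 ≤ r ^ 2 → |lapD h V x| ≤ m ^ (-p) * M := by
    intro x hx
    obtain ⟨κ, k1, k2, k3⟩ := U_lap hp hC.hd hU hm x (fun q hq => hC.lo x (hx.trans hρ2) q hq) (fun q hq => hC.hi x q hq) hs hst hs'
    have hκ : 0 ≤ κ := (Real.rpow_nonneg hM.le _).trans k1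
    simp only [hV]
    rw [k3, abs_mul, abs_of_nonneg hκ]
    have m1 : s ∈ Icc a b := hsub ⟨le_rfl, hst⟩
    have m2 : s + r ^ 2 ∈ Icc a b := hsub ⟨hst, le_rfl⟩
    refine mul_le_mul k2 ?_ (abs_nonneg _) hmp.le
    rw [abs_le]
    constructor <;> linarith [hC.nn x _ m1, hC.nn x _ m2, hC.hi x _ m1, hC.hi x _ m2]
  have key := path_center (r := ε * r) (L := m ^ (-p) * M * (r / 8) + (n + 2) * (M * r ^ 2) / (r / 8)) hh (by positivity) (by positivity) V x0 y hy ?_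
  · refine key.trans (le_of_eq ?_)
    field_simp
  · intro z e hz
    have hzr : ∀ x, dsq h x z ≤ (4 * (r / 8)) ^ 2 → dsq h x x0 ≤ r ^ 2 := by
      intro x hx
      have := dsq_tri (by positivity) (by positivity) hx hz
      refine this.trans (pow_le_pow_left₀ (by positivity) ?_ 2)
      nlinarith
    exact grad_est hh (by linarith : h ≤ r / 8) (by positivity) (by positivity) V z e (fun x y _ _ => hosc x y) (fun x hx => hlap x (hzr x hx))

end Cyl
end OscC

open Real Set MeasureTheory Metric Filter

section OscD
variable {n : ℕ}
namespace Cyl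
variable {h p m M C1 : ℝ} {u : Lt n → ℝ → ℝ} {x0 : Lt n} {tc ρ : ℝ}

set_option maxHeartbeats 2000000 in
lemma step (hh : 0 < h) (hp : 1 ≤ p) (hm : 0 < m) (hM : 0 < M) (hC1 : 0 ≤ C1) (hρ : 0 < ρ)
    (hC : Cyl h p m M C1 u x0 tc ρ) {η σ ε1 ε2 L Lam Mb cd : ℝ}
    (hL : L = n * (m ^ (-p) * M / 8 + 8 * (n + 2) * M))
    (hLam : Lam = 11 * M ^ p * (4 * n + 8) ^ 2 / (8 * ε2 ^ 2))
    (hMb : ∀ x, dsq h x x0 ≤ ρ ^ 2 → ∀ t ∈ Icc (tc - 4 * ρ ^ 2) (tc + 4 * ρ ^ 2), u x t ≤ Mb)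
    (hη : 0 < η) (hε2 : 0 < ε2) (hε2' : ε2 ≤ 1 / 2) (hLε2 : 8 * L * ε2 ≤ η)
    (hε1 : 0 < ε1) (hε1' : ε1 ≤ 1 / 2) (hLε1 : 4 * L * ε1 ≤ σ) (hσ : 704 * σ = η * Real.exp (-Lam))
    (hh1 : 8 * h ≤ ε1 * ε2 * ρ) (hh2 : 72 * h ^ 2 ≤ Real.exp (-Lam) * (ε1 * ε2 * ρ) ^ 2)
    (hq1 : 56 * (C1 * ρ ^ 2) ≤ σ) (hq2 : 64 * (C1 * ρ ^ 2) ≤ η * Real.exp (-Lam) / 8 * ε1 ^ 2) (hq3 : 40 * (C1 * ρ ^ 2) ≤ η)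
    (hcd1 : cd ≤ σ / 8) (hcd2 : cd ≤ η * Real.exp (-Lam) / 8 * ε1 ^ 2 / 8) :
    (∀ x, dsq h x x0 ≤ (ε1 * ε2 / 2 * ρ) ^ 2 → ∀ t ∈ Icc (tc - 4 * (ε1 * ε2 / 2 * ρ) ^ 2) (tc + 4 * (ε1 * ε2 / 2 * ρ) ^ 2), u x t ≤ Mb - cd) ∨
    (∀ x, dsq h x x0 ≤ (ε1 * ε2 / 2 * ρ) ^ 2 → ∀ t ∈ Icc (tc - 4 * (ε1 * ε2 / 2 * ρ) ^ 2) (tc + 4 * (ε1 * ε2 / 2 * ρ) ^ 2), Mb - η ≤ u x t) := by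
  have hρ2 : 0 < ρ ^ 2 := by positivity
  have hab : tc - 4 * ρ ^ 2 ≤ tc + 4 * ρ ^ 2 := by linarith
  have hex : ∀ x, ∃ G : ℝ → ℝ, ∀ t ∈ Icc (tc - 4 * ρ ^ 2) (tc + 4 * ρ ^ 2), HasDerivAt G (u x t) t := fun x =>
    exists_prim hab (fun t ht => (hC.hd x t ht).continuousAt.continuousWithinAt)
  choose U hU using hex
  set r := ε1 * ρ with hr
  have hr0 : 0 < r := by positivity
  have hrρ : r ≤ ρ / 2 := by
    have := mul_le_mul_of_nonneg_right hε1' hρ.le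
    rw [hr]; linarith
  set e := ε2 * r with he
  have he0 : 0 < e := by positivity
  have her : e ≤ r / 2 := by
    have := mul_le_mul_of_nonneg_right hε2' hr0.le
    rw [he]; linarith
  have hre : ε1 * ε2 / 2 * ρ = e / 2 := by rw [he, hr]; ring
  have hre' : ε1 * ε2 * ρ = e := by rw [he, hr]; ring
  rw [hre]
  rw [hre'] at hh1 hh2
  have hr2 : 0 < r ^ 2 := by positivity
  have he2 : 0 < e ^ 2 := by positivity
  have hr2ρ : 4 * r ^ 2 ≤ ρ ^ 2 := by
    have h1 := pow_le_pow_left₀ hr0.le hrρ 2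
    have h2 : (ρ / 2) ^ 2 = ρ ^ 2 / 4 := by ring
    rw [h2] at h1; linarith
  have he2r : 4 * e ^ 2 ≤ r ^ 2 := by
    have h1 := pow_le_pow_left₀ he0.le her 2
    have h2 : (r / 2) ^ 2 = r ^ 2 / 4 := by ring
    rw [h2] at h1; linarith
  have hE : 0 < Real.exp (-Lam) := Real.exp_pos _
  have hσ0 : 0 < σ := by linarith [mul_pos hη hE]
  have hQ0 : 0 ≤ C1 * ρ ^ 2 := by positivity
  have hL0 : 0 ≤ L := by rw [hL]; have := Real.rpow_pos_of_pos hm (-p); positivity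
  -- time drift
  have drift : ∀ x s t k, tc - 4 * ρ ^ 2 ≤ s → s ≤ t → t ≤ tc + 4 * ρ ^ 2 → t - s ≤ k * ρ ^ 2 →
      u x s - k * (C1 * ρ ^ 2) ≤ u x t := by
    intro x s t k a1 a2 a3 a4
    have := hC.qu x s t a1 a2 a3
    have h2 := mul_le_mul_of_nonneg_left a4 hC1
    linarith
  have hx00 : ∀ c : ℝ, dsq h x0 x0 ≤ c ^ 2 := fun c => by rw [dsq_self]; positivity
  by_cases hA : σ ≤ Mb - u x0 (tc + 3 * ρ ^ 2)
  · left
    intro y hy t ht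
    have hyr : dsq h y x0 ≤ (ε1 * ρ) ^ 2 := hy.trans (pow_le_pow_left₀ (by positivity) (by linarith) 2)
    have hw := hC.winLip hh hp hm hM hU (r := ρ) (ε := ε1) (s := tc + 2 * ρ ^ 2) hρ le_rfl (by linarith) (by linarith) (by linarith) hε1.le hε1' y hyr
    rw [← hL] at hw
    have e1 : tc + 2 * ρ ^ 2 + ρ ^ 2 = tc + 3 * ρ ^ 2 := by ring
    rw [e1] at hw
    have hsub : Icc (tc + 2 * ρ ^ 2) (tc + 3 * ρ ^ 2) ⊆ Icc (tc - 4 * ρ ^ 2) (tc + 4 * ρ ^ 2) := Icc_subset_Icc (by linarith) (by linarith)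
    have h1 := prim_le (c := Mb - σ / 2) (by linarith : tc + 2 * ρ ^ 2 ≤ tc + 3 * ρ ^ 2) (fun q hq => hU x0 q (hsub hq)) (fun q hq => by
      have := drift x0 q (tc + 3 * ρ ^ 2) 1 (hsub hq).1 hq.2 (by linarith) (by linarith [hq.1])
      linarith)
    obtain ⟨q, hq, hq'⟩ := prim_ex_le (c := Mb - σ / 4) (by linarith : tc + 2 * ρ ^ 2 < tc + 3 * ρ ^ 2) (fun q hq => hU y q (hsub hq)) (by
      have := (abs_le.mp hw).2
      have h3 := mul_le_mul_of_nonneg_right hLε1 hρ2.le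
      linarith)
    have hb1 : tc - 4 * ρ ^ 2 ≤ t := by
      have h3 : (e / 2) ^ 2 = e ^ 2 / 4 := by ring
      rw [h3] at ht; linarith [ht.1]
    have hb2 : t ≤ tc + 2 * ρ ^ 2 := by
      have h3 : (e / 2) ^ 2 = e ^ 2 / 4 := by ring
      rw [h3] at ht; linarith [ht.2]
    have := drift y t q 7 hb1 (hb2.trans hq.1) (hsub hq).2 (by linarith [hq.2])
    linarith
  push Not at hA
  have hEnd : ∀ y, dsq h y x0 ≤ r ^ 2 → Mb - u y (tc + 4 * ρ ^ 2) ≤ 4 * σ := by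
    intro y hy
    have hw := hC.winLip hh hp hm hM hU (r := ρ) (ε := ε1) (s := tc + 3 * ρ ^ 2) hρ le_rfl (by linarith) (by linarith) (by linarith) hε1.le hε1' y hy
    rw [← hL] at hw
    have e1 : tc + 3 * ρ ^ 2 + ρ ^ 2 = tc + 4 * ρ ^ 2 := by ring
    rw [e1] at hw
    have hsub : Icc (tc + 3 * ρ ^ 2) (tc + 4 * ρ ^ 2) ⊆ Icc (tc - 4 * ρ ^ 2) (tc + 4 * ρ ^ 2) := Icc_subset_Icc (by linarith) (by linarith)
    have h1 := prim_ge (c := Mb - 2 * σ) (by linarith : tc + 3 * ρ ^ 2 ≤ tc + 4 * ρ ^ 2) (fun q hq => hU x0 q (hsub hq)) (fun q hq => by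
      have := drift x0 (tc + 3 * ρ ^ 2) q 1 (by linarith) hq.1 hq.2 (by linarith [hq.2])
      linarith)
    obtain ⟨q, hq, hq'⟩ := prim_ex_ge (c := Mb - 3 * σ) (by linarith : tc + 3 * ρ ^ 2 < tc + 4 * ρ ^ 2) (fun q hq => hU y q (hsub hq)) (by
      have := (abs_le.mp hw).1
      have h3 := mul_le_mul_of_nonneg_right hLε1 hρ2.le
      have h4 := mul_pos hσ0 hρ2
      linarith)
    have := drift y q (tc + 4 * ρ ^ 2) 1 (hsub hq).1 hq.2 le_rfl (by linarith [hq.1])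
    linarith
  by_cases hB : ∀ x, dsq h x x0 ≤ (e / 2) ^ 2 → ∀ t ∈ Icc (tc - 4 * (e / 2) ^ 2) (tc + 4 * (e / 2) ^ 2), Mb - η ≤ u x t
  · exact Or.inr hB
  left
  push Not at hB
  obtain ⟨y, hy, s, hs, hys⟩ := hB
  have he2' : (e / 2) ^ 2 = e ^ 2 / 4 := by ring
  rw [he2'] at hs hy
  -- window integrals
  set ts := tc - 6 * r ^ 2 with hts
  have ets : ts + r ^ 2 = tc - 5 * r ^ 2 := by rw [hts]; ring
  have hsub : Icc ts (ts + r ^ 2) ⊆ Icc (tc - 4 * ρ ^ 2) (tc + 4 * ρ ^ 2) := Icc_subset_Icc (by linarith) (by linarith)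
  have hwin : ∀ z, dsq h z x0 ≤ e ^ 2 → U z (ts + r ^ 2) - U z ts ≤ (Mb - η / 2) * r ^ 2 := by
    intro z hz
    have w1 := hC.winLip hh hp hm hM hU (r := r) (ε := ε2) (s := ts) hr0 (by linarith) (by linarith) (by linarith) (by linarith) hε2.le hε2' z hz
    have w2 := hC.winLip hh hp hm hM hU (r := r) (ε := ε2) (s := ts) hr0 (by linarith) (by linarith) (by linarith) (by linarith) hε2.le hε2' y (by linarith)
    rw [← hL] at w1 w2
    have h1 := prim_le (c := Mb - 3 * η / 4) (by linarith : ts ≤ ts + r ^ 2) (fun q hq => hU y q (hsub hq)) (fun q hq => by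
      have := drift y q s 10 (hsub hq).1 (by linarith [hq.2, hs.1]) (by linarith [hs.2]) (by linarith [hq.1, hs.2])
      linarith)
    have a1 := (abs_le.mp w1).2
    have a2 := (abs_le.mp w2).1
    have a3 : L * ε2 * r ^ 2 ≤ η / 8 * r ^ 2 := mul_le_mul_of_nonneg_right (by linarith) hr2.le
    have e2 : ts + r ^ 2 - ts = r ^ 2 := by ring
    rw [e2] at h1
    linarith
  set b := tc + 4 * ρ ^ 2 with hb
  set te := tc + 5 * r ^ 2 with hte
  let F : Lt n → ℝ → ℝ := fun x t => Mb * (b - t) - (U x b - U x t)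
  have her2 : e ^ 2 ≤ ρ ^ 2 := by linarith
  have hIn : ∀ t ∈ Icc ts te, t ∈ Icc (tc - 4 * ρ ^ 2) b := fun t ht => ⟨by linarith [ht.1], by linarith [ht.2]⟩
  have hMpp : 0 < M ^ p := Real.rpow_pos_of_pos hM p
  have hbar := fun z hz => par_barrier (n := n) (h := h) (e := e) (κ2 := M ^ p) (σ := σ) (B0 := η * r ^ 2 / 2) (ts := ts) (te := te)
    hh (by linarith) hMpp (by positivity) hσ0.le (by linarith) F x0 (by
      intro x hx t ht
      obtain ⟨κ, k1, k2, k3⟩ := U_lap hp hC.hd hU hm x (fun q hq => hC.lo x (hx.le.trans her2) q hq) (fun q hq => hC.hi x q hq) (hIn t ht).1 (hIn t ht).2 le_rfl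
      have hMn : 0 < M ^ (-p) := Real.rpow_pos_of_pos hM _
      have hκ0 : 0 < κ := hMn.trans_le k1
      refine ⟨Mb * (0 - 1) - (0 - u x t), κ⁻¹, ?_, by positivity, ?_, ?_⟩
      · exact (((hasDerivAt_const t b).sub (hasDerivAt_id t)).const_mul Mb).sub ((hasDerivAt_const t (U x b)).sub (hU x t (hIn t ht)))
      · rw [Real.rpow_neg hM.le] at k1
        exact inv_le_of_inv_le₀ hMpp k1
      · have hl : lapD h (fun y => F y t) x = - (κ * (u x b - u x t)) := by
          simp only [F]
          rw [lapD_sub, lapD_const, k3]; ring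
        rw [hl]
        have e3 : κ⁻¹ * -(κ * (u x b - u x t)) = -(u x b - u x t) := by field_simp
        rw [e3]
        have := hEnd x (by linarith)
        linarith) (by
      intro x hx t ht
      have hx' : dsq h x x0 ≤ ρ ^ 2 := by
        have h3 : (2 * e) ^ 2 = 4 * e ^ 2 := by ring
        rw [h3] at hx; linarith
      have := prim_le (c := Mb) (hIn t ht).2 (fun q hq => hU x q ⟨(hIn t ht).1.trans hq.1, hq.2⟩) (fun q hq => hMb x hx' q ⟨(hIn t ht).1.trans hq.1, hq.2⟩)
      simp only [F]
      linarith) (by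
      intro x hx
      have h1 := hwin x hx.le
      have h2 := prim_le (c := Mb) (by linarith : ts + r ^ 2 ≤ b) (fun q hq => hU x q ⟨by linarith [hq.1], hq.2⟩) (fun q hq => hMb x (by linarith) q ⟨by linarith [hq.1], hq.2⟩)
      simp only [F]
      linarith) z hz
  intro z hz t ht
  rw [he2'] at ht
  have h1 := hbar z hz
  have e4 : te - ts = 11 * r ^ 2 := by rw [hte, hts]; ring
  rw [e4] at h1
  have e5 : -(M ^ p * (4 * n + 8) ^ 2 / (8 * e ^ 2)) * (11 * r ^ 2) = - Lam := by
    rw [hLam, he]; field_simp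
  rw [e5] at h1
  have h9 : 9 * h ^ 2 / e ^ 2 ≤ Real.exp (-Lam) / 8 := by
    rw [div_le_iff₀ he2]; linarith
  have h10 : η * r ^ 2 / 2 * (9 * h ^ 2 / e ^ 2) ≤ η * r ^ 2 / 2 * (Real.exp (-Lam) / 8) := mul_le_mul_of_nonneg_left h9 (by positivity)
  have h11 : 4 * σ * (11 * r ^ 2) = η * Real.exp (-Lam) * r ^ 2 / 16 := by
    have : σ = η * Real.exp (-Lam) / 704 := by linarith
    rw [this]; ring
  have h12 : η * Real.exp (-Lam) / 8 * r ^ 2 ≤ F z te := by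
    rw [h11] at h1; linarith
  obtain ⟨q, hq, hq'⟩ := prim_ex_le (c := Mb - η * Real.exp (-Lam) / 8 * ε1 ^ 2 / 4) (by linarith : te < b) (fun q hq => hU z q ⟨by linarith [hq.1], hq.2⟩) (by
    simp only [F] at h12
    have e6 : r ^ 2 = ε1 ^ 2 * ρ ^ 2 := by rw [hr]; ring
    have h13 : b - te ≤ 4 * ρ ^ 2 := by linarith
    have h14 : η * Real.exp (-Lam) / 8 * ε1 ^ 2 / 4 * (b - te) ≤ η * Real.exp (-Lam) / 8 * ε1 ^ 2 / 4 * (4 * ρ ^ 2) :=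
      mul_le_mul_of_nonneg_left h13 (by positivity)
    rw [e6] at h12
    linarith)
  have := drift z t q 8 (by linarith [ht.1]) (by linarith [ht.2, hq.1]) hq.2 (by linarith [ht.1, hq.2])
  linarith

end Cyl
end OscD

open Real Set MeasureTheory Metric Filter

section OscE

/-- small oscillation on small cylinders -/
lemma small_osc (n : ℕ) {p m M C1 η : ℝ} (hp : 1 ≤ p) (hm : 0 < m) (hM : 0 < M) (hC1 : 0 ≤ C1) (hη : 0 < η) :
    ∃ ε ρ0 εh : ℝ, 0 < ε ∧ ε ≤ 1 ∧ 0 < ρ0 ∧ 0 < εh ∧ ∀ (h ρ tc : ℝ) (u : Lt n → ℝ → ℝ) (x0 : Lt n), 0 < h → 0 < ρ → ρ ≤ ρ0 →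
      h ≤ εh * ρ → Cyl h p m M C1 u x0 tc ρ → ∃ Mb, ∀ x, dsq h x x0 ≤ (ε * ρ) ^ 2 →
        ∀ t ∈ Icc (tc - 4 * (ε * ρ) ^ 2) (tc + 4 * (ε * ρ) ^ 2), Mb - η ≤ u x t ∧ u x t ≤ Mb := by
  obtain ⟨L, hL⟩ : ∃ L : ℝ, L = n * (m ^ (-p) * M / 8 + 8 * (n + 2) * M) := ⟨_, rfl⟩
  have hL0 : 0 ≤ L := by rw [hL]; have := Real.rpow_pos_of_pos hm (-p); positivity
  obtain ⟨ε2, hε2⟩ : ∃ x : ℝ, x = min (1 / 2) (η / (8 * L + 1)) := ⟨_, rfl⟩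
  have hε20 : 0 < ε2 := by rw [hε2]; exact lt_min (by norm_num) (by positivity)
  have hε2h : ε2 ≤ 1 / 2 := by rw [hε2]; exact min_le_left _ _
  have hLε2 : 8 * L * ε2 ≤ η := by
    have h1 : ε2 ≤ η / (8 * L + 1) := by rw [hε2]; exact min_le_right _ _
    rw [le_div_iff₀ (by positivity)] at h1
    linarith
  obtain ⟨Lam, hLam⟩ : ∃ x : ℝ, x = 11 * M ^ p * (4 * n + 8) ^ 2 / (8 * ε2 ^ 2) := ⟨_, rfl⟩
  have hE : 0 < Real.exp (-Lam) := Real.exp_pos _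
  obtain ⟨σ, hσ⟩ : ∃ x : ℝ, x = η * Real.exp (-Lam) / 704 := ⟨_, rfl⟩
  have hσ0 : 0 < σ := by rw [hσ]; positivity
  obtain ⟨ε1, hε1⟩ : ∃ x : ℝ, x = min (1 / 2) (σ / (4 * L + 1)) := ⟨_, rfl⟩
  have hε10 : 0 < ε1 := by rw [hε1]; exact lt_min (by norm_num) (by positivity)
  have hε1h : ε1 ≤ 1 / 2 := by rw [hε1]; exact min_le_left _ _
  have hLε1 : 4 * L * ε1 ≤ σ := by
    have h1 : ε1 ≤ σ / (4 * L + 1) := by rw [hε1]; exact min_le_right _ _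
    rw [le_div_iff₀ (by positivity)] at h1
    linarith
  obtain ⟨A, hA⟩ : ∃ x : ℝ, x = η * Real.exp (-Lam) / 8 * ε1 ^ 2 := ⟨_, rfl⟩
  have hA0 : 0 < A := by rw [hA]; positivity
  obtain ⟨cd, hcd⟩ : ∃ x : ℝ, x = min (σ / 8) (A / 8) := ⟨_, rfl⟩
  have hcd0 : 0 < cd := by rw [hcd]; exact lt_min (by positivity) (by positivity)
  have hcd1 : cd ≤ σ / 8 := by rw [hcd]; exact min_le_left _ _
  have hcd2 : cd ≤ A / 8 := by rw [hcd]; exact min_le_right _ _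
  obtain ⟨Q, hQ⟩ : ∃ x : ℝ, x = min (σ / 56) (min (A / 64) (η / 40)) := ⟨_, rfl⟩
  have hQ0 : 0 < Q := by rw [hQ]; exact lt_min (by positivity) (lt_min (by positivity) (by positivity))
  have hQ1 : Q ≤ σ / 56 := by rw [hQ]; exact min_le_left _ _
  have hQ2 : Q ≤ A / 64 := by rw [hQ]; exact (min_le_right _ _).trans (min_le_left _ _)
  have hQ3 : Q ≤ η / 40 := by rw [hQ]; exact (min_le_right _ _).trans (min_le_right _ _)
  obtain ⟨ρs, hρs⟩ : ∃ x : ℝ, x = min 1 (Q / (C1 + 1)) := ⟨_, rfl⟩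
  have hρs0 : 0 < ρs := by rw [hρs]; exact lt_min one_pos (by positivity)
  have hρsQ : ∀ ρ, 0 < ρ → ρ ≤ ρs → C1 * ρ ^ 2 ≤ Q := by
    intro ρ h0 h1
    have h2 : ρ ≤ 1 := h1.trans (by rw [hρs]; exact min_le_left _ _)
    have h3 : ρ ≤ Q / (C1 + 1) := h1.trans (by rw [hρs]; exact min_le_right _ _)
    rw [le_div_iff₀ (by positivity)] at h3
    have h4 : ρ ^ 2 ≤ ρ := by rw [sq]; exact mul_le_of_le_one_left h0.le h2
    have h5 := mul_le_mul_of_nonneg_left h4 hC1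
    linarith
  obtain ⟨εs, hεs⟩ : ∃ x : ℝ, x = min (1 / 8) (Real.exp (-Lam) / 72) * (ε1 * ε2) := ⟨_, rfl⟩
  have hεm : 0 < min (1 / 8) (Real.exp (-Lam) / 72) := lt_min (by norm_num) (by positivity)
  have hεs0 : 0 < εs := by rw [hεs]; positivity
  have hε12 : 0 < ε1 * ε2 := by positivity
  have key : ∀ N : ℕ, ∃ ε ρ0 εh : ℝ, 0 < ε ∧ ε ≤ 1 ∧ 0 < ρ0 ∧ 0 < εh ∧ ∀ (h ρ tc : ℝ) (u : Lt n → ℝ → ℝ) (x0 : Lt n) (Mb : ℝ),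
      0 < h → 0 < ρ → ρ ≤ ρ0 → h ≤ εh * ρ → Cyl h p m M C1 u x0 tc ρ → Mb ≤ N * cd →
      (∀ x, dsq h x x0 ≤ ρ ^ 2 → ∀ t ∈ Icc (tc - 4 * ρ ^ 2) (tc + 4 * ρ ^ 2), u x t ≤ Mb) → ∃ Mb, ∀ x, dsq h x x0 ≤ (ε * ρ) ^ 2 →
        ∀ t ∈ Icc (tc - 4 * (ε * ρ) ^ 2) (tc + 4 * (ε * ρ) ^ 2), Mb - η ≤ u x t ∧ u x t ≤ Mb := by
    intro N
    induction N with
    | zero =>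
      refine ⟨1, 1, 1, one_pos, le_rfl, one_pos, one_pos, ?_⟩
      intro h ρ tc u x0 Mb hh hρ _ _ hC hMb hu
      exfalso
      have hx : dsq h x0 x0 ≤ ρ ^ 2 := by rw [dsq_self]; positivity
      have ht : tc ∈ Icc (tc - 4 * ρ ^ 2) (tc + 4 * ρ ^ 2) := ⟨by linarith [sq_nonneg ρ], by linarith [sq_nonneg ρ]⟩
      have h1 := hC.lo x0 hx tc ht
      have h2 := hu x0 hx tc ht
      simp only [Nat.cast_zero, zero_mul] at hMb
      linarith
    | succ N ih =>
      obtain ⟨ε, ρ0, εh, e1, e2, e3, e4, IH⟩ := ih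
      have hlt : ε1 * ε2 / 2 ≤ 1 := by
        have := mul_le_mul hε1h hε2h hε20.le (by norm_num)
        linarith
      refine ⟨ε * (ε1 * ε2 / 2), min ρ0 ρs, min (εh * (ε1 * ε2 / 2)) εs, by positivity, mul_le_one₀ e2 (by positivity) hlt, lt_min e3 hρs0, lt_min (by positivity) hεs0, ?_⟩
      intro h ρ tc u x0 Mb hh hρ hρ0 hhρ hC hMb hu
      have hρA := hρ0.trans (min_le_left _ _)
      have hρB := hρsQ ρ hρ (hρ0.trans (min_le_right _ _))
      have hhA : h ≤ εh * (ε1 * ε2 / 2) * ρ := hhρ.trans (mul_le_mul_of_nonneg_right (min_le_left _ _) hρ.le)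
      have hhB : h ≤ εs * ρ := hhρ.trans (mul_le_mul_of_nonneg_right (min_le_right _ _) hρ.le)
      have hb0 : 0 < ε1 * ε2 * ρ := by positivity
      have hh1 : 8 * h ≤ ε1 * ε2 * ρ := by
        have := mul_le_mul_of_nonneg_right (min_le_left (1 / 8) (Real.exp (-Lam) / 72)) hb0.le
        rw [hεs] at hhB
        linarith
      have hh2 : 72 * h ^ 2 ≤ Real.exp (-Lam) * (ε1 * ε2 * ρ) ^ 2 := by
        have h3 := mul_le_mul_of_nonneg_right (min_le_right (1 / 8) (Real.exp (-Lam) / 72)) hb0.le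
        rw [hεs] at hhB
        have h4 : 72 * h ≤ Real.exp (-Lam) * (ε1 * ε2 * ρ) := by linarith
        have h5 : h ≤ ε1 * ε2 * ρ := by linarith
        have h6 := mul_le_mul h4 h5 hh.le (by positivity)
        calc 72 * h ^ 2 = 72 * h * h := by ring
          _ ≤ _ := h6
          _ = _ := by ring
      have hsub : ε1 * ε2 / 2 * ρ ≤ ρ := mul_le_of_le_one_left hρ.le hlt
      have hpos : 0 < ε1 * ε2 / 2 * ρ := by positivity
      rcases Cyl.step hh hp hm hM hC1 hρ hC hL hLam hu hη hε20 hε2h hLε2 hε10 hε1h hLε1 (by rw [hσ]; ring) hh1 hh2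
        (by linarith) (by rw [← hA]; linarith) (by linarith) hcd1 (by rw [← hA]; exact hcd2) with h1 | h1
      · obtain ⟨Mb', hMb'⟩ := IH h (ε1 * ε2 / 2 * ρ) tc u x0 (Mb - cd) hh hpos (hsub.trans hρA) (by linarith) (hC.sub hpos.le hsub) (by
          push_cast at hMb; linarith) h1
        refine ⟨Mb', ?_⟩
        rw [show ε * (ε1 * ε2 / 2) * ρ = ε * (ε1 * ε2 / 2 * ρ) by ring]
        exact hMb'
      · refine ⟨Mb, fun x hx t ht => ?_⟩
        rw [show ε * (ε1 * ε2 / 2) * ρ = ε * (ε1 * ε2 / 2 * ρ) by ring] at hx ht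
        have h5 : (ε * (ε1 * ε2 / 2 * ρ)) ^ 2 ≤ (ε1 * ε2 / 2 * ρ) ^ 2 :=
          pow_le_pow_left₀ (by positivity) (mul_le_of_le_one_left hpos.le e2) 2
        have h6 : (ε1 * ε2 / 2 * ρ) ^ 2 ≤ ρ ^ 2 := pow_le_pow_left₀ hpos.le hsub 2
        exact ⟨h1 x (hx.trans h5) t ⟨by linarith [ht.1], by linarith [ht.2]⟩,
          hu x ((hx.trans h5).trans h6) t ⟨by linarith [ht.1], by linarith [ht.2]⟩⟩
  obtain ⟨N, hN⟩ := exists_nat_ge (M / cd)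
  obtain ⟨ε, ρ0, εh, e1, e2, e3, e4, H⟩ := key N
  refine ⟨ε, ρ0, εh, e1, e2, e3, e4, ?_⟩
  intro h ρ tc u x0 hh hρ hρ0 hhρ hC
  refine H h ρ tc u x0 M hh hρ hρ0 hhρ hC ?_ (fun x _ t ht => hC.hi x t ht)
  rwa [div_le_iff₀ hcd0] at hN

end OscE

open Real Set MeasureTheory Metric Filter

lemma touch {ι : Type*} (S : Finset ι) (f : ι → ℝ → ℝ) (a b K : ℝ)
    (hc : ∀ i ∈ S, ContinuousOn (f i) (Icc a b)) (h0 : ∀ i ∈ S, f i a < K)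
    (hd : ∀ i ∈ S, ∀ t, a < t → t ≤ b → f i t = K → (∀ j ∈ S, f j t ≤ K) →
      ∃ f', HasDerivAt (f i) f' t ∧ f' < 0) :
    ∀ i ∈ S, ∀ t ∈ Icc a b, f i t < K := by
  intro i0 hi0 t0 ht0
  by_contra hcon
  push Not at hcon
  let B : Set ℝ := ⋃ i ∈ S, (Icc a b ∩ f i ⁻¹' Ici K)
  have hB : IsClosed B := S.finite_toSet.isClosed_biUnion (fun i hi =>
    (hc i hi).preimage_isClosed_of_isClosed isClosed_Icc isClosed_Ici)
  have hBs : B ⊆ Icc a b := by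
    intro t ht
    simp only [B, mem_iUnion] at ht
    obtain ⟨i, _, h1⟩ := ht
    exact h1.1
  have hBc : IsCompact B := isCompact_Icc.of_isClosed_subset hB hBs
  have hBn : B.Nonempty := ⟨t0, by simp only [B, mem_iUnion]; exact ⟨i0, hi0, ht0, hcon⟩⟩
  obtain ⟨t, htB, hmin⟩ := hBc.exists_isLeast hBn
  have htI := hBs htB
  simp only [B, mem_iUnion] at htB
  obtain ⟨i, hi, _, hiK⟩ := htB
  have hiK : K ≤ f i t := hiK
  have hat : a < t := by
    rcases htI.1.lt_or_eq with h | h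
    · exact h
    · rw [← h] at hiK; exact absurd (h0 i hi) (not_lt.mpr hiK)
  have hlt : ∀ j ∈ S, ∀ s ∈ Ico a t, f j s < K := by
    intro j hj s hs
    by_contra hc2
    push Not at hc2
    have : s ∈ B := by
      simp only [B, mem_iUnion]
      exact ⟨j, hj, ⟨hs.1, hs.2.le.trans htI.2⟩, hc2⟩
    exact absurd (hmin this) (not_le.mpr hs.2)
  have hle : ∀ j ∈ S, f j t ≤ K := by
    intro j hj
    have h1 : ContinuousWithinAt (f j) (Ico a t) t := ((hc j hj) t htI).mono (fun s hs => ⟨hs.1, hs.2.le.trans htI.2⟩)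
    have : (nhdsWithin t (Ico a t)).NeBot := by
      rw [← mem_closure_iff_nhdsWithin_neBot, closure_Ico hat.ne]
      exact ⟨hat.le, le_rfl⟩
    refine le_of_tendsto h1 ?_
    filter_upwards [self_mem_nhdsWithin] with s hs using (hlt j hj s hs).le
  obtain ⟨f', hf', hneg⟩ := hd i hi t hat htI.2 (le_antisymm (hle i hi) hiK) hle
  have := left_deriv_nonneg hf' hat (fun s hs => by
    rcases hs.2.lt_or_eq with h | h
    · exact ((hlt i hi s ⟨hs.1, h⟩).le).trans hiK
    · rw [h])
  linarith

section Bern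
variable {n : ℕ}

lemma cut_facts {h ρ s δ : ℝ} (hh : 0 < h) (hρ : 0 < ρ) (hs : 0 ≤ s) (hs1 : s ≤ 1) (hδ : 0 < δ) (hδ1 : δ ≤ 1 / 4)
    (x x0 : Lt n) (hx : dsq h x x0 < ρ ^ 2) (hζ : 15 * h ≤ δ * ρ * (1 - dsq h x x0 / ρ ^ 2)) :
    (∀ e, dsq h (x + st e) x0 < ρ ^ 2) ∧
    (∀ e, (Dd h e (fun y => s * (1 - dsq h y x0 / ρ ^ 2) ^ 2) x) ^ 2 ≤ 225 / ρ ^ 2 * (s * (1 - dsq h x x0 / ρ ^ 2) ^ 2)) ∧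
    (∀ e, h * |Dd h e (fun y => s * (1 - dsq h y x0 / ρ ^ 2) ^ 2) x| ≤ δ * (s * (1 - dsq h x x0 / ρ ^ 2) ^ 2)) ∧
    -(22 * n / ρ ^ 2) ≤ lapD h (fun y => s * (1 - dsq h y x0 / ρ ^ 2) ^ 2) x := by
  have hρ2 : 0 < ρ ^ 2 := by positivity
  obtain ⟨ζ, hζd⟩ : ∃ ζ, ζ = 1 - dsq h x x0 / ρ ^ 2 := ⟨_, rfl⟩
  rw [← hζd] at hζ ⊢
  have hd0 := dsq_nonneg h x x0
  have hζ0 : 0 < ζ := by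
    rw [hζd, sub_pos, div_lt_one hρ2]; exact hx
  have hζ1 : ζ ≤ 1 := by
    rw [hζd]; have : 0 ≤ dsq h x x0 / ρ ^ 2 := by positivity
    linarith
  have h60 : 60 * h ≤ ρ * ζ := by
    have : δ * (ρ * ζ) ≤ 1 / 4 * (ρ * ζ) := mul_le_mul_of_nonneg_right hδ1 (by positivity)
    linarith
  have hhρ : 60 * h ≤ ρ := by
    have : ρ * ζ ≤ ρ := mul_le_of_le_one_right hρ.le hζ1
    linarith
  -- derivative of ζ
  have hD : ∀ e, |Dd h e (fun z => dsq h z x0) x| ≤ 3 * ρ := by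
    intro e
    rw [Dd_dsq hh.ne']
    have h1 : |h * ((x e.1 : ℝ) - x0 e.1)| ≤ ρ := by
      rw [← sq_le_sq₀ (abs_nonneg _) hρ.le, sq_abs]
      exact (dsq_coord h x x0 e.1).trans hx.le
    have h2 : |(sgn e : ℝ)| = 1 := by unfold sgn; split_ifs <;> norm_num
    calc |2 * (sgn e : ℝ) * (h * ((x e.1 : ℝ) - x0 e.1)) + h| ≤ |2 * (sgn e : ℝ) * (h * ((x e.1 : ℝ) - x0 e.1))| + |h| := abs_add_le _ _
      _ = 2 * |h * ((x e.1 : ℝ) - x0 e.1)| + h := by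
        rw [abs_mul, abs_mul, h2, abs_of_pos hh]; norm_num
      _ ≤ 3 * ρ := by linarith
  have hst : ∀ e, dsq h (x + st e) x0 = dsq h x x0 + h * Dd h e (fun z => dsq h z x0) x := by
    intro e; unfold Dd; field_simp; ring
  -- value of ζ at neighbours
  have hk : ∀ e, ∃ k, |k| ≤ 3 / ρ ∧ k = -(Dd h e (fun z => dsq h z x0) x) / ρ ^ 2 ∧ 1 - dsq h (x + st e) x0 / ρ ^ 2 = ζ + h * k := by
    intro e
    refine ⟨-(Dd h e (fun z => dsq h z x0) x) / ρ ^ 2, ?_, rfl, ?_⟩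
    · rw [abs_div, abs_neg, abs_of_pos hρ2, div_le_div_iff₀ hρ2 hρ]
      have := mul_le_mul_of_nonneg_right (hD e) hρ.le
      calc _ ≤ _ := this
        _ = _ := by ring
    · rw [hst e, hζd]; field_simp; ring
  have hDη : ∀ e, ∀ k, 1 - dsq h (x + st e) x0 / ρ ^ 2 = ζ + h * k →
      Dd h e (fun y => s * (1 - dsq h y x0 / ρ ^ 2) ^ 2) x = s * (2 * ζ * k + h * k ^ 2) := by
    intro e k hk
    unfold Dd
    beta_reduce
    rw [hk, ← hζd]; field_simp; ring
  have hDb : ∀ e, |Dd h e (fun y => s * (1 - dsq h y x0 / ρ ^ 2) ^ 2) x| ≤ 15 * (s * ζ) / ρ := by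
    intro e
    obtain ⟨k, k1, k2, k3⟩ := hk e
    rw [hDη e k k3, abs_mul, abs_of_nonneg hs]
    have hk2 : k ^ 2 ≤ (3 / ρ) ^ 2 := by rw [← sq_abs]; exact pow_le_pow_left₀ (abs_nonneg _) k1 2
    have h1 : |2 * ζ * k + h * k ^ 2| ≤ 2 * ζ * (3 / ρ) + h * (3 / ρ) ^ 2 := by
      refine (abs_add_le _ _).trans (add_le_add ?_ ?_)
      · rw [abs_mul, abs_of_pos (by positivity : 0 < 2 * ζ)]
        exact mul_le_mul_of_nonneg_left k1 (by positivity)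
      · rw [abs_of_nonneg (by positivity)]
        exact mul_le_mul_of_nonneg_left hk2 hh.le
    have h2 : h * (3 / ρ) ^ 2 ≤ 9 * ζ / ρ := by
      rw [div_pow, mul_div_assoc', div_le_div_iff₀ hρ2 hρ]
      have h3 := mul_le_mul_of_nonneg_right (by linarith : h ≤ ρ * ζ) hρ.le
      calc h * 3 ^ 2 * ρ = 9 * (h * ρ) := by ring
        _ ≤ 9 * (ρ * ζ * ρ) := by linarith
        _ = _ := by ring
    have h4 : 2 * ζ * (3 / ρ) = 6 * ζ / ρ := by ring
    have h5 : |2 * ζ * k + h * k ^ 2| ≤ 15 * ζ / ρ := by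
      have : 6 * ζ / ρ + 9 * ζ / ρ = 15 * ζ / ρ := by ring
      linarith
    calc _ ≤ s * (15 * ζ / ρ) := mul_le_mul_of_nonneg_left h5 hs
      _ = _ := by ring
  refine ⟨?_, ?_, ?_, ?_⟩
  · intro e
    obtain ⟨k, k1, k2, k3⟩ := hk e
    have h1 : h * |k| ≤ h * (3 / ρ) := mul_le_mul_of_nonneg_left k1 hh.le
    have h2 : h * (3 / ρ) ≤ ζ / 20 := by
      rw [mul_div_assoc', div_le_div_iff₀ hρ (by norm_num)]; linarith
    have h3 : -(h * |k|) ≤ h * k := by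
      have := mul_le_mul_of_nonneg_left (neg_abs_le k) hh.le
      linarith
    have h4 : 0 < 1 - dsq h (x + st e) x0 / ρ ^ 2 := by rw [k3]; linarith
    rw [sub_pos, div_lt_one hρ2] at h4
    exact h4
  · intro e
    rw [← sq_abs]
    refine (pow_le_pow_left₀ (abs_nonneg _) (hDb e) 2).trans ?_
    have : s ^ 2 ≤ s := by rw [sq]; exact mul_le_of_le_one_left hs hs1
    calc (15 * (s * ζ) / ρ) ^ 2 = 225 / ρ ^ 2 * (s ^ 2 * ζ ^ 2) := by ring
      _ ≤ 225 / ρ ^ 2 * (s * ζ ^ 2) := by gcongr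
  · intro e
    refine (mul_le_mul_of_nonneg_left (hDb e) hh.le).trans ?_
    rw [mul_div_assoc', div_le_iff₀ hρ]
    have := mul_le_mul_of_nonneg_right hζ (by positivity : 0 ≤ s * ζ)
    calc h * (15 * (s * ζ)) = 15 * h * (s * ζ) := by ring
      _ ≤ _ := this
      _ = _ := by ring
  · have e1 : (fun y => s * (1 - dsq h y x0 / ρ ^ 2) ^ 2) = fun y => s * ((1 - (1 / ρ ^ 2) * dsq h y x0) * (1 - (1 / ρ ^ 2) * dsq h y x0)) := by
      ext y; ring
    rw [e1, lapD_mul_const, lapD_mul hh.ne', lapD_sub, lapD_const, lapD_mul_const, lapD_dsq hh]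
    have e2 : 1 - 1 / ρ ^ 2 * dsq h x x0 = ζ := by rw [hζd]; ring
    rw [e2]
    have h1 : 0 ≤ ∑ e, Dd h e (fun y => 1 - (1 / ρ ^ 2) * dsq h y x0) x * Dd h e (fun y => 1 - (1 / ρ ^ 2) * dsq h y x0) x :=
      Finset.sum_nonneg (fun e _ => mul_self_nonneg _)
    have h2 : 0 ≤ n / ρ ^ 2 := by positivity
    have h3 : ζ * (n / ρ ^ 2) ≤ 1 * (n / ρ ^ 2) := mul_le_mul_of_nonneg_right hζ1 h2
    have h4 : -(22 * (n / ρ ^ 2)) ≤ ζ * (0 - 1 / ρ ^ 2 * (2 * n)) + ζ * (0 - 1 / ρ ^ 2 * (2 * n)) +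
       ∑ e, Dd h e (fun y => 1 - (1 / ρ ^ 2) * dsq h y x0) x * Dd h e (fun y => 1 - (1 / ρ ^ 2) * dsq h y x0) x := by
      have : ζ * (0 - 1 / ρ ^ 2 * (2 * n)) = - 2 * (ζ * (n / ρ ^ 2)) := by ring
      rw [this]; linarith
    have h5 : -(22 * (n / ρ ^ 2)) ≤ s * (-(22 * (n / ρ ^ 2))) := by
      have := mul_le_mul_of_nonneg_right hs1 h2
      linarith
    calc -(22 * n / ρ ^ 2) = -(22 * (n / ρ ^ 2)) := by ring
      _ ≤ _ := h5
      _ ≤ _ := mul_le_mul_of_nonneg_left h4 hs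

end Bern

open Real Set MeasureTheory Metric Filter

section Bern2

/-- scalar cross term estimate -/
lemma cross_term {d w Z Y η δ B h : ℝ} (hh : 0 < h) (hZ : 0 ≤ Z) (hY : 0 ≤ Y) (hη : 0 ≤ η) (hδ : 0 < δ) (hB : 0 ≤ B)
    (h1 : d ^ 2 ≤ B * η) (h2 : h * |d| ≤ δ * η) (h3 : (w - h * Y) ^ 2 ≤ 4 * Z * Y) :
    -(d * w) ≤ 2 * δ * η * Y + B / δ * Z := by
  have h4 : (d * (w - h * Y)) ^ 2 ≤ (B / δ * Z + δ * η * Y) ^ 2 := by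
    calc (d * (w - h * Y)) ^ 2 = d ^ 2 * (w - h * Y) ^ 2 := by ring
      _ ≤ (B * η) * (4 * Z * Y) := mul_le_mul h1 h3 (sq_nonneg _) (by positivity)
      _ = 4 * (B / δ * Z) * (δ * η * Y) := by field_simp
      _ ≤ (B / δ * Z + δ * η * Y) ^ 2 := by nlinarith [sq_nonneg (B / δ * Z - δ * η * Y)]
  have h5 := abs_le_of_sq_le_sq h4 (by positivity)
  have h6 : -(d * h * Y) ≤ δ * η * Y := by
    have : -d * h ≤ δ * η := by
      refine le_trans ?_ h2
      rw [mul_comm]; exact mul_le_mul_of_nonneg_left (neg_le_abs d) hh.le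
    have := mul_le_mul_of_nonneg_right this hY
    linarith
  have := (abs_le.mp h5).1
  linarith

set_option maxHeartbeats 1000000 in
/-- Interior estimate of Bernstein type on a lattice cylinder. -/
lemma bern_est (n : ℕ) {a0 a1 κ CZ CX c K0 C2 ρ τ : ℝ} (ha0 : 0 < a0) (ha1 : a0 ≤ a1) (hκ : 0 ≤ κ) (hCZ : 0 ≤ CZ)
    (hCX : 0 ≤ CX) (hc : 0 < c) (hK0 : 0 < K0) (hC2 : 0 ≤ C2) (hρ : 0 < ρ) (hτ : 0 < τ) (hκK : κ * K0 ≤ c / 8) :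
    ∃ C, 0 < C ∧ ∀ (h t0 : ℝ) (x0 : Lt n) (Z X : Lt n → ℝ → ℝ) (Y : Dr n → Lt n → ℝ → ℝ), 0 < h →
      (∀ x, dsq h x x0 < ρ ^ 2 → ∀ t ∈ Icc t0 (t0 + τ), 0 ≤ Z x t ∧ 0 ≤ X x t ∧ X x t ≤ K0 ∧ h ^ 2 * Z x t ≤ C2) →
      (∀ x, dsq h x x0 < ρ ^ 2 → ∀ t ∈ Icc t0 (t0 + τ), ∀ e, 0 ≤ Y e x t ∧
        (Dd h e (fun y => Z y t) x - h * Y e x t) ^ 2 ≤ 4 * Z x t * Y e x t) →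
      (∀ x, dsq h x x0 < ρ ^ 2 → ∀ t ∈ Icc t0 (t0 + τ), ∃ Z' X' a, HasDerivAt (Z x) Z' t ∧ HasDerivAt (X x) X' t ∧ a0 ≤ a ∧ a ≤ a1 ∧
        Z' ≤ a * lapD h (fun y => Z y t) x - a0 / 2 * ∑ e, Y e x t + κ * Z x t ^ 2 + CZ ∧
        X' ≤ a * lapD h (fun y => X y t) x - c * Z x t + CX) →
      ∀ x, dsq h x x0 ≤ (ρ / 2) ^ 2 → ∀ t ∈ Icc (t0 + τ / 2) (t0 + τ), Z x t ≤ C := by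
  have ha1' : 0 < a1 := ha0.trans_le ha1
  have hρ2 : 0 < ρ ^ 2 := by positivity
  obtain ⟨δ, hδ⟩ : ∃ δ, δ = a0 / (4 * a1) := ⟨_, rfl⟩
  have hδ0 : 0 < δ := by rw [hδ]; positivity
  have hδ1 : δ ≤ 1 / 4 := by
    rw [hδ, div_le_div_iff₀ (by positivity) (by norm_num)]; linarith
  have hδa : a1 * (2 * δ) = a0 / 2 := by rw [hδ]; field_simp; norm_num
  obtain ⟨B, hB⟩ : ∃ B, B = 1 / τ + a1 * (22 * n / ρ ^ 2) + a1 * (2 * n * (225 / ρ ^ 2 / δ)) := ⟨_, rfl⟩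
  have hB0 : 0 ≤ B := by rw [hB]; positivity
  obtain ⟨lam, hlam⟩ : ∃ l, l = 1 + 225 * C2 / (δ ^ 2 * ρ ^ 2 * K0) + 4 * B / c + 2 * (CZ + CX + 1) / (c * K0) := ⟨_, rfl⟩
  have q1 : 0 ≤ 225 * C2 / (δ ^ 2 * ρ ^ 2 * K0) := by positivity
  have q2 : 0 ≤ 4 * B / c := by positivity
  have q3 : 0 ≤ 2 * (CZ + CX + 1) / (c * K0) := by positivity
  have l1 : 1 ≤ lam := by rw [hlam]; linarith
  have l2 : 225 * C2 / (δ ^ 2 * ρ ^ 2 * K0) < lam := by rw [hlam]; linarith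
  have l3 : 4 * B / c ≤ lam := by rw [hlam]; linarith
  have l4 : 2 * (CZ + CX + 1) / (c * K0) ≤ lam := by rw [hlam]; linarith
  rw [div_lt_iff₀ (by positivity)] at l2
  rw [div_le_iff₀ (by positivity)] at l3 l4
  have hl0 : 0 < lam := by linarith
  clear q1 q2 q3 hlam
  refine ⟨8 * (lam * K0), by positivity, ?_⟩
  intro h t0 x0 Z X Y hh hb hY heq
  let s : ℝ → ℝ := fun t => (t - t0) / τ
  let ζ : Lt n → ℝ := fun x => 1 - dsq h x x0 / ρ ^ 2
  let f : Lt n → ℝ → ℝ := fun x t => s t * ζ x ^ 2 * Z x t + lam * X x t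
  have hs0 : ∀ t ∈ Icc t0 (t0 + τ), 0 ≤ s t := fun t ht => div_nonneg (by linarith [ht.1]) hτ.le
  have hs1 : ∀ t ∈ Icc t0 (t0 + τ), s t ≤ 1 := fun t ht => by
    simp only [s]; rw [div_le_one hτ]; linarith [ht.2]
  have hsd : ∀ t, HasDerivAt s (1 / τ) t := fun t => ((hasDerivAt_id t).sub_const t0).div_const τ
  have hζ0 : ∀ x, dsq h x x0 < ρ ^ 2 → 0 < ζ x := fun x hx => by
    simp only [ζ]; rw [sub_pos, div_lt_one hρ2]; exact hx
  have hζ1 : ∀ x, ζ x ≤ 1 := fun x => by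
    simp only [ζ]; have := div_nonneg (dsq_nonneg h x x0) hρ2.le; linarith
  have hfd : ∀ x, ∀ t, ∀ Z' X', HasDerivAt (Z x) Z' t → HasDerivAt (X x) X' t →
      HasDerivAt (f x) ((1 / τ * ζ x ^ 2) * Z x t + s t * ζ x ^ 2 * Z' + lam * X') t := fun x t Z' X' h1 h2 =>
    (((hsd t).mul_const (ζ x ^ 2)).mul h1).add (h2.const_mul lam)
  have main : ∀ x ∈ lball hh x0 ρ, ∀ t ∈ Icc t0 (t0 + τ), f x t < 2 * (lam * K0) := by
    refine touch (lball hh x0 ρ) f t0 (t0 + τ) (2 * (lam * K0)) ?_ ?_ ?_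
    · intro x hx t ht
      rw [mem_lball] at hx
      obtain ⟨Z', X', a, h1, h2, _⟩ := heq x hx t ht
      exact (hfd x t Z' X' h1 h2).continuousAt.continuousWithinAt
    · intro x hx
      rw [mem_lball] at hx
      have ht : t0 ∈ Icc t0 (t0 + τ) := ⟨le_rfl, by linarith⟩
      obtain ⟨b1, b2, b3, b4⟩ := hb x hx t0 ht
      have : s t0 = 0 := by simp [s]
      simp only [f]
      rw [this]
      have := mul_le_mul_of_nonneg_left b3 hl0.le
      have := mul_pos hl0 hK0
      linarith
    · intro x hx t ht1 ht2 hfx hmax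
      rw [mem_lball] at hx
      have ht : t ∈ Icc t0 (t0 + τ) := ⟨ht1.le, ht2⟩
      obtain ⟨b1, b2, b3, b4⟩ := hb x hx t ht
      obtain ⟨Z', X', a, d1, d2, aa0, aa1, hZ', hX'⟩ := heq x hx t ht
      have s0 := hs0 t ht
      have s1 := hs1 t ht
      have z0 := hζ0 x hx
      have z1 := hζ1 x
      obtain ⟨η, hη⟩ : ∃ η, η = s t * ζ x ^ 2 := ⟨_, rfl⟩
      have η0 : 0 ≤ η := by rw [hη]; positivity
      have hζsq : ζ x ^ 2 ≤ 1 := pow_le_one₀ z0.le z1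
      have η1 : η ≤ 1 := by rw [hη]; exact mul_le_one₀ s1 (by positivity) hζsq
      have hηζ : η ≤ ζ x ^ 2 := by rw [hη]; exact mul_le_of_le_one_left (by positivity) s1
      have hfx' : η * Z x t + lam * X x t = 2 * (lam * K0) := by rw [hη]; exact hfx
      have hlX := mul_le_mul_of_nonneg_left b3 hl0.le
      have hlX0 := mul_nonneg hl0.le b2
      have e1 : lam * K0 ≤ η * Z x t := by linarith
      have e2 : η * Z x t ≤ 2 * (lam * K0) := by linarith
      have hcase : 15 * h ≤ δ * ρ * ζ x := by
        by_contra hcon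
        push Not at hcon
        have h1 : (δ * ρ * ζ x) ^ 2 ≤ (15 * h) ^ 2 := pow_le_pow_left₀ (by positivity) hcon.le 2
        have h2 := mul_le_mul_of_nonneg_right h1 b1
        have h3 := mul_le_mul_of_nonneg_right hηζ b1
        have h4 : δ ^ 2 * ρ ^ 2 * (lam * K0) ≤ δ ^ 2 * ρ ^ 2 * (ζ x ^ 2 * Z x t) := mul_le_mul_of_nonneg_left (by linarith) (by positivity)
        have h5 : δ ^ 2 * ρ ^ 2 * (ζ x ^ 2 * Z x t) = (δ * ρ * ζ x) ^ 2 * Z x t := by ring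
        have h6 : (15 * h) ^ 2 * Z x t = 225 * (h ^ 2 * Z x t) := by ring
        linarith
      obtain ⟨f1, f2, f3, f4⟩ := cut_facts hh hρ s0 s1 hδ0 hδ1 x x0 hx hcase
      have f2' : ∀ e, (Dd h e (fun y => s t * ζ y ^ 2) x) ^ 2 ≤ 225 / ρ ^ 2 * η := by rw [hη]; exact f2
      have f3' : ∀ e, h * |Dd h e (fun y => s t * ζ y ^ 2) x| ≤ δ * η := by rw [hη]; exact f3
      have f4' : -(22 * n / ρ ^ 2) ≤ lapD h (fun y => s t * ζ y ^ 2) x := f4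
      have hlap : lapD h (fun y => f y t) x ≤ 0 := lapD_nonpos_of_max _ _ (fun e => by
        beta_reduce
        rw [hfx]
        exact hmax _ ((mem_lball hh x0 ρ _).mpr (f1 e)))
      have e3 : lapD h (fun y => f y t) x = η * lapD h (fun y => Z y t) x + Z x t * lapD h (fun y => s t * ζ y ^ 2) x +
          ∑ e, Dd h e (fun y => s t * ζ y ^ 2) x * Dd h e (fun y => Z y t) x + lam * lapD h (fun y => X y t) x := by
        simp only [f]
        rw [lapD_add, lapD_mul_const, lapD_mul hh.ne', hη]
      rw [e3] at hlap
      have hcross : -(∑ e, Dd h e (fun y => s t * ζ y ^ 2) x * Dd h e (fun y => Z y t) x) ≤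
          2 * δ * η * (∑ e, Y e x t) + 2 * n * (225 / ρ ^ 2 / δ) * Z x t := by
        rw [← Finset.sum_neg_distrib, Finset.mul_sum]
        have : 2 * n * (225 / ρ ^ 2 / δ) * Z x t = ∑ e : Dr n, 225 / ρ ^ 2 / δ * Z x t := by
          rw [Finset.sum_const, card_Dr, nsmul_eq_mul]; push_cast; ring
        rw [this, ← Finset.sum_add_distrib]
        exact Finset.sum_le_sum (fun e _ => cross_term hh b1 (hY x hx t ht e).1 η0 hδ0 (by positivity) (f2' e) (f3' e) (hY x hx t ht e).2)
      refine ⟨_, hfd x t Z' X' d1 d2, ?_⟩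
      rw [← hη]
      have hapos : 0 < a := ha0.trans_le aa0
      obtain ⟨SY, hSY⟩ : ∃ q, q = ∑ e, Y e x t := ⟨_, rfl⟩
      obtain ⟨LZ, hLZ⟩ : ∃ q, q = lapD h (fun y => Z y t) x := ⟨_, rfl⟩
      obtain ⟨LX, hLX⟩ : ∃ q, q = lapD h (fun y => X y t) x := ⟨_, rfl⟩
      obtain ⟨Lη, hLη⟩ : ∃ q, q = lapD h (fun y => s t * ζ y ^ 2) x := ⟨_, rfl⟩
      obtain ⟨CR, hCR⟩ : ∃ q, q = ∑ e, Dd h e (fun y => s t * ζ y ^ 2) x * Dd h e (fun y => Z y t) x := ⟨_, rfl⟩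
      have hSY0 : 0 ≤ SY := by rw [hSY]; exact Finset.sum_nonneg (fun e _ => (hY x hx t ht e).1)
      rw [← hSY] at hcross hZ'
      rw [← hCR] at hcross hlap
      rw [← hLZ] at hZ' hlap
      rw [← hLX] at hX' hlap
      rw [← hLη] at f4' hlap
      obtain ⟨z, hz⟩ : ∃ z, z = Z x t := ⟨_, rfl⟩
      rw [← hz] at hZ' hX' hlap hcross b1 e1 e2 ⊢
      have g1 : η * Z' ≤ η * (a * LZ - a0 / 2 * SY + κ * z ^ 2 + CZ) := mul_le_mul_of_nonneg_left hZ' η0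
      have g2 : lam * X' ≤ lam * (a * LX - c * z + CX) := mul_le_mul_of_nonneg_left hX' hl0.le
      have g3 : a * (η * LZ + z * Lη + CR + lam * LX) ≤ 0 := mul_nonpos_of_nonneg_of_nonpos hapos.le hlap
      have g4 : a * (-(z * Lη)) ≤ a1 * (22 * n / ρ ^ 2 * z) := by
        have h1 : -(z * Lη) ≤ 22 * n / ρ ^ 2 * z := by
          have := mul_le_mul_of_nonneg_right f4' b1
          linarith
        exact (mul_le_mul_of_nonneg_left h1 hapos.le).trans (mul_le_mul_of_nonneg_right aa1 (by positivity))
      have g5 : a * (-CR) ≤ a1 * (2 * δ * η * SY + 2 * n * (225 / ρ ^ 2 / δ) * z) := by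
        refine (mul_le_mul_of_nonneg_left hcross hapos.le).trans (mul_le_mul_of_nonneg_right aa1 (by positivity))
      have g6 : η * (κ * z ^ 2) ≤ lam * c / 4 * z := by
        have h1 : κ * (η * z) ≤ κ * (2 * (lam * K0)) := mul_le_mul_of_nonneg_left e2 hκ
        have h2 : lam * (κ * K0) ≤ lam * (c / 8) := mul_le_mul_of_nonneg_left hκK hl0.le
        have h3 : κ * (η * z) ≤ lam * c / 4 := by linarith
        have := mul_le_mul_of_nonneg_right h3 b1
        calc _ = κ * (η * z) * z := by ring
          _ ≤ _ := this
      have g7 : 1 / τ * ζ x ^ 2 * z ≤ 1 / τ * z := by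
        refine mul_le_mul_of_nonneg_right (mul_le_of_le_one_right (by positivity) hζsq) b1
      have g8 : η * CZ ≤ CZ := mul_le_of_le_one_left hCZ η1
      have g9 : B * z ≤ lam * c / 4 * z := mul_le_mul_of_nonneg_right (by linarith) b1
      have g10 : lam * K0 ≤ z := e1.trans (mul_le_of_le_one_left b1 η1)
      have g11 : lam * c / 2 * (lam * K0) ≤ lam * c / 2 * z := mul_le_mul_of_nonneg_left g10 (by positivity)
      have g12 : lam * (2 * (CZ + CX + 1)) ≤ lam * (lam * (c * K0)) := mul_le_mul_of_nonneg_left l4 hl0.le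
      have g13 : 1 * (CZ + 1) ≤ lam * (CZ + 1) := mul_le_mul_of_nonneg_right l1 (by linarith)
      have g14 : a1 * (2 * δ * η * SY) = a0 / 2 * (η * SY) := by rw [← hδa]; ring
      have g15 : B * z = 1 / τ * z + a1 * (22 * n / ρ ^ 2 * z) + a1 * (2 * n * (225 / ρ ^ 2 / δ) * z) := by rw [hB]; ring
      have g16 : a1 * (2 * δ * η * SY + 2 * n * (225 / ρ ^ 2 / δ) * z) = a1 * (2 * δ * η * SY) + a1 * (2 * n * (225 / ρ ^ 2 / δ) * z) := by ring
      have g17 : lam * c / 2 * (lam * K0) = lam * (lam * (c * K0)) / 2 := by ring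
      have g18 : η * (a * LZ - a0 / 2 * SY + κ * z ^ 2 + CZ) = a * (η * LZ) - a0 / 2 * (η * SY) + η * (κ * z ^ 2) + η * CZ := by ring
      have g19 : a * (η * LZ + z * Lη + CR + lam * LX) = a * (η * LZ) - a * (-(z * Lη)) - a * (-CR) + a * (lam * LX) := by ring
      have g20 : lam * (a * LX - c * z + CX) = a * (lam * LX) - lam * c * z + lam * CX := by ring
      linarith
  intro x hx t ht
  have hx' : dsq h x x0 < ρ ^ 2 := by
    have : (ρ / 2) ^ 2 = ρ ^ 2 / 4 := by ring
    rw [this] at hx; linarith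
  have ht' : t ∈ Icc t0 (t0 + τ) := ⟨by linarith [ht.1], ht.2⟩
  have h1 := main x ((mem_lball hh x0 ρ x).mpr hx') t ht'
  obtain ⟨b1, b2, b3, b4⟩ := hb x hx' t ht'
  have h2 : 1 / 2 ≤ s t := by
    simp only [s]; rw [div_le_div_iff₀ (by norm_num) hτ]; linarith [ht.1]
  have h3 : 3 / 4 ≤ ζ x := by
    simp only [ζ]
    have : dsq h x x0 / ρ ^ 2 ≤ 1 / 4 := by
      rw [div_le_div_iff₀ hρ2 (by norm_num)]
      have : (ρ / 2) ^ 2 = ρ ^ 2 / 4 := by ring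
      rw [this] at hx; linarith
    linarith
  have h4 : (3 / 4 : ℝ) ^ 2 ≤ ζ x ^ 2 := pow_le_pow_left₀ (by norm_num) h3 2
  have h5 : 1 / 2 * (3 / 4 : ℝ) ^ 2 ≤ s t * ζ x ^ 2 := mul_le_mul h2 h4 (by norm_num) (by linarith)
  have h6 := mul_le_mul_of_nonneg_right h5 b1
  have h7 := mul_nonneg hl0.le b2
  simp only [f] at h1
  linarith

end Bern2

open Real Set MeasureTheory Metric Filter

section Fam
variable {n : ℕ}

lemma Dd_lapD_comm (h : ℝ) (e : Dr n) (f : Lt n → ℝ) (x : Lt n) :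
    lapD h (fun y => Dd h e f y) x = Dd h e (fun y => lapD h f y) x := by
  unfold lapD Dd
  beta_reduce
  rw [← Finset.sum_sub_distrib, Finset.sum_div]
  refine Finset.sum_congr rfl (fun e' _ => ?_)
  rw [show x + st e' + st e = x + st e + st e' by abel]
  ring

lemma lapD_shift {h : ℝ} (hh : h ≠ 0) (e : Dr n) (f : Lt n → ℝ) (x : Lt n) :
    lapD h f (x + st e) = lapD h f x + ∑ e', Dd h e' (fun y => Dd h e f y) x := by
  unfold lapD Dd
  beta_reduce
  rw [← Finset.sum_add_distrib]
  refine Finset.sum_congr rfl (fun e' _ => ?_)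
  rw [show x + st e' + st e = x + st e + st e' by abel]
  field_simp
  ring

lemma h_lapD {h : ℝ} (hh : h ≠ 0) (f : Lt n → ℝ) (x : Lt n) : h * lapD h f x = ∑ e, Dd h e f x := by
  unfold lapD Dd
  rw [Finset.mul_sum]
  refine Finset.sum_congr rfl (fun e' _ => ?_)
  field_simp

lemma st_neg (i : Fin n) : st ((i, false) : Dr n) = - st (i, true) := by
  unfold st sgn
  ext j
  by_cases hj : j = i
  · subst hj; simp
  · simp [hj]

lemma lapD_second {h : ℝ} (hh : h ≠ 0) (f : Lt n → ℝ) (x : Lt n) :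
    lapD h f x = - ∑ i, Dd h (i, false) (fun y => Dd h (i, true) f y) x := by
  unfold lapD Dd
  rw [sum_Dr, ← Finset.sum_neg_distrib]
  refine Finset.sum_congr rfl (fun i _ => ?_)
  beta_reduce
  rw [st_neg, show x + -st (i, true) + st (i, true) = x by abel]
  field_simp
  ring

lemma sum_Dr_sq_le (F : Dr n → ℝ) : (∑ e, F e) ^ 2 ≤ 2 * n * ∑ e, F e ^ 2 := by
  have := sq_sum_le_card_mul_sum_sq (s := Finset.univ) (f := F)
  rw [card_Dr] at this
  push_cast at this
  exact this

lemma lapD_sq_le {h : ℝ} (hh : h ≠ 0) (f : Lt n → ℝ) (x : Lt n) :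
    (lapD h f x) ^ 2 ≤ n * ∑ e', ∑ e, (Dd h e' (fun y => Dd h e f y) x) ^ 2 := by
  rw [lapD_second hh, neg_sq]
  have := sq_sum_le_card_mul_sum_sq (s := Finset.univ) (f := fun i : Fin n => Dd h (i, false) (fun y => Dd h (i, true) f y) x)
  refine this.trans ?_
  rw [Finset.card_univ, Fintype.card_fin]
  refine mul_le_mul_of_nonneg_left ?_ (by positivity)
  rw [sum_Dr (n := n)]
  refine Finset.sum_le_sum (fun i _ => ?_)
  have h1 : (Dd h (i, false) (fun y => Dd h (i, true) f y) x) ^ 2 ≤ ∑ e, (Dd h (i, false) (fun y => Dd h e f y) x) ^ 2 :=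
    Finset.single_le_sum (f := fun e => (Dd h (i, false) (fun y => Dd h e f y) x) ^ 2) (fun _ _ => sq_nonneg _) (Finset.mem_univ (i, true))
  have h2 : 0 ≤ ∑ e, (Dd h (i, true) (fun y => Dd h e f y) x) ^ 2 := Finset.sum_nonneg (fun _ _ => sq_nonneg _)
  linarith

lemma lapD_shift_sq_le {h : ℝ} (hh : h ≠ 0) (f : Lt n → ℝ) (x : Lt n) (e0 : Dr n) :
    (lapD h f (x + st e0)) ^ 2 ≤ 6 * n * ∑ e', ∑ e, (Dd h e' (fun y => Dd h e f y) x) ^ 2 := by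
  rw [lapD_shift hh]
  have h1 := lapD_sq_le hh f x
  have h2 := sum_Dr_sq_le (fun e' => Dd h e' (fun y => Dd h e0 f y) x)
  have h3 : ∑ e', (Dd h e' (fun y => Dd h e0 f y) x) ^ 2 ≤ ∑ e', ∑ e, (Dd h e' (fun y => Dd h e f y) x) ^ 2 :=
    Finset.sum_le_sum (fun e' _ => Finset.single_le_sum (f := fun e => (Dd h e' (fun y => Dd h e f y) x) ^ 2) (fun _ _ => sq_nonneg _) (Finset.mem_univ e0))
  have h4 : 2 * (n : ℝ) * ∑ e', (Dd h e' (fun y => Dd h e0 f y) x) ^ 2 ≤ 2 * n * ∑ e', ∑ e, (Dd h e' (fun y => Dd h e f y) x) ^ 2 :=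
    mul_le_mul_of_nonneg_left h3 (by positivity)
  refine (add_sq_le).trans ?_
  linarith

lemma h_lapD_sq_le {h : ℝ} (hh : h ≠ 0) (f : Lt n → ℝ) (x : Lt n) :
    h ^ 2 * (lapD h f x) ^ 2 ≤ 2 * n * ∑ e, (Dd h e f x) ^ 2 := by
  rw [← mul_pow, h_lapD hh]
  exact sum_Dr_sq_le _

lemma lapD_sum {ι : Type} [Fintype ι] (h : ℝ) (f : ι → Lt n → ℝ) (x : Lt n) :
    lapD h (fun y => ∑ j, f j y) x = ∑ j, lapD h (f j) x := by
  unfold lapD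
  rw [Finset.sum_comm]
  refine Finset.sum_congr rfl (fun e _ => ?_)
  rw [← Finset.sum_sub_distrib, Finset.sum_div]

lemma lapD_fam {ι : Type} [Fintype ι] {h : ℝ} (hh : h ≠ 0) (v : ι → Lt n → ℝ) (x : Lt n) :
    lapD h (fun y => ∑ j, v j y ^ 2) x = 2 * ∑ j, v j x * lapD h (v j) x + ∑ e, ∑ j, (Dd h e (v j) x) ^ 2 := by
  rw [lapD_sum h (fun j y => v j y ^ 2), Finset.sum_comm, Finset.mul_sum, ← Finset.sum_add_distrib]
  refine Finset.sum_congr rfl (fun j _ => ?_)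
  have : (fun y => v j y ^ 2) = fun y => v j y * v j y := by ext y; ring
  rw [this, lapD_mul hh]
  have : ∑ e, Dd h e (v j) x * Dd h e (v j) x = ∑ e, Dd h e (v j) x ^ 2 := Finset.sum_congr rfl (fun e _ => by ring)
  rw [this]; ring

lemma fam_CS {ι : Type} [Fintype ι] {h : ℝ} (hh : h ≠ 0) (v : ι → Lt n → ℝ) (x : Lt n) (e : Dr n) :
    (Dd h e (fun y => ∑ j, v j y ^ 2) x - h * ∑ j, (Dd h e (v j) x) ^ 2) ^ 2 ≤
      4 * (∑ j, v j x ^ 2) * ∑ j, (Dd h e (v j) x) ^ 2 := by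
  have e1 : Dd h e (fun y => ∑ j, v j y ^ 2) x - h * ∑ j, (Dd h e (v j) x) ^ 2 = 2 * ∑ j, v j x * Dd h e (v j) x := by
    unfold Dd
    beta_reduce
    rw [← Finset.sum_sub_distrib, Finset.sum_div, Finset.mul_sum, ← Finset.sum_sub_distrib, Finset.mul_sum]
    refine Finset.sum_congr rfl (fun j _ => ?_)
    field_simp; ring
  rw [e1]
  have := Finset.sum_mul_sq_le_sq_mul_sq Finset.univ (fun j => v j x) (fun j => Dd h e (v j) x)
  calc _ = 4 * (∑ j, v j x * Dd h e (v j) x) ^ 2 := by ring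
    _ ≤ 4 * ((∑ j, v j x ^ 2) * ∑ j, (Dd h e (v j) x) ^ 2) := by linarith
    _ = _ := by ring

lemma fam_deriv {ι : Type} [Fintype ι] {h : ℝ} (hh : h ≠ 0) (v : ι → Lt n → ℝ → ℝ) (x : Lt n) (t a : ℝ) (F : ι → ℝ)
    (hv : ∀ j, HasDerivAt (v j x) (a * lapD h (fun y => v j y t) x + F j) t) :
    HasDerivAt (fun t => ∑ j, v j x t ^ 2) (a * lapD h (fun y => ∑ j, v j y t ^ 2) x
      - a * ∑ e, ∑ j, (Dd h e (fun y => v j y t) x) ^ 2 + 2 * ∑ j, v j x t * F j) t := by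
  have h1 : HasDerivAt (fun t => ∑ j, v j x t ^ 2) (∑ j, 2 * v j x t * (a * lapD h (fun y => v j y t) x + F j)) t := by
    refine HasDerivAt.fun_sum (fun j _ => ?_)
    have := (hv j).fun_pow 2
    simpa using this
  have e1 : a * lapD h (fun y => ∑ j, v j y t ^ 2) x - a * ∑ e, ∑ j, (Dd h e (fun y => v j y t) x) ^ 2 + 2 * ∑ j, v j x t * F j
      = ∑ j, 2 * v j x t * (a * lapD h (fun y => v j y t) x + F j) := by
    rw [lapD_fam hh (fun j y => v j y t)]
    have : ∑ j, 2 * v j x t * (a * lapD h (fun y => v j y t) x + F j) = 2 * a * ∑ j, v j x t * lapD h (fun y => v j y t) x + 2 * ∑ j, v j x t * F j := by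
      rw [Finset.mul_sum, Finset.mul_sum, ← Finset.sum_add_distrib]
      refine Finset.sum_congr rfl (fun j _ => by ring)
    rw [this]; ring
  rw [e1]; exact h1

/-- Bernstein estimate for a family. -/
lemma bern_fam (n : ℕ) (ι : Type) [Fintype ι] {a0 a1 κ CZ CX c K0 C2 ρ τ : ℝ} (ha0 : 0 < a0) (ha1 : a0 ≤ a1) (hκ : 0 ≤ κ) (hCZ : 0 ≤ CZ)
    (hCX : 0 ≤ CX) (hc : 0 < c) (hK0 : 0 < K0) (hC2 : 0 ≤ C2) (hρ : 0 < ρ) (hτ : 0 < τ) (hκK : κ * K0 ≤ c / 8) :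
    ∃ C, 0 < C ∧ ∀ (h t0 : ℝ) (x0 : Lt n) (v : ι → Lt n → ℝ → ℝ) (X : Lt n → ℝ → ℝ), 0 < h →
      (∀ x, dsq h x x0 < ρ ^ 2 → ∀ t ∈ Icc t0 (t0 + τ), 0 ≤ X x t ∧ X x t ≤ K0 ∧ h ^ 2 * (∑ j, v j x t ^ 2) ≤ C2) →
      (∀ x, dsq h x x0 < ρ ^ 2 → ∀ t ∈ Icc t0 (t0 + τ), ∃ a X', ∃ F : ι → ℝ, a0 ≤ a ∧ a ≤ a1 ∧
        (∀ j, HasDerivAt (v j x) (a * lapD h (fun y => v j y t) x + F j) t) ∧ HasDerivAt (X x) X' t ∧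
        2 * ∑ j, v j x t * F j ≤ a0 / 2 * (∑ e, ∑ j, (Dd h e (fun y => v j y t) x) ^ 2) + κ * (∑ j, v j x t ^ 2) ^ 2 + CZ ∧
        X' ≤ a * lapD h (fun y => X y t) x - c * (∑ j, v j x t ^ 2) + CX) →
      ∀ x, dsq h x x0 ≤ (ρ / 2) ^ 2 → ∀ t ∈ Icc (t0 + τ / 2) (t0 + τ), ∑ j, v j x t ^ 2 ≤ C := by
  obtain ⟨C, hC, H⟩ := bern_est n ha0 ha1 hκ hCZ hCX hc hK0 hC2 hρ hτ hκK
  refine ⟨C, hC, ?_⟩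
  intro h t0 x0 v X hh hb heq
  refine H h t0 x0 (fun x t => ∑ j, v j x t ^ 2) X (fun e x t => ∑ j, (Dd h e (fun y => v j y t) x) ^ 2) hh ?_ ?_ ?_
  · intro x hx t ht
    exact ⟨Finset.sum_nonneg (fun _ _ => sq_nonneg _), hb x hx t ht⟩
  · intro x hx t ht e
    exact ⟨Finset.sum_nonneg (fun _ _ => sq_nonneg _), fam_CS hh.ne' (fun j y => v j y t) x e⟩
  · intro x hx t ht
    obtain ⟨a, X', F, b0, b1, hv, hX, h1, h2⟩ := heq x hx t ht
    refine ⟨_, X', a, fam_deriv hh.ne' v x t a F hv, hX, b0, b1, ?_, h2⟩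
    have hY0 : 0 ≤ ∑ e, ∑ j, (Dd h e (fun y => v j y t) x) ^ 2 := Finset.sum_nonneg (fun _ _ => Finset.sum_nonneg (fun _ _ => sq_nonneg _))
    have := mul_le_mul_of_nonneg_right b0 hY0
    linarith

end Fam

open Real Set MeasureTheory Metric Filter

section Steps
variable {n : ℕ}

lemma sq_deriv {h : ℝ} (hh : h ≠ 0) (f : Lt n → ℝ → ℝ) (x : Lt n) (t a G : ℝ)
    (hf : HasDerivAt (f x) (a * lapD h (fun y => f y t) x + G) t) :
    HasDerivAt (fun t => f x t ^ 2) (a * lapD h (fun y => f y t ^ 2) x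
      - a * ∑ e, (Dd h e (fun y => f y t) x) ^ 2 + 2 * (f x t * G)) t := by
  have := fam_deriv (ι := Unit) hh (fun _ => f) x t a (fun _ => G) (fun _ => hf)
  simpa using this

lemma nb {h r : ℝ} (hh : 0 < h) (hr : 0 < r) (hhr : h ≤ r) {x x0 : Lt n} (hx : dsq h x x0 < r ^ 2) (e : Dr n) :
    dsq h (x + st e) x0 ≤ (2 * r) ^ 2 :=
  (dsq_step_le hh.le hr.le hx.le e).trans (pow_le_pow_left₀ (by positivity) (by linarith) 2)

lemma Dd_deriv (h : ℝ) (e : Dr n) (g g' : Lt n → ℝ → ℝ) (x : Lt n) (t : ℝ)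
    (h1 : HasDerivAt (g x) (g' x t) t) (h2 : HasDerivAt (g (x + st e)) (g' (x + st e) t) t) :
    HasDerivAt (fun t => Dd h e (fun y => g y t) x) (Dd h e (fun y => g' y t) x) t :=
  (h2.sub h1).div_const h

lemma Dd_eq (h : ℝ) (e : Dr n) (a g G : Lt n → ℝ) (x : Lt n) :
    Dd h e (fun y => a y * lapD h g y + G y) x = a x * lapD h (fun y => Dd h e g y) x +
      (Dd h e a x * lapD h g (x + st e) + Dd h e G x) := by
  rw [Dd_lapD_comm]
  unfold Dd
  beta_reduce
  ring

lemma grad_deriv (h : ℝ) (e : Dr n) (a g G : Lt n → ℝ → ℝ) (x : Lt n) (t : ℝ)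
    (h1 : HasDerivAt (g x) (a x t * lapD h (fun y => g y t) x + G x t) t)
    (h2 : HasDerivAt (g (x + st e)) (a (x + st e) t * lapD h (fun y => g y t) (x + st e) + G (x + st e) t) t) :
    HasDerivAt (fun t => Dd h e (fun y => g y t) x) (a x t * lapD h (fun y => Dd h e (fun z => g z t) y) x +
      (Dd h e (fun y => a y t) x * lapD h (fun y => g y t) (x + st e) + Dd h e (fun y => G y t) x)) t := by
  have := Dd_deriv h e g (fun y t => a y t * lapD h (fun z => g z t) y + G y t) x t h1 h2
  rw [← Dd_eq h e (fun y => a y t) (fun y => g y t) (fun y => G y t) x]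
  exact this

/-- bound of the lower order terms for gradients -/
lemma grad_F {h A B a0 : ℝ} (hh : h ≠ 0) (hA : 0 ≤ A) (hB : 0 ≤ B) (ha0 : 0 < a0) (a g G : Lt n → ℝ) (x : Lt n)
    (h1 : ∀ e, |Dd h e a x| ≤ A) (h2 : ∀ e, |Dd h e G x| ≤ B * (|Dd h e g x| + 1)) :
    2 * ∑ e, Dd h e g x * (Dd h e a x * lapD h g (x + st e) + Dd h e G x) ≤
      a0 / 2 * (∑ e', ∑ e, (Dd h e' (fun y => Dd h e g y) x) ^ 2) +
      (A ^ 2 * (2 * (12 * n ^ 2 + 1) / a0) + 3 * B) * (∑ e, (Dd h e g x) ^ 2) + 2 * n * B := by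
  obtain ⟨Y, hY⟩ : ∃ Y, Y = ∑ e', ∑ e, (Dd h e' (fun y => Dd h e g y) x) ^ 2 := ⟨_, rfl⟩
  have hY0 : 0 ≤ Y := by rw [hY]; exact Finset.sum_nonneg (fun _ _ => Finset.sum_nonneg (fun _ _ => sq_nonneg _))
  rw [← hY]
  obtain ⟨θ, hθ⟩ : ∃ θ, θ = a0 / (2 * (12 * n ^ 2 + 1)) := ⟨_, rfl⟩
  have hθ0 : 0 < θ := by rw [hθ]; positivity
  have hA2 : A ^ 2 * (2 * (12 * n ^ 2 + 1) / a0) = A ^ 2 / θ := by rw [hθ]; field_simp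
  rw [hA2]
  have per : ∀ e, 2 * (Dd h e g x * (Dd h e a x * lapD h g (x + st e) + Dd h e G x)) ≤
      θ * (6 * n * Y) + (A ^ 2 / θ + 3 * B) * (Dd h e g x) ^ 2 + B := by
    intro e
    have hl := lapD_shift_sq_le hh g x e
    rw [← hY] at hl
    obtain ⟨v, hv⟩ : ∃ v, v = Dd h e g x := ⟨_, rfl⟩
    obtain ⟨l, hl'⟩ : ∃ v, v = lapD h g (x + st e) := ⟨_, rfl⟩
    obtain ⟨d, hd'⟩ : ∃ v, v = Dd h e a x := ⟨_, rfl⟩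
    obtain ⟨g', hg'⟩ : ∃ v, v = Dd h e G x := ⟨_, rfl⟩
    have h1 := h1 e
    have h2 := h2 e
    rw [← hv, ← hg'] at h2
    rw [← hd'] at h1
    rw [← hl'] at hl
    rw [← hv, ← hl', ← hd', ← hg']
    have q1 : v * d * l ≤ |v| * A * |l| := by
      refine (le_abs_self _).trans ?_
      rw [abs_mul, abs_mul]
      gcongr
    have q2 : v * g' ≤ |v| * (B * (|v| + 1)) := by
      refine (le_abs_self _).trans ?_
      rw [abs_mul]
      gcongr
    have q3 : 2 * (|v| * A * |l|) ≤ θ * l ^ 2 + A ^ 2 / θ * v ^ 2 := by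
      have h5 : 0 ≤ (θ * |l| - A * |v|) ^ 2 / θ := by positivity
      have h6 : (θ * |l| - A * |v|) ^ 2 / θ = θ * |l| ^ 2 - 2 * (|v| * A * |l|) + A ^ 2 / θ * |v| ^ 2 := by
        field_simp; ring
      rw [h6, sq_abs, sq_abs] at h5
      linarith
    have q4 : 2 * |v| ≤ v ^ 2 + 1 := by nlinarith [sq_nonneg (|v| - 1), sq_abs v]
    have q5 : B * (2 * |v|) ≤ B * (v ^ 2 + 1) := mul_le_mul_of_nonneg_left q4 hB
    have q6 : |v| * (B * (|v| + 1)) = B * v ^ 2 + B * |v| := by rw [← sq_abs v]; ring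
    have q7 := mul_le_mul_of_nonneg_left hl hθ0.le
    linarith
  rw [Finset.mul_sum]
  refine (Finset.sum_le_sum (fun e _ => per e)).trans ?_
  rw [Finset.sum_add_distrib, Finset.sum_add_distrib, Finset.sum_const, Finset.sum_const, card_Dr, ← Finset.mul_sum, nsmul_eq_mul, nsmul_eq_mul]
  push_cast
  have : 2 * (n : ℝ) * (θ * (6 * n * Y)) ≤ a0 / 2 * Y := by
    have e1 : 2 * (n : ℝ) * (θ * (6 * n * Y)) = (θ * (12 * n ^ 2)) * Y := by ring
    rw [e1]
    refine mul_le_mul_of_nonneg_right ?_ hY0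
    rw [hθ, div_mul_eq_mul_div, div_le_div_iff₀ (by positivity) (by norm_num)]
    nlinarith
  linarith

/-- gradient bound for u, assuming small oscillation -/
lemma gradU (n : ℕ) {p m M : ℝ} (hp : 1 ≤ p) (hm : 0 < m) (hmM : m ≤ M) : ∃ η, 0 < η ∧ ∀ r τ : ℝ, 0 < r → 0 < τ → ∃ C, 0 < C ∧
    ∀ (h t0 Mb : ℝ) (x0 : Lt n) (u : Lt n → ℝ → ℝ), 0 < h → h ≤ r →
    (∀ x, dsq h x x0 ≤ (2 * r) ^ 2 → ∀ t ∈ Icc t0 (t0 + τ), HasDerivAt (u x) (u x t ^ p * lapD h (fun y => u y t) x) t ∧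
      m ≤ u x t ∧ u x t ≤ M ∧ Mb - η ≤ u x t ∧ u x t ≤ Mb) →
    ∀ x, dsq h x x0 ≤ (r / 2) ^ 2 → ∀ t ∈ Icc (t0 + τ / 2) (t0 + τ), ∑ e, (Dd h e (fun y => u y t) x) ^ 2 ≤ C := by
  have hM : 0 < M := hm.trans_le hmM
  obtain ⟨a0, ha0⟩ : ∃ a, a = m ^ p := ⟨_, rfl⟩
  obtain ⟨a1, ha1⟩ : ∃ a, a = M ^ p := ⟨_, rfl⟩
  have ha00 : 0 < a0 := by rw [ha0]; exact Real.rpow_pos_of_pos hm p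
  have ha01 : a0 ≤ a1 := by rw [ha0, ha1]; exact Real.rpow_le_rpow hm.le hmM (by linarith)
  obtain ⟨L, hL⟩ : ∃ L, L = p * M ^ (p - 1) := ⟨_, rfl⟩
  have hL0 : 0 < L := by rw [hL]; have := Real.rpow_pos_of_pos hM (p - 1); positivity
  obtain ⟨θ, hθ⟩ : ∃ θ, θ = a0 / (12 * n + 1) := ⟨_, rfl⟩
  have hθ0 : 0 < θ := by rw [hθ]; positivity
  obtain ⟨κ, hκ⟩ : ∃ κ, κ = L ^ 2 / θ := ⟨_, rfl⟩
  have hκ0 : 0 < κ := by rw [hκ]; positivity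
  obtain ⟨η, hη⟩ : ∃ η, η = Real.sqrt (a0 / 8 / κ) := ⟨_, rfl⟩
  have hη0 : 0 < η := by rw [hη]; exact Real.sqrt_pos.mpr (by positivity)
  have hη2 : κ * η ^ 2 ≤ a0 / 8 := by
    rw [hη, Real.sq_sqrt (by positivity)]; field_simp; norm_num
  refine ⟨η, hη0, ?_⟩
  intro r τ hr hτ
  obtain ⟨C, hC, H⟩ := bern_fam n (Dr n) (CZ := 0) (CX := 0) (C2 := 2 * n * M ^ 2) (K0 := η ^ 2) (c := a0) ha00 ha01 hκ0.le le_rfl le_rfl ha00 (by positivity) (by positivity) hr hτ hη2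
  refine ⟨C, hC, ?_⟩
  intro h t0 Mb x0 u hh hhr hu
  have hin : ∀ x, dsq h x x0 < r ^ 2 → dsq h x x0 ≤ (2 * r) ^ 2 := fun x hx => hx.le.trans (pow_le_pow_left₀ hr.le (by linarith) 2)
  refine H h t0 x0 (fun e x t => Dd h e (fun y => u y t) x) (fun x t => (u x t - (Mb - η)) ^ 2) hh ?_ ?_
  · intro x hx t ht
    obtain ⟨_, b1, b2, b3, b4⟩ := hu x (hin x hx) t ht
    refine ⟨sq_nonneg _, pow_le_pow_left₀ (by linarith) (by linarith) 2, ?_⟩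
    rw [Finset.mul_sum]
    have per : ∀ e, h ^ 2 * (Dd h e (fun y => u y t) x) ^ 2 ≤ M ^ 2 := by
      intro e
      obtain ⟨_, c1, c2, c3, c4⟩ := hu _ (nb hh hr hhr hx e) t ht
      rw [← mul_pow]
      have : h * Dd h e (fun y => u y t) x = u (x + st e) t - u x t := by unfold Dd; field_simp
      rw [this]
      exact sq_le_sq' (by linarith) (by linarith)
    refine (Finset.sum_le_sum (fun e _ => per e)).trans ?_
    rw [Finset.sum_const, card_Dr, nsmul_eq_mul]; push_cast; exact le_rfl
  · intro x hx t ht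
    obtain ⟨d1, b1, b2, b3, b4⟩ := hu x (hin x hx) t ht
    have hup : 0 ≤ u x t := by linarith
    refine ⟨u x t ^ p, _, fun e => Dd h e (fun y => u y t ^ p) x * lapD h (fun y => u y t) (x + st e) + Dd h e (fun _ => 0) x, ?_, ?_, ?_,
      sq_deriv hh.ne' (fun y t => u y t - (Mb - η)) x t (u x t ^ p) 0 ?_, ?_, ?_⟩
    · rw [ha0]; exact Real.rpow_le_rpow hm.le b1 (by linarith)
    · rw [ha1]; exact Real.rpow_le_rpow hup b2 (by linarith)
    · intro e
      obtain ⟨d2, _⟩ := hu _ (nb hh hr hhr hx e) t ht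
      exact grad_deriv h e (fun y t => u y t ^ p) u (fun _ _ => 0) x t (by rw [add_zero]; exact d1) (by rw [add_zero]; exact d2)
    · rw [add_zero]
      have : lapD h (fun y => u y t - (Mb - η)) x = lapD h (fun y => u y t) x := by
        rw [lapD_sub, lapD_const, sub_zero]
      rw [this]
      exact d1.sub_const _
    · obtain ⟨Y, hY⟩ : ∃ Y, Y = ∑ e', ∑ e, (Dd h e' (fun y => Dd h e (fun z => u z t) y) x) ^ 2 := ⟨_, rfl⟩
      have hY0 : 0 ≤ Y := by rw [hY]; exact Finset.sum_nonneg (fun _ _ => Finset.sum_nonneg (fun _ _ => sq_nonneg _))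
      rw [← hY]
      obtain ⟨S, hS⟩ : ∃ S, S = Real.sqrt (6 * n * Y) := ⟨_, rfl⟩
      have hS0 : 0 ≤ S := by rw [hS]; exact Real.sqrt_nonneg _
      have hS2 : S ^ 2 = 6 * n * Y := by rw [hS, Real.sq_sqrt (by positivity)]
      have per : ∀ e, Dd h e (fun y => u y t) x * (Dd h e (fun y => u y t ^ p) x * lapD h (fun y => u y t) (x + st e) + Dd h e (fun _ => (0:ℝ)) x) ≤ (Dd h e (fun y => u y t) x) ^ 2 * (L * S) := by
        intro e
        obtain ⟨_, c1, c2, c3, c4⟩ := hu _ (nb hh hr hhr hx e) t ht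
        have hl := lapD_shift_sq_le hh.ne' (fun y => u y t) x e
        rw [← hY, ← hS2] at hl
        have hl2 := abs_le_of_sq_le_sq hl hS0
        have hz : Dd h e (fun _ => (0:ℝ)) x = 0 := by simp [Dd]
        rw [hz, add_zero]
        have hda : |Dd h e (fun y => u y t ^ p) x| ≤ L * |Dd h e (fun y => u y t) x| := by
          unfold Dd
          beta_reduce
          rw [abs_div, abs_div, abs_of_pos hh, hL, mul_div_assoc']
          exact div_le_div_of_nonneg_right (rpow_lip_abs hp hup (by linarith) c2 b2) hh.le
        refine (le_abs_self _).trans ?_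
        rw [abs_mul, abs_mul]
        calc _ ≤ |Dd h e (fun y => u y t) x| * ((L * |Dd h e (fun y => u y t) x|) * S) := by gcongr
          _ = |Dd h e (fun y => u y t) x| ^ 2 * (L * S) := by ring
          _ = _ := by rw [sq_abs]
      obtain ⟨Z, hZ⟩ : ∃ Z, Z = ∑ e, (Dd h e (fun y => u y t) x) ^ 2 := ⟨_, rfl⟩
      have hsum : ∑ e, Dd h e (fun y => u y t) x * (Dd h e (fun y => u y t ^ p) x * lapD h (fun y => u y t) (x + st e) + Dd h e (fun _ => (0:ℝ)) x) ≤ Z * (L * S) := by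
        rw [hZ, Finset.sum_mul]
        exact Finset.sum_le_sum (fun e _ => per e)
      rw [← hZ]
      have q3 : 2 * (Z * (L * S)) ≤ θ * S ^ 2 + κ * Z ^ 2 := by
        have h5 : 0 ≤ (θ * S - L * Z) ^ 2 / θ := by positivity
        have h6 : (θ * S - L * Z) ^ 2 / θ = θ * S ^ 2 - 2 * (Z * (L * S)) + κ * Z ^ 2 := by
          rw [hκ]; field_simp; ring
        rw [h6] at h5; linarith
      have q4 : θ * S ^ 2 ≤ a0 / 2 * Y := by
        rw [hS2]
        have : θ * (6 * n * Y) = θ * (6 * n) * Y := by ring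
        rw [this]
        refine mul_le_mul_of_nonneg_right ?_ hY0
        rw [hθ, div_mul_eq_mul_div, div_le_div_iff₀ (by positivity) (by norm_num)]
        nlinarith
      linarith
    · have hD : ∀ e, Dd h e (fun y => u y t - (Mb - η)) x = Dd h e (fun y => u y t) x := fun e => by
        unfold Dd; beta_reduce; ring
      simp only [hD]
      have hZ0 : 0 ≤ ∑ e, (Dd h e (fun y => u y t) x) ^ 2 := Finset.sum_nonneg (fun _ _ => sq_nonneg _)
      have : a0 ≤ u x t ^ p := by rw [ha0]; exact Real.rpow_le_rpow hm.le b1 (by linarith)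
      have := mul_le_mul_of_nonneg_right this hZ0
      linarith

end Steps

open Real Set MeasureTheory Metric Filter

section Steps2

lemma gradStep (n : ℕ) {a0 a1 C r τ : ℝ} (ha0 : 0 < a0) (ha1 : a0 ≤ a1) (hC : 0 < C) (hr : 0 < r) (hτ : 0 < τ) : ∃ C', 0 < C' ∧
    ∀ (h t0 : ℝ) (x0 : Lt n) (a f G : Lt n → ℝ → ℝ), 0 < h → h ≤ r →
    (∀ x, dsq h x x0 ≤ (2 * r) ^ 2 → ∀ t ∈ Icc t0 (t0 + τ), HasDerivAt (f x) (a x t * lapD h (fun y => f y t) x + G x t) t ∧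
      a0 ≤ a x t ∧ a x t ≤ a1 ∧ |f x t| ≤ C ∧ |G x t| ≤ C) →
    (∀ x, dsq h x x0 < r ^ 2 → ∀ t ∈ Icc t0 (t0 + τ), ∀ e, |Dd h e (fun y => a y t) x| ≤ C ∧
      |Dd h e (fun y => G y t) x| ≤ C * (|Dd h e (fun y => f y t) x| + 1)) →
    ∀ x, dsq h x x0 ≤ (r / 2) ^ 2 → ∀ t ∈ Icc (t0 + τ / 2) (t0 + τ), ∑ e, (Dd h e (fun y => f y t) x) ^ 2 ≤ C' := by
  obtain ⟨Q, hQ⟩ : ∃ Q, Q = C ^ 2 * (2 * (12 * n ^ 2 + 1) / a0) + 3 * C := ⟨_, rfl⟩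
  have hQ0 : 0 < Q := by rw [hQ]; positivity
  obtain ⟨κ, hκ⟩ : ∃ κ, κ = a0 / (8 * C ^ 2) := ⟨_, rfl⟩
  have hκ0 : 0 < κ := by rw [hκ]; positivity
  have hκK : κ * C ^ 2 ≤ a0 / 8 := by rw [hκ]; field_simp; exact le_rfl
  obtain ⟨C', hC', H⟩ := bern_fam n (Dr n) (CZ := Q ^ 2 / (4 * κ) + 2 * n * C) (CX := 2 * C ^ 2) (C2 := 2 * n * (2 * C) ^ 2) (K0 := C ^ 2) (c := a0) ha0 ha1 hκ0.le (by positivity) (by positivity) ha0 (by positivity) (by positivity) hr hτ hκK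
  refine ⟨C', hC', ?_⟩
  intro h t0 x0 a f G hh hhr hf hD
  have hin : ∀ x, dsq h x x0 < r ^ 2 → dsq h x x0 ≤ (2 * r) ^ 2 := fun x hx => hx.le.trans (pow_le_pow_left₀ hr.le (by linarith) 2)
  refine H h t0 x0 (fun e x t => Dd h e (fun y => f y t) x) (fun x t => (f x t) ^ 2) hh ?_ ?_
  · intro x hx t ht
    obtain ⟨_, b1, b2, b3, b4⟩ := hf x (hin x hx) t ht
    refine ⟨sq_nonneg _, ?_, ?_⟩
    · rw [← sq_abs]; exact pow_le_pow_left₀ (abs_nonneg _) b3 2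
    rw [Finset.mul_sum]
    have per : ∀ e, h ^ 2 * (Dd h e (fun y => f y t) x) ^ 2 ≤ (2 * C) ^ 2 := by
      intro e
      obtain ⟨_, c1, c2, c3, c4⟩ := hf _ (nb hh hr hhr hx e) t ht
      rw [← mul_pow]
      have : h * Dd h e (fun y => f y t) x = f (x + st e) t - f x t := by unfold Dd; field_simp
      rw [this]
      rw [abs_le] at b3 c3
      exact sq_le_sq' (by linarith) (by linarith)
    refine (Finset.sum_le_sum (fun e _ => per e)).trans ?_
    rw [Finset.sum_const, card_Dr, nsmul_eq_mul]; push_cast; exact le_rfl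
  · intro x hx t ht
    obtain ⟨d1, b1, b2, b3, b4⟩ := hf x (hin x hx) t ht
    refine ⟨a x t, _, fun e => Dd h e (fun y => a y t) x * lapD h (fun y => f y t) (x + st e) + Dd h e (fun y => G y t) x, b1, b2, ?_,
      sq_deriv hh.ne' f x t (a x t) (G x t) d1, ?_, ?_⟩
    · intro e
      obtain ⟨d2, _⟩ := hf _ (nb hh hr hhr hx e) t ht
      exact grad_deriv h e a f G x t d1 d2
    · have h1 := grad_F hh.ne' hC.le hC.le ha0 (fun y => a y t) (fun y => f y t) (fun y => G y t) x (fun e => (hD x hx t ht e).1) (fun e => (hD x hx t ht e).2)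
      rw [← hQ] at h1
      obtain ⟨Z, hZ⟩ : ∃ Z, Z = ∑ e, (Dd h e (fun y => f y t) x) ^ 2 := ⟨_, rfl⟩
      rw [← hZ] at h1 ⊢
      have h2 : Q * Z ≤ κ * Z ^ 2 + Q ^ 2 / (4 * κ) := by
        have h5 : 0 ≤ (2 * κ * Z - Q) ^ 2 / (4 * κ) := by positivity
        have h6 : (2 * κ * Z - Q) ^ 2 / (4 * κ) = κ * Z ^ 2 - Q * Z + Q ^ 2 / (4 * κ) := by field_simp; ring
        rw [h6] at h5; linarith
      linarith
    · have hZ0 : 0 ≤ ∑ e, (Dd h e (fun y => f y t) x) ^ 2 := Finset.sum_nonneg (fun _ _ => sq_nonneg _)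
      have h1 := mul_le_mul_of_nonneg_right b1 hZ0
      have h2 : f x t * G x t ≤ C ^ 2 := by
        refine (le_abs_self _).trans ?_
        rw [abs_mul, sq]
        gcongr
      linarith

lemma valStep (n : ℕ) {a0 a1 C r τ : ℝ} (ha0 : 0 < a0) (ha1 : a0 ≤ a1) (hC : 0 < C) (hr : 0 < r) (hτ : 0 < τ) : ∃ C', 0 < C' ∧
    ∀ (h t0 : ℝ) (x0 : Lt n) (a g G f F : Lt n → ℝ → ℝ), 0 < h → h ≤ r →
    (∀ x, dsq h x x0 ≤ (2 * r) ^ 2 → ∀ t ∈ Icc t0 (t0 + τ), HasDerivAt (g x) (a x t * lapD h (fun y => g y t) x + G x t) t ∧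
      a0 ≤ a x t ∧ a x t ≤ a1 ∧ |G x t| ≤ C) →
    (∀ x, dsq h x x0 < r ^ 2 → ∀ t ∈ Icc t0 (t0 + τ), (∀ e, |Dd h e (fun y => a y t) x| ≤ C ∧
      |Dd h e (fun y => G y t) x| ≤ C * (|Dd h e (fun y => g y t) x| + 1)) ∧ ∑ e, (Dd h e (fun y => g y t) x) ^ 2 ≤ C ∧
      HasDerivAt (f x) (a x t * lapD h (fun y => f y t) x + F x t) t ∧ |F x t| ≤ C * (1 + f x t ^ 2) ∧
      f x t = a x t * lapD h (fun y => g y t) x + G x t) →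
    ∀ x, dsq h x x0 ≤ (r / 2) ^ 2 → ∀ t ∈ Icc (t0 + τ / 2) (t0 + τ), f x t ^ 2 ≤ C' := by
  have ha1' : 0 < a1 := ha0.trans_le ha1
  obtain ⟨Q, hQ⟩ : ∃ Q, Q = C ^ 2 * (2 * (12 * n ^ 2 + 1) / a0) + 3 * C := ⟨_, rfl⟩
  have hQ0 : 0 < Q := by rw [hQ]; positivity
  obtain ⟨D, hD⟩ : ∃ D, D = 2 * a1 ^ 2 * n + 1 := ⟨_, rfl⟩
  have hD0 : 0 < D := by rw [hD]; positivity
  obtain ⟨c, hc⟩ : ∃ c, c = a0 / (2 * D) := ⟨_, rfl⟩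
  have hc0 : 0 < c := by rw [hc]; positivity
  have hcD : c * D = a0 / 2 := by rw [hc]; field_simp
  obtain ⟨κ, hκ⟩ : ∃ κ, κ = c / (8 * C) := ⟨_, rfl⟩
  have hκ0 : 0 < κ := by rw [hκ]; positivity
  have hκK : κ * C ≤ c / 8 := by rw [hκ]; field_simp; exact le_rfl
  obtain ⟨b, hb⟩ : ∃ b, b = κ / 2 + C ^ 2 / (κ / 2) := ⟨_, rfl⟩
  have hb0 : 0 < b := by rw [hb]; positivity
  obtain ⟨C', hC', H⟩ := bern_fam n Unit (CZ := b ^ 2 / (2 * κ) + C ^ 2 / (κ / 2)) (CX := Q * C + 2 * n * C + c * (2 * C ^ 2)) (C2 := 2 * (a1 ^ 2 * (2 * n * C)) + 2 * (r ^ 2 * C ^ 2)) (K0 := C) (c := c) ha0 ha1 hκ0.le (by positivity) (by positivity) hc0 (by positivity) (by positivity) hr hτ hκK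
  refine ⟨C', hC', ?_⟩
  intro h t0 x0 a g G f F hh hhr hg hf
  have hin : ∀ x, dsq h x x0 < r ^ 2 → dsq h x x0 ≤ (2 * r) ^ 2 := fun x hx => hx.le.trans (pow_le_pow_left₀ hr.le (by linarith) 2)
  have key := H h t0 x0 (fun _ => f) (fun x t => ∑ e, (Dd h e (fun y => g y t) x) ^ 2) hh ?_ ?_
  · intro x hx t ht
    have := key x hx t ht
    simpa using this
  · intro x hx t ht
    obtain ⟨_, b1, b2, b4⟩ := hg x (hin x hx) t ht
    obtain ⟨c1, c2, c3, c4, c5⟩ := hf x hx t ht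
    refine ⟨Finset.sum_nonneg (fun _ _ => sq_nonneg _), c2, ?_⟩
    rw [Fintype.sum_unique]
    have h1 := h_lapD_sq_le hh.ne' (fun y => g y t) x
    obtain ⟨l, hl⟩ : ∃ l, l = lapD h (fun y => g y t) x := ⟨_, rfl⟩
    rw [← hl] at h1 c5
    have h2 : h ^ 2 * l ^ 2 ≤ 2 * n * C := h1.trans (mul_le_mul_of_nonneg_left c2 (by positivity))
    have ha2 : a x t ^ 2 ≤ a1 ^ 2 := pow_le_pow_left₀ (by linarith) b2 2
    have h3 : a x t ^ 2 * (h ^ 2 * l ^ 2) ≤ a1 ^ 2 * (2 * n * C) := mul_le_mul ha2 h2 (by positivity) (by positivity)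
    have h4 : h ^ 2 * G x t ^ 2 ≤ r ^ 2 * C ^ 2 := by
      refine mul_le_mul (pow_le_pow_left₀ hh.le hhr 2) ?_ (by positivity) (by positivity)
      rw [← sq_abs]; exact pow_le_pow_left₀ (abs_nonneg _) b4 2
    rw [c5]
    have h5 : (a x t * l + G x t) ^ 2 ≤ 2 * ((a x t * l) ^ 2 + G x t ^ 2) := add_sq_le
    have h6 := mul_le_mul_of_nonneg_left h5 (sq_nonneg h)
    have h7 : h ^ 2 * (2 * ((a x t * l) ^ 2 + G x t ^ 2)) = 2 * (a x t ^ 2 * (h ^ 2 * l ^ 2)) + 2 * (h ^ 2 * G x t ^ 2) := by ring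
    linarith
  · intro x hx t ht
    obtain ⟨d1, b1, b2, b4⟩ := hg x (hin x hx) t ht
    obtain ⟨c1, c2, c3, c4, c5⟩ := hf x hx t ht
    have hfam := fam_deriv hh.ne' (fun e x t => Dd h e (fun y => g y t) x) x t (a x t)
      (fun e => Dd h e (fun y => a y t) x * lapD h (fun y => g y t) (x + st e) + Dd h e (fun y => G y t) x) (fun e => by
        obtain ⟨d2, _⟩ := hg _ (nb hh hr hhr hx e) t ht
        exact grad_deriv h e a g G x t d1 d2)
    refine ⟨a x t, _, fun _ => F x t, b1, b2, fun _ => c3, hfam, ?_, ?_⟩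
    · simp only [Fintype.sum_unique]
      have hY0 : 0 ≤ ∑ e, (Dd h e (fun y => f y t) x) ^ 2 := Finset.sum_nonneg (fun _ _ => sq_nonneg _)
      have hY1 := mul_nonneg (by linarith : 0 ≤ a0 / 2) hY0
      obtain ⟨q, hq⟩ : ∃ q, q = f x t ^ 2 := ⟨_, rfl⟩
      have hq0 : 0 ≤ q := by rw [hq]; positivity
      have h1 : f x t * F x t ≤ |f x t| * (C * (1 + q)) := by
        refine (le_abs_self _).trans ?_
        rw [abs_mul, hq]
        gcongr
      rw [← hq]
      obtain ⟨ε, hε⟩ : ∃ ε, ε = κ / 2 := ⟨_, rfl⟩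
      have hε0 : 0 < ε := by rw [hε]; positivity
      have h2 : 2 * C * |f x t| ≤ ε * q + C ^ 2 / ε := by
        have h5 : 0 ≤ (ε * |f x t| - C) ^ 2 / ε := by positivity
        have h6 : (ε * |f x t| - C) ^ 2 / ε = ε * |f x t| ^ 2 - 2 * C * |f x t| + C ^ 2 / ε := by field_simp; ring
        rw [h6, sq_abs, ← hq] at h5; linarith
      have h3 := mul_le_mul_of_nonneg_right h2 (by linarith : 0 ≤ 1 + q)
      have h4 : b * q ≤ κ / 2 * q ^ 2 + b ^ 2 / (2 * κ) := by
        have h5 : 0 ≤ (κ * q - b) ^ 2 / (2 * κ) := by positivity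
        have h6 : (κ * q - b) ^ 2 / (2 * κ) = κ / 2 * q ^ 2 - b * q + b ^ 2 / (2 * κ) := by field_simp; ring
        rw [h6] at h5; linarith
      rw [← hε] at hb ⊢
      have h7 : (ε * q + C ^ 2 / ε) * (1 + q) = κ / 2 * q ^ 2 + b * q + C ^ 2 / ε := by rw [hb, ← hε]; ring
      linarith
    · have h1 := grad_F hh.ne' hC.le hC.le ha0 (fun y => a y t) (fun y => g y t) (fun y => G y t) x (fun e => (c1 e).1) (fun e => (c1 e).2)
      rw [← hQ] at h1
      simp only [Fintype.sum_unique]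
      have hlap := lapD_sq_le hh.ne' (fun y => g y t) x
      obtain ⟨Z, hZ⟩ : ∃ Z, Z = ∑ e, (Dd h e (fun y => g y t) x) ^ 2 := ⟨_, rfl⟩
      obtain ⟨Y, hY⟩ : ∃ Y, Y = ∑ e', ∑ e, (Dd h e' (fun y => Dd h e (fun z => g z t) y) x) ^ 2 := ⟨_, rfl⟩
      have hY0 : 0 ≤ Y := by rw [hY]; exact Finset.sum_nonneg (fun _ _ => Finset.sum_nonneg (fun _ _ => sq_nonneg _))
      rw [← hZ, ← hY] at h1
      rw [← hZ] at c2
      rw [← hY] at hlap ⊢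
      have h2 : Q * Z ≤ Q * C := mul_le_mul_of_nonneg_left c2 hQ0.le
      have h3 := mul_le_mul_of_nonneg_right b1 hY0
      have h4 : f x t ^ 2 ≤ D * Y + 2 * C ^ 2 := by
        rw [c5]
        obtain ⟨l, hl⟩ : ∃ l, l = lapD h (fun y => g y t) x := ⟨_, rfl⟩
        rw [← hl] at hlap ⊢
        have ha2 : a x t ^ 2 ≤ a1 ^ 2 := pow_le_pow_left₀ (by linarith) b2 2
        have q1 : a x t ^ 2 * l ^ 2 ≤ a1 ^ 2 * (n * Y) := mul_le_mul ha2 hlap (by positivity) (by positivity)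
        have q2 : G x t ^ 2 ≤ C ^ 2 := by
          rw [← sq_abs]; exact pow_le_pow_left₀ (abs_nonneg _) b4 2
        have h5 : (a x t * l + G x t) ^ 2 ≤ 2 * ((a x t * l) ^ 2 + G x t ^ 2) := add_sq_le
        rw [hD]
        have h8 : (a x t * l) ^ 2 = a x t ^ 2 * l ^ 2 := by ring
        linarith
      have h5 := mul_le_mul_of_nonneg_left h4 hc0.le
      have h6 : c * (D * Y + 2 * C ^ 2) = a0 / 2 * Y + c * (2 * C ^ 2) := by rw [← hcD]; ring
      linarith

end Steps2

open Real Set MeasureTheory Metric Filter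

section Chain
variable {n : ℕ}

/-- bounded pair with small difference -/
def LB (K N a b : ℝ) : Prop := |a| ≤ K ∧ |b| ≤ K ∧ |b - a| ≤ K * N

lemma LB.mono {K L N N' a b : ℝ} (h : LB K N a b) (hKL : K ≤ L) (hN : 0 ≤ N) (hNN : N ≤ N') (hL : 0 ≤ L) : LB L N' a b :=
  ⟨h.1.trans hKL, h.2.1.trans hKL, h.2.2.trans ((mul_le_mul_of_nonneg_right hKL hN).trans (mul_le_mul_of_nonneg_left hNN hL))⟩

lemma LB.mul {K L N a b c d : ℝ} (h1 : LB K N a b) (h2 : LB L N c d) (hN : 0 ≤ N) : LB (2 * (K * L)) N (a * c) (b * d) := by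
  obtain ⟨a1, a2, a3⟩ := h1
  obtain ⟨b1, b2, b3⟩ := h2
  have hK : 0 ≤ K := (abs_nonneg _).trans a1
  have hL : 0 ≤ L := (abs_nonneg _).trans b1
  have hKL : 0 ≤ K * L := mul_nonneg hK hL
  refine ⟨?_, ?_, ?_⟩
  · rw [abs_mul]; have := mul_le_mul a1 b1 (abs_nonneg _) hK; linarith
  · rw [abs_mul]; have := mul_le_mul a2 b2 (abs_nonneg _) hK; linarith
  · have e : b * d - a * c = b * (d - c) + (b - a) * c := by ring
    rw [e]
    refine (abs_add_le _ _).trans ?_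
    rw [abs_mul, abs_mul]
    have h3 := mul_le_mul a2 b3 (abs_nonneg _) hK
    have h4 := mul_le_mul a3 b1 (abs_nonneg _) (mul_nonneg hK hN)
    nlinarith

lemma LB.add {K L N a b c d : ℝ} (h1 : LB K N a b) (h2 : LB L N c d) : LB (K + L) N (a + c) (b + d) := by
  obtain ⟨a1, a2, a3⟩ := h1
  obtain ⟨b1, b2, b3⟩ := h2
  refine ⟨(abs_add_le _ _).trans (by linarith), (abs_add_le _ _).trans (by linarith), ?_⟩
  have e : b + d - (a + c) = (b - a) + (d - c) := by ring
  rw [e]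
  refine (abs_add_le _ _).trans ?_
  linarith

lemma LB.const {N : ℝ} (c : ℝ) (hN : 0 ≤ N) : LB |c| N c c :=
  ⟨le_rfl, le_rfl, by simp; positivity⟩

lemma LB.inv {m K N a b : ℝ} (hm : 0 < m) (ha : m ≤ a) (hb : m ≤ b) (hK : 0 ≤ K) (hN : 0 ≤ N) (h : |b - a| ≤ K * N) :
    LB (1 / m + K / m ^ 2) N a⁻¹ b⁻¹ := by
  have ha0 : 0 < a := hm.trans_le ha
  have hb0 : 0 < b := hm.trans_le hb
  have h1 : ∀ c, m ≤ c → |c⁻¹| ≤ 1 / m + K / m ^ 2 := by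
    intro c hc
    rw [abs_of_pos (inv_pos.mpr (hm.trans_le hc)), ← one_div]
    have := one_div_le_one_div_of_le hm hc
    have : 0 ≤ K / m ^ 2 := by positivity
    linarith
  refine ⟨h1 a ha, h1 b hb, ?_⟩
  have e : b⁻¹ - a⁻¹ = -(b - a) / (a * b) := by field_simp; ring
  rw [e, abs_div, abs_neg, abs_of_pos (mul_pos ha0 hb0)]
  have h2 : m ^ 2 ≤ a * b := by rw [pow_two]; exact mul_le_mul ha hb hm.le ha0.le
  have h3 : |b - a| / (a * b) ≤ K * N / m ^ 2 := div_le_div₀ (by positivity) h (by positivity) h2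
  refine h3.trans ?_
  have : 0 ≤ 1 / m * N := by positivity
  have e2 : K * N / m ^ 2 = K / m ^ 2 * N := by ring
  rw [e2]; linarith

noncomputable def wf (h p : ℝ) (u : Lt n → ℝ → ℝ) (x : Lt n) (t : ℝ) : ℝ := u x t ^ p * lapD h (fun y => u y t) x
noncomputable def Gf (h p : ℝ) (u : Lt n → ℝ → ℝ) (x : Lt n) (t : ℝ) : ℝ := p * (wf h p u x t * wf h p u x t) * (u x t)⁻¹
noncomputable def zf (h p : ℝ) (u : Lt n → ℝ → ℝ) (x : Lt n) (t : ℝ) : ℝ := u x t ^ p * lapD h (fun y => wf h p u y t) x + Gf h p u x t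
noncomputable def Ff (h p : ℝ) (u : Lt n → ℝ → ℝ) (x : Lt n) (t : ℝ) : ℝ :=
  (3 * p) * (wf h p u x t * (u x t)⁻¹) * zf h p u x t + (-(p ^ 2 + p)) * ((wf h p u x t * (u x t)⁻¹) * (wf h p u x t * (u x t)⁻¹)) * wf h p u x t

structure Reg (h p m M η Mb : ℝ) (u : Lt n → ℝ → ℝ) (x0 : Lt n) (r t0 t1 : ℝ) : Prop where
  du : ∀ x, dsq h x x0 ≤ r ^ 2 → ∀ t ∈ Icc t0 t1, HasDerivAt (u x) (wf h p u x t) t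
  dw : ∀ x, dsq h x x0 ≤ r ^ 2 → ∀ t ∈ Icc t0 t1, HasDerivAt (wf h p u x) (zf h p u x t) t
  dz : ∀ x, dsq h x x0 ≤ r ^ 2 → ∀ t ∈ Icc t0 t1, HasDerivAt (zf h p u x) (u x t ^ p * lapD h (fun y => zf h p u y t) x + Ff h p u x t) t
  lo : ∀ x, dsq h x x0 ≤ r ^ 2 → ∀ t ∈ Icc t0 t1, m ≤ u x t
  hi : ∀ x, dsq h x x0 ≤ r ^ 2 → ∀ t ∈ Icc t0 t1, u x t ≤ M
  os : ∀ x, dsq h x x0 ≤ r ^ 2 → ∀ t ∈ Icc t0 t1, Mb - η ≤ u x t ∧ u x t ≤ Mb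

lemma wf_deriv {h p : ℝ} (hp : 1 ≤ p) (u : Lt n → ℝ → ℝ) (x : Lt n) (t : ℝ) (hu : ∀ y, HasDerivAt (u y) (wf h p u y t) t)
    (hx : 0 < u x t) : HasDerivAt (wf h p u x) (zf h p u x t) t := by
  have h1 := (hu x).rpow_const (p := p) (Or.inl hx.ne')
  have h2 := lapD_hasDerivAt h u (fun y => wf h p u y t) x t hu
  have h3 := h1.mul h2
  have e : wf h p u x t * p * u x t ^ (p - 1) * lapD h (fun y => u y t) x + u x t ^ p * lapD h (fun y => wf h p u y t) x = zf h p u x t := by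
    unfold zf Gf
    have : u x t ^ (p - 1) = u x t ^ p * (u x t)⁻¹ := by rw [Real.rpow_sub hx, Real.rpow_one, div_eq_mul_inv]
    rw [this]
    have e2 : wf h p u x t = u x t ^ p * lapD h (fun y => u y t) x := rfl
    obtain ⟨w, hw⟩ : ∃ w, w = wf h p u x t := ⟨_, rfl⟩
    have e3 : w * p * (u x t ^ p * (u x t)⁻¹) * lapD h (fun y => u y t) x = p * (w * (u x t ^ p * lapD h (fun y => u y t) x)) * (u x t)⁻¹ := by ring
    rw [← hw, e3, ← e2, ← hw]; ring
  rw [e] at h3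
  exact h3

lemma zf_deriv {h p : ℝ} (hp : 1 ≤ p) (u : Lt n → ℝ → ℝ) (x : Lt n) (t : ℝ) (hu : HasDerivAt (u x) (wf h p u x t) t)
    (hw : ∀ e, HasDerivAt (wf h p u (x + st e)) (zf h p u (x + st e) t) t) (hw0 : HasDerivAt (wf h p u x) (zf h p u x t) t)
    (hx : 0 < u x t) :
    HasDerivAt (zf h p u x) (u x t ^ p * lapD h (fun y => zf h p u y t) x + Ff h p u x t) t := by
  have h1 := hu.rpow_const (p := p) (Or.inl hx.ne')
  have h2 : HasDerivAt (fun t => lapD h (fun y => wf h p u y t) x) (lapD h (fun y => zf h p u y t) x) t := by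
    unfold lapD
    exact HasDerivAt.fun_sum (fun e _ => ((hw e).sub hw0).div_const _)
  have h3 := h1.mul h2
  have h4 := ((hw0.mul hw0).const_mul p).mul (hu.inv hx.ne')
  have h5 := h3.add h4
  have e : wf h p u x t * p * u x t ^ (p - 1) * lapD h (fun y => wf h p u y t) x + u x t ^ p * lapD h (fun y => zf h p u y t) x
      + (p * (zf h p u x t * wf h p u x t + wf h p u x t * zf h p u x t) * (u x t)⁻¹ + p * (wf h p u x t * wf h p u x t) * (-wf h p u x t / u x t ^ 2))
      = u x t ^ p * lapD h (fun y => zf h p u y t) x + Ff h p u x t := by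
    have e1 : u x t ^ (p - 1) = u x t ^ p * (u x t)⁻¹ := by rw [Real.rpow_sub hx, Real.rpow_one, div_eq_mul_inv]
    have e2 : u x t ^ p * lapD h (fun y => wf h p u y t) x = zf h p u x t - Gf h p u x t := by unfold zf; ring
    have e3 : wf h p u x t * p * u x t ^ (p - 1) * lapD h (fun y => wf h p u y t) x = wf h p u x t * p * (u x t)⁻¹ * (zf h p u x t - Gf h p u x t) := by
      rw [← e2, e1]; ring
    rw [e3]
    unfold Ff Gf
    field_simp
    ring
  have h6 := h5
  simp only [Pi.mul_apply, Pi.inv_apply] at h6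
  rw [e] at h6
  exact h6
end Chain

open Real Set MeasureTheory Metric Filter

section Chain2
variable {n : ℕ}

lemma Dd_le_iff {h : ℝ} (hh : 0 < h) (e : Dr n) (f : Lt n → ℝ) (x : Lt n) (C : ℝ) :
    |Dd h e f x| ≤ C ↔ |f (x + st e) - f x| ≤ C * h := by
  unfold Dd; rw [abs_div, abs_of_pos hh, div_le_iff₀ hh]

lemma G_LB (p m C : ℝ) (hm : 0 < m) (hC : 0 ≤ C) : ∃ K, 0 < K ∧ ∀ u u' w w' N : ℝ, 0 ≤ N → m ≤ u → m ≤ u' → |u' - u| ≤ C * N →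
    LB C N w w' → LB K N (p * (w * w) * u⁻¹) (p * (w' * w') * u'⁻¹) := by
  refine ⟨2 * (2 * (|p| * (2 * (C * C))) * (1 / m + C / m ^ 2)) + 1, by positivity, ?_⟩
  intro u u' w w' N hN h1 h2 h3 h4
  exact ((((LB.const p hN).mul (h4.mul h4 hN) hN).mul (LB.inv hm h1 h2 hC hN h3) hN)).mono (by linarith) hN le_rfl (by positivity)

lemma F_LB (p m C : ℝ) (hm : 0 < m) (hC : 0 ≤ C) : ∃ K, 0 < K ∧ ∀ u u' w w' z z' N : ℝ, 0 ≤ N → m ≤ u → m ≤ u' → |u' - u| ≤ C * N →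
    LB C N w w' → LB C N z z' → LB K N ((3 * p) * (w * u⁻¹) * z + (-(p ^ 2 + p)) * ((w * u⁻¹) * (w * u⁻¹)) * w)
      ((3 * p) * (w' * u'⁻¹) * z' + (-(p ^ 2 + p)) * ((w' * u'⁻¹) * (w' * u'⁻¹)) * w') := by
  obtain ⟨q, hq⟩ : ∃ q, q = 2 * (C * (1 / m + C / m ^ 2)) := ⟨_, rfl⟩
  have hq0 : 0 ≤ q := by rw [hq]; positivity
  refine ⟨2 * (2 * (|3 * p| * q) * C) + 2 * (2 * (|(-(p ^ 2 + p))| * (2 * (q * q))) * C) + 1, by positivity, ?_⟩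
  intro u u' w w' z z' N hN h1 h2 h3 h4 h5
  have h6 := h4.mul (LB.inv hm h1 h2 hC hN h3) hN
  rw [← hq] at h6
  exact (((((LB.const (3 * p) hN).mul h6 hN).mul h5 hN).add
    (((LB.const (-(p ^ 2 + p)) hN).mul (h6.mul h6 hN) hN).mul h4 hN))).mono (by linarith) hN le_rfl (by positivity)

lemma D_from_LB {h K N : ℝ} (hh : 0 < h) (e : Dr n) (f : Lt n → ℝ) (x : Lt n) (hl : LB K (N * h) (f x) (f (x + st e))) :
    |Dd h e f x| ≤ K * N := by
  rw [Dd_le_iff hh]; linarith [hl.2.2]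

lemma a_lip {h p m M C : ℝ} (hh : 0 < h) (hp : 1 ≤ p) (hm : 0 < m) (hM : 0 < M) (e : Dr n) (u : Lt n → ℝ → ℝ) (x : Lt n) (t : ℝ)
    (h1 : m ≤ u x t) (h2 : m ≤ u (x + st e) t) (h3 : u x t ≤ M) (h4 : u (x + st e) t ≤ M)
    (hD : |Dd h e (fun y => u y t) x| ≤ C) : |Dd h e (fun y => u y t ^ p) x| ≤ p * M ^ (p - 1) * C := by
  rw [Dd_le_iff hh] at hD ⊢
  have h5 := rpow_lip_abs hp (hm.le.trans h1) (hm.le.trans h2) h4 h3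
  refine h5.trans ?_
  have : 0 ≤ p * M ^ (p - 1) := by have := Real.rpow_pos_of_pos hM (p - 1); positivity
  have := mul_le_mul_of_nonneg_left hD this
  linarith

lemma a_bds {p m M : ℝ} (hp : 1 ≤ p) (hm : 0 < m) {v : ℝ} (h1 : m ≤ v) (h2 : v ≤ M) : m ^ p ≤ v ^ p ∧ v ^ p ≤ M ^ p :=
  ⟨Real.rpow_le_rpow hm.le h1 (by linarith), Real.rpow_le_rpow (hm.le.trans h1) h2 (by linarith)⟩

lemma dlt {h r : ℝ} (hr : 0 < r) {x x0 : Lt n} (hx : dsq h x x0 < r ^ 2) : dsq h x x0 ≤ (2 * r) ^ 2 :=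
  hx.le.trans (by nlinarith)

/-- local regularity step 2: bound on `w` -/
lemma L2 (n : ℕ) {p m M C r τ : ℝ} (hp : 1 ≤ p) (hm : 0 < m) (hmM : m ≤ M) (hC : 0 < C) (hr : 0 < r) (hτ : 0 < τ) : ∃ C', 0 < C' ∧
    ∀ (h t0 η Mb : ℝ) (x0 : Lt n) (u : Lt n → ℝ → ℝ), 0 < h → h ≤ r → Reg h p m M η Mb u x0 (2 * r) t0 (t0 + τ) →
    (∀ x, dsq h x x0 ≤ (2 * r) ^ 2 → ∀ t ∈ Icc t0 (t0 + τ), ∀ e, |Dd h e (fun y => u y t) x| ≤ C) →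
    ∀ x, dsq h x x0 ≤ (r / 2) ^ 2 → ∀ t ∈ Icc (t0 + τ / 2) (t0 + τ), |wf h p u x t| ≤ C' := by
  have hM : 0 < M := hm.trans_le hmM
  have hL : 0 < p * M ^ (p - 1) := by have := Real.rpow_pos_of_pos hM (p - 1); positivity
  obtain ⟨B, hB⟩ : ∃ B, B = p * M ^ (p - 1) * C + 2 * n * C ^ 2 + p / m + 1 := ⟨_, rfl⟩
  have hB1 : p * M ^ (p - 1) * C ≤ B := by rw [hB]; have : 0 < p / m := by positivity
                                           have : 0 ≤ 2 * n * C ^ 2 := by positivity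
                                           linarith
  have hB2 : 2 * n * C ^ 2 ≤ B := by rw [hB]; have : 0 < p / m := by positivity
                                     have := mul_pos hL hC
                                     linarith
  have hB3 : p / m ≤ B := by rw [hB]; have : 0 ≤ 2 * n * C ^ 2 := by positivity
                             have := mul_pos hL hC
                             linarith
  have hB0 : 0 < B := (by positivity : 0 < p / m).trans_le hB3
  obtain ⟨C', hC', H⟩ := valStep n (a0 := m ^ p) (a1 := M ^ p) (C := B) (Real.rpow_pos_of_pos hm p) (Real.rpow_le_rpow hm.le hmM (by linarith)) hB0 hr hτ
  refine ⟨C' + 1, by linarith, ?_⟩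
  intro h t0 η Mb x0 u hh hhr hR hD x hx t ht
  have h1 := H h t0 x0 (fun x t => u x t ^ p) u (fun _ _ => 0) (wf h p u) (Gf h p u) hh hhr ?_ ?_ x hx t ht
  · exact abs_le_of_sq_le_sq (by nlinarith) (by linarith)
  · intro x hx t ht
    have := a_bds hp hm (hR.lo x hx t ht) (hR.hi x hx t ht)
    refine ⟨?_, this.1, this.2, by simpa using hB0.le⟩
    simpa [wf] using hR.du x hx t ht
  · intro x hx t ht
    have hx2 := dlt hr hx
    refine ⟨?_, ?_, hR.dw x hx2 t ht, ?_, by simp [wf]⟩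
    · intro e
      have hxe := nb hh hr hhr hx e
      refine ⟨(a_lip hh hp hm hM e u x t (hR.lo x hx2 t ht) (hR.lo _ hxe t ht) (hR.hi x hx2 t ht) (hR.hi _ hxe t ht) (hD x hx2 t ht e)).trans hB1, ?_⟩
      have : Dd h e (fun _ => (0:ℝ)) x = 0 := by simp [Dd]
      rw [this, abs_zero]; positivity
    · refine le_trans ?_ hB2
      have : ∀ e ∈ (Finset.univ : Finset (Dr n)), (Dd h e (fun y => u y t) x) ^ 2 ≤ C ^ 2 := by
        intro e _
        have := hD x hx2 t ht e
        rw [← sq_abs]; exact pow_le_pow_left₀ (abs_nonneg _) this 2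
      refine (Finset.sum_le_sum this).trans ?_
      rw [Finset.sum_const, card_Dr, nsmul_eq_mul]; push_cast; exact le_rfl
    · have hlo := hR.lo x hx2 t ht
      have hup : 0 < u x t := hm.trans_le hlo
      unfold Gf
      rw [abs_mul, abs_of_pos (inv_pos.mpr hup), abs_mul, abs_of_pos (by linarith : 0 < p), abs_mul_self]
      have h5 : (u x t)⁻¹ ≤ m⁻¹ := inv_anti₀ hm hlo
      have h6 : 0 ≤ p * (wf h p u x t * wf h p u x t) := by have := mul_self_nonneg (wf h p u x t); positivity
      have h7 := mul_le_mul_of_nonneg_left h5 h6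
      have h8 : p * (wf h p u x t * wf h p u x t) * m⁻¹ = p / m * wf h p u x t ^ 2 := by ring
      rw [h8] at h7
      have := mul_le_mul_of_nonneg_right hB3 (sq_nonneg (wf h p u x t))
      linarith

/-- step 3: gradient of `w` -/
lemma L3 (n : ℕ) {p m M C r τ : ℝ} (hp : 1 ≤ p) (hm : 0 < m) (hmM : m ≤ M) (hC : 0 < C) (hr : 0 < r) (hτ : 0 < τ) : ∃ C', 0 < C' ∧
    ∀ (h t0 η Mb : ℝ) (x0 : Lt n) (u : Lt n → ℝ → ℝ), 0 < h → h ≤ r → Reg h p m M η Mb u x0 (2 * r) t0 (t0 + τ) →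
    (∀ x, dsq h x x0 ≤ (2 * r) ^ 2 → ∀ t ∈ Icc t0 (t0 + τ), (∀ e, |Dd h e (fun y => u y t) x| ≤ C) ∧ |wf h p u x t| ≤ C) →
    ∀ x, dsq h x x0 ≤ (r / 2) ^ 2 → ∀ t ∈ Icc (t0 + τ / 2) (t0 + τ), ∀ e, |Dd h e (fun y => wf h p u y t) x| ≤ C' := by
  have hM : 0 < M := hm.trans_le hmM
  have hL : 0 < p * M ^ (p - 1) := by have := Real.rpow_pos_of_pos hM (p - 1); positivity
  obtain ⟨K, hK, HK⟩ := G_LB p m (C + 1) hm (by linarith)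
  have hLC := mul_pos hL hC
  obtain ⟨B, hB⟩ : ∃ B, B = p * M ^ (p - 1) * C + C + K := ⟨_, rfl⟩
  obtain ⟨C', hC', H⟩ := gradStep n (a0 := m ^ p) (a1 := M ^ p) (C := B) (Real.rpow_pos_of_pos hm p) (Real.rpow_le_rpow hm.le hmM (by linarith)) (by linarith) hr hτ
  refine ⟨C' + 1, by linarith, ?_⟩
  intro h t0 η Mb x0 u hh hhr hR hD x hx t ht e
  have h1 := H h t0 x0 (fun x t => u x t ^ p) (wf h p u) (Gf h p u) hh hhr ?_ ?_ x hx t ht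
  · have h2 := Finset.single_le_sum (f := fun e => (Dd h e (fun y => wf h p u y t) x) ^ 2) (fun e _ => sq_nonneg _) (Finset.mem_univ e)
    have h3 := h2.trans h1
    beta_reduce at h3
    exact abs_le_of_sq_le_sq (by nlinarith) (by linarith)
  · intro x hx t ht
    have := a_bds hp hm (hR.lo x hx t ht) (hR.hi x hx t ht)
    have hw := (hD x hx t ht).2
    have hGx := HK (u x t) (u x t) (wf h p u x t) (wf h p u x t) 0 le_rfl (hR.lo x hx t ht) (hR.lo x hx t ht) (by simp)
      ⟨by linarith, by linarith, by simp⟩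
    refine ⟨hR.dw x hx t ht, this.1, this.2, by linarith, ?_⟩
    have := hGx.1
    unfold Gf; linarith
  · intro x hx t ht e
    have hx2 := dlt hr hx
    have hxe := nb hh hr hhr hx e
    have hDu := (hD x hx2 t ht).1 e
    refine ⟨(a_lip hh hp hm hM e u x t (hR.lo x hx2 t ht) (hR.lo _ hxe t ht) (hR.hi x hx2 t ht) (hR.hi _ hxe t ht) hDu).trans (by linarith), ?_⟩
    obtain ⟨d, hd⟩ : ∃ d, d = |Dd h e (fun y => wf h p u y t) x| := ⟨_, rfl⟩
    have hd0 : 0 ≤ d := by rw [hd]; positivity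
    have hN : 0 ≤ (d + 1) * h := by positivity
    have hw1 := (hD x hx2 t ht).2
    have hw2 := (hD _ hxe t ht).2
    have hdw : |wf h p u (x + st e) t - wf h p u x t| ≤ d * h := (Dd_le_iff hh e (fun y => wf h p u y t) x d).1 hd.ge
    rw [Dd_le_iff hh] at hDu
    have hLB : LB (C + 1) ((d + 1) * h) (wf h p u x t) (wf h p u (x + st e) t) :=
      ⟨by linarith, by linarith, hdw.trans (by nlinarith [mul_nonneg hC.le hN])⟩
    have hG := HK _ _ _ _ _ hN (hR.lo x hx2 t ht) (hR.lo _ hxe t ht) (hDu.trans (by nlinarith [mul_nonneg (mul_nonneg hC.le hd0) hh.le])) hLB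
    have := D_from_LB hh e (fun y => Gf h p u y t) x (N := d + 1) (by unfold Gf; exact hG)
    rw [← hd]
    refine this.trans ?_
    exact mul_le_mul_of_nonneg_right (by linarith) (by linarith)

/-- step 4: bound on `z` -/
lemma L4 (n : ℕ) {p m M C r τ : ℝ} (hp : 1 ≤ p) (hm : 0 < m) (hmM : m ≤ M) (hC : 0 < C) (hr : 0 < r) (hτ : 0 < τ) : ∃ C', 0 < C' ∧
    ∀ (h t0 η Mb : ℝ) (x0 : Lt n) (u : Lt n → ℝ → ℝ), 0 < h → h ≤ r → Reg h p m M η Mb u x0 (2 * r) t0 (t0 + τ) →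
    (∀ x, dsq h x x0 ≤ (2 * r) ^ 2 → ∀ t ∈ Icc t0 (t0 + τ), (∀ e, |Dd h e (fun y => u y t) x| ≤ C) ∧ |wf h p u x t| ≤ C ∧
      (∀ e, |Dd h e (fun y => wf h p u y t) x| ≤ C)) →
    ∀ x, dsq h x x0 ≤ (r / 2) ^ 2 → ∀ t ∈ Icc (t0 + τ / 2) (t0 + τ), |zf h p u x t| ≤ C' := by
  have hM : 0 < M := hm.trans_le hmM
  have hL : 0 < p * M ^ (p - 1) := by have := Real.rpow_pos_of_pos hM (p - 1); positivity
  obtain ⟨K, hK, HK⟩ := G_LB p m (C + 1) hm (by linarith)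
  have hLC := mul_pos hL hC
  obtain ⟨Q, hQ⟩ : ∃ Q, Q = C / m := ⟨_, rfl⟩
  have hQ0 : 0 < Q := by rw [hQ]; positivity
  obtain ⟨B, hB⟩ : ∃ B, B = p * M ^ (p - 1) * C + 2 * n * C ^ 2 + C + K + (3 * p * Q + (p ^ 2 + p) * (Q * Q) * C) := ⟨_, rfl⟩
  have hb1 : 0 ≤ 2 * n * C ^ 2 := by positivity
  have hb2 : 0 ≤ 3 * p * Q := by positivity
  have hb3 : 0 ≤ (p ^ 2 + p) * (Q * Q) * C := by positivity
  obtain ⟨C', hC', H⟩ := valStep n (a0 := m ^ p) (a1 := M ^ p) (C := B) (Real.rpow_pos_of_pos hm p) (Real.rpow_le_rpow hm.le hmM (by linarith)) (by linarith) hr hτ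
  refine ⟨C' + 1, by linarith, ?_⟩
  intro h t0 η Mb x0 u hh hhr hR hD x hx t ht
  have h1 := H h t0 x0 (fun x t => u x t ^ p) (wf h p u) (Gf h p u) (zf h p u) (Ff h p u) hh hhr ?_ ?_ x hx t ht
  · exact abs_le_of_sq_le_sq (by nlinarith) (by linarith)
  · intro x hx t ht
    have := a_bds hp hm (hR.lo x hx t ht) (hR.hi x hx t ht)
    have hw := (hD x hx t ht).2.1
    have hGx := HK (u x t) (u x t) (wf h p u x t) (wf h p u x t) 0 le_rfl (hR.lo x hx t ht) (hR.lo x hx t ht) (by simp)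
      ⟨by linarith, by linarith, by simp⟩
    refine ⟨hR.dw x hx t ht, this.1, this.2, ?_⟩
    have := hGx.1
    unfold Gf; linarith
  · intro x hx t ht
    have hx2 := dlt hr hx
    refine ⟨?_, ?_, hR.dz x hx2 t ht, ?_, rfl⟩
    · intro e
      have hxe := nb hh hr hhr hx e
      have hDu := (hD x hx2 t ht).1 e
      refine ⟨(a_lip hh hp hm hM e u x t (hR.lo x hx2 t ht) (hR.lo _ hxe t ht) (hR.hi x hx2 t ht) (hR.hi _ hxe t ht) hDu).trans (by linarith), ?_⟩
      obtain ⟨d, hd⟩ : ∃ d, d = |Dd h e (fun y => wf h p u y t) x| := ⟨_, rfl⟩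
      have hd0 : 0 ≤ d := by rw [hd]; positivity
      have hN : 0 ≤ (d + 1) * h := by positivity
      have hw1 := (hD x hx2 t ht).2.1
      have hw2 := (hD _ hxe t ht).2.1
      have hdw : |wf h p u (x + st e) t - wf h p u x t| ≤ d * h := (Dd_le_iff hh e (fun y => wf h p u y t) x d).1 hd.ge
      rw [Dd_le_iff hh] at hDu
      have hLB : LB (C + 1) ((d + 1) * h) (wf h p u x t) (wf h p u (x + st e) t) :=
        ⟨by linarith, by linarith, hdw.trans (by nlinarith [mul_nonneg hC.le hN])⟩
      have hG := HK _ _ _ _ _ hN (hR.lo x hx2 t ht) (hR.lo _ hxe t ht) (hDu.trans (by nlinarith [mul_nonneg (mul_nonneg hC.le hd0) hh.le])) hLB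
      have := D_from_LB hh e (fun y => Gf h p u y t) x (N := d + 1) (by unfold Gf; exact hG)
      rw [← hd]
      refine this.trans ?_
      exact mul_le_mul_of_nonneg_right (by linarith) (by linarith)
    · refine le_trans ?_ (by linarith : 2 * n * C ^ 2 ≤ B)
      have : ∀ e ∈ (Finset.univ : Finset (Dr n)), (Dd h e (fun y => wf h p u y t) x) ^ 2 ≤ C ^ 2 := by
        intro e _
        have := (hD x hx2 t ht).2.2 e
        rw [← sq_abs]; exact pow_le_pow_left₀ (abs_nonneg _) this 2
      refine (Finset.sum_le_sum this).trans ?_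
      rw [Finset.sum_const, card_Dr, nsmul_eq_mul]; push_cast; exact le_rfl
    · have hlo := hR.lo x hx2 t ht
      have hup : 0 < u x t := hm.trans_le hlo
      have hw := (hD x hx2 t ht).2.1
      have hq : |wf h p u x t * (u x t)⁻¹| ≤ Q := by
        rw [abs_mul, abs_of_pos (inv_pos.mpr hup), hQ, div_eq_mul_inv]
        exact mul_le_mul hw (inv_anti₀ hm hlo) (by positivity) hC.le
      obtain ⟨q, hqe⟩ : ∃ q, q = wf h p u x t * (u x t)⁻¹ := ⟨_, rfl⟩
      obtain ⟨w, hwe⟩ : ∃ q, q = wf h p u x t := ⟨_, rfl⟩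
      obtain ⟨z, hze⟩ : ∃ q, q = zf h p u x t := ⟨_, rfl⟩
      unfold Ff
      rw [← hqe] at hq ⊢
      rw [← hwe] at hw ⊢
      rw [← hze]
      have a1 : |3 * p * q * z| ≤ 3 * p * Q * (1 + z ^ 2) := by
        rw [abs_mul, abs_mul, abs_of_pos (by linarith : 0 < 3 * p)]
        have hz : |z| ≤ 1 + z ^ 2 := by rw [← sq_abs]; nlinarith [sq_nonneg (|z| - 1), abs_nonneg z]
        exact mul_le_mul (mul_le_mul_of_nonneg_left hq (by linarith)) hz (abs_nonneg _) hb2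
      have a2 : |-(p ^ 2 + p) * (q * q) * w| ≤ (p ^ 2 + p) * (Q * Q) * C := by
        rw [abs_mul, abs_mul, abs_neg, abs_of_pos (by positivity : 0 < p ^ 2 + p), abs_mul]
        exact mul_le_mul (mul_le_mul_of_nonneg_left (mul_le_mul hq hq (abs_nonneg _) hQ0.le) (by positivity)) hw (abs_nonneg _) (by positivity)
      refine (abs_add_le _ _).trans ?_
      have a3 : 0 ≤ (p ^ 2 + p) * (Q * Q) * C * z ^ 2 := mul_nonneg hb3 (sq_nonneg z)
      have a4 : (3 * p * Q + (p ^ 2 + p) * (Q * Q) * C) * (1 + z ^ 2) ≤ B * (1 + z ^ 2) :=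
        mul_le_mul_of_nonneg_right (by linarith) (by positivity)
      linarith

/-- step 5: gradient of `z` -/
lemma L5 (n : ℕ) {p m M C r τ : ℝ} (hp : 1 ≤ p) (hm : 0 < m) (hmM : m ≤ M) (hC : 0 < C) (hr : 0 < r) (hτ : 0 < τ) : ∃ C', 0 < C' ∧
    ∀ (h t0 η Mb : ℝ) (x0 : Lt n) (u : Lt n → ℝ → ℝ), 0 < h → h ≤ r → Reg h p m M η Mb u x0 (2 * r) t0 (t0 + τ) →
    (∀ x, dsq h x x0 ≤ (2 * r) ^ 2 → ∀ t ∈ Icc t0 (t0 + τ), (∀ e, |Dd h e (fun y => u y t) x| ≤ C) ∧ |wf h p u x t| ≤ C ∧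
      (∀ e, |Dd h e (fun y => wf h p u y t) x| ≤ C) ∧ |zf h p u x t| ≤ C) →
    ∀ x, dsq h x x0 ≤ (r / 2) ^ 2 → ∀ t ∈ Icc (t0 + τ / 2) (t0 + τ), ∀ e, |Dd h e (fun y => zf h p u y t) x| ≤ C' := by
  have hM : 0 < M := hm.trans_le hmM
  have hL : 0 < p * M ^ (p - 1) := by have := Real.rpow_pos_of_pos hM (p - 1); positivity
  obtain ⟨K, hK, HK⟩ := F_LB p m (C + 1) hm (by linarith)
  have hLC := mul_pos hL hC
  obtain ⟨B, hB⟩ : ∃ B, B = p * M ^ (p - 1) * C + C + K := ⟨_, rfl⟩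
  obtain ⟨C', hC', H⟩ := gradStep n (a0 := m ^ p) (a1 := M ^ p) (C := B) (Real.rpow_pos_of_pos hm p) (Real.rpow_le_rpow hm.le hmM (by linarith)) (by linarith) hr hτ
  refine ⟨C' + 1, by linarith, ?_⟩
  intro h t0 η Mb x0 u hh hhr hR hD x hx t ht e
  have h1 := H h t0 x0 (fun x t => u x t ^ p) (zf h p u) (Ff h p u) hh hhr ?_ ?_ x hx t ht
  · have h2 := Finset.single_le_sum (f := fun e => (Dd h e (fun y => zf h p u y t) x) ^ 2) (fun e _ => sq_nonneg _) (Finset.mem_univ e)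
    have h3 := h2.trans h1
    beta_reduce at h3
    exact abs_le_of_sq_le_sq (by nlinarith) (by linarith)
  · intro x hx t ht
    have := a_bds hp hm (hR.lo x hx t ht) (hR.hi x hx t ht)
    obtain ⟨-, hw, -, hz⟩ := hD x hx t ht
    have hGx := HK (u x t) (u x t) (wf h p u x t) (wf h p u x t) (zf h p u x t) (zf h p u x t) 0 le_rfl (hR.lo x hx t ht) (hR.lo x hx t ht) (by simp)
      ⟨by linarith, by linarith, by simp⟩ ⟨by linarith, by linarith, by simp⟩
    refine ⟨hR.dz x hx t ht, this.1, this.2, by linarith, ?_⟩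
    have := hGx.1
    unfold Ff; linarith
  · intro x hx t ht e
    have hx2 := dlt hr hx
    have hxe := nb hh hr hhr hx e
    obtain ⟨hDu, hw1, hDw, hz1⟩ := hD x hx2 t ht
    obtain ⟨-, hw2, -, hz2⟩ := hD _ hxe t ht
    have hDu := hDu e
    have hDw := hDw e
    refine ⟨(a_lip hh hp hm hM e u x t (hR.lo x hx2 t ht) (hR.lo _ hxe t ht) (hR.hi x hx2 t ht) (hR.hi _ hxe t ht) hDu).trans (by linarith), ?_⟩
    obtain ⟨d, hd⟩ : ∃ d, d = |Dd h e (fun y => zf h p u y t) x| := ⟨_, rfl⟩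
    have hd0 : 0 ≤ d := by rw [hd]; positivity
    have hN : 0 ≤ (d + 1) * h := by positivity
    have hdz : |zf h p u (x + st e) t - zf h p u x t| ≤ d * h := (Dd_le_iff hh e (fun y => zf h p u y t) x d).1 hd.ge
    rw [Dd_le_iff hh] at hDu hDw
    have hCd := mul_nonneg (mul_nonneg hC.le hd0) hh.le
    have hLBw : LB (C + 1) ((d + 1) * h) (wf h p u x t) (wf h p u (x + st e) t) :=
      ⟨by linarith, by linarith, hDw.trans (by nlinarith)⟩
    have hLBz : LB (C + 1) ((d + 1) * h) (zf h p u x t) (zf h p u (x + st e) t) :=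
      ⟨by linarith, by linarith, hdz.trans (by nlinarith [mul_nonneg hC.le hN])⟩
    have hG := HK _ _ _ _ _ _ _ hN (hR.lo x hx2 t ht) (hR.lo _ hxe t ht) (hDu.trans (by nlinarith)) hLBw hLBz
    have := D_from_LB hh e (fun y => Ff h p u y t) x (N := d + 1) (by unfold Ff; exact hG)
    rw [← hd]
    refine this.trans ?_
    exact mul_le_mul_of_nonneg_right (by linarith) (by linarith)
end Chain2

open Real Set MeasureTheory Metric Filter

section Ell
variable {n : ℕ}

lemma rpow_neg_lip {q c x y : ℝ} (hq : 0 ≤ q) (hc : 0 < c) (hx : c ≤ x) (hy : c ≤ y) :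
    |y ^ (-q) - x ^ (-q)| ≤ q * c ^ (-q - 1) * |y - x| := by
  have h := Convex.norm_image_sub_le_of_norm_hasDerivWithin_le (f := fun x : ℝ => x ^ (-q)) (f' := fun x => (-q) * x ^ (-q - 1))
    (s := Ici c) (C := q * c ^ (-q - 1)) (x := x) (y := y)
    (fun x hx => (Real.hasDerivAt_rpow_const (Or.inl (hc.trans_le hx).ne')).hasDerivWithinAt) ?_ (convex_Ici c) hx hy
  · simpa [Real.norm_eq_abs] using h
  · intro x hx
    rw [Real.norm_eq_abs, abs_mul, abs_neg, abs_of_nonneg hq, abs_of_pos (Real.rpow_pos_of_pos (hc.trans_le hx) _)]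
    exact mul_le_mul_of_nonneg_left (Real.rpow_le_rpow_of_nonpos hc hx (by linarith)) hq

lemma rpow_neg_second {q c b s t : ℝ} (hq : 0 ≤ q) (hc : 0 < c) (h0 : c ≤ b) (h1 : c ≤ b + s) (h2 : c ≤ b + t) (h3 : c ≤ b + s + t) :
    |((b + s + t) ^ (-q) - (b + s) ^ (-q)) - ((b + t) ^ (-q) - b ^ (-q))| ≤ q * ((q + 1) * c ^ (-q - 2)) * |t| * |s| := by
  have hcv : Convex ℝ (Ici c ∩ Ici (c - t)) := (convex_Ici c).inter (convex_Ici _)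
  have h := Convex.norm_image_sub_le_of_norm_hasDerivWithin_le (f := fun x : ℝ => (x + t) ^ (-q) - x ^ (-q))
    (f' := fun x => 1 * (-q) * (x + t) ^ (-q - 1) - (-q) * x ^ (-q - 1))
    (s := Ici c ∩ Ici (c - t)) (C := q * ((q + 1) * c ^ (-q - 2)) * |t|) (x := b) (y := b + s) ?_ ?_ hcv
    ⟨h0, by simp only [mem_Ici]; linarith⟩ ⟨h1, by simp only [mem_Ici]; linarith⟩
  · simpa [Real.norm_eq_abs] using h
  · rintro x ⟨hx1, hx2⟩
    simp only [mem_Ici] at hx1 hx2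
    exact ((((hasDerivAt_id x).add_const t).rpow_const (p := -q) (Or.inl (by simp only [id]; linarith))).sub
      (Real.hasDerivAt_rpow_const (Or.inl (hc.trans_le hx1).ne'))).hasDerivWithinAt
  · rintro x ⟨hx1, hx2⟩
    simp only [mem_Ici] at hx1 hx2
    have h5 := rpow_neg_lip (q := q + 1) (x := x) (y := x + t) (by linarith) hc hx1 (by linarith)
    have e : 1 * (-q) * (x + t) ^ (-q - 1) - (-q) * x ^ (-q - 1) = (-q) * ((x + t) ^ (-(q + 1)) - x ^ (-(q + 1))) := by
      rw [show -(q + 1) = -q - 1 by ring]; ring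
    rw [e, Real.norm_eq_abs, abs_mul, abs_neg, abs_of_nonneg hq, mul_assoc q]
    refine mul_le_mul_of_nonneg_left ?_ hq
    have e2 : x + t - x = t := by ring
    rw [e2, show -(q + 1) - 1 = -q - 2 by ring] at h5
    exact h5

/-- quadruple bounds -/
def QB (K h a b c d : ℝ) : Prop := (|a| ≤ K ∧ |d| ≤ K) ∧ (|b - a| ≤ K * h ∧ |c - a| ≤ K * h ∧ |d - b| ≤ K * h ∧ |d - c| ≤ K * h) ∧
  |d - b - c + a| ≤ K * h ^ 2

lemma QB.mul {K L h a b c d a' b' c' d' : ℝ} (hh : 0 ≤ h) (h1 : QB K h a b c d) (h2 : QB L h a' b' c' d') :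
    |d * d' - b * b' - c * c' + a * a'| ≤ 4 * (K * L) * h ^ 2 := by
  obtain ⟨⟨a1, a2⟩, ⟨b1, b2, b3, b4⟩, c1⟩ := h1
  obtain ⟨⟨a1', a2'⟩, ⟨b1', b2', b3', b4'⟩, c1'⟩ := h2
  have hK : 0 ≤ K := (abs_nonneg _).trans a1
  have hL : 0 ≤ L := (abs_nonneg _).trans a1'
  have e : d * d' - b * b' - c * c' + a * a' = (d - b - c + a) * d' + (b - a) * (d' - b') + (c - a) * (d' - c') + a * (d' - b' - c' + a') := by ring
  rw [e]
  have m1 : |(d - b - c + a) * d'| ≤ K * h ^ 2 * L := by rw [abs_mul]; exact mul_le_mul c1 a2' (abs_nonneg _) (by positivity)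
  have m2 : |(b - a) * (d' - b')| ≤ K * h * (L * h) := by rw [abs_mul]; exact mul_le_mul b1 b3' (abs_nonneg _) (by positivity)
  have m3 : |(c - a) * (d' - c')| ≤ K * h * (L * h) := by rw [abs_mul]; exact mul_le_mul b2 b4' (abs_nonneg _) (by positivity)
  have m4 : |a * (d' - b' - c' + a')| ≤ K * (L * h ^ 2) := by rw [abs_mul]; exact mul_le_mul a1 c1' (abs_nonneg _) (by positivity)
  have := (abs_add_le ((d - b - c + a) * d' + (b - a) * (d' - b') + (c - a) * (d' - c')) (a * (d' - b' - c' + a')))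
  have := (abs_add_le ((d - b - c + a) * d' + (b - a) * (d' - b')) ((c - a) * (d' - c')))
  have := (abs_add_le ((d - b - c + a) * d') ((b - a) * (d' - b')))
  have e1 : 4 * (K * L) * h ^ 2 = K * h ^ 2 * L + K * h * (L * h) + K * h * (L * h) + K * (L * h ^ 2) := by ring
  linarith

lemma QB.rpow {p m K : ℝ} (hp : 1 ≤ p) (hm : 0 < m) (hK : 0 ≤ K) : ∃ L, 0 < L ∧ ∀ h a b c d : ℝ, 0 ≤ h → K * h ≤ m / 2 →
    m ≤ a → m ≤ b → m ≤ c → m ≤ d → QB K h a b c d → QB L h (a ^ (-p)) (b ^ (-p)) (c ^ (-p)) (d ^ (-p)) := by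
  obtain ⟨k, hk⟩ : ∃ k, k = m / 2 := ⟨_, rfl⟩
  have hk0 : 0 < k := by rw [hk]; positivity
  obtain ⟨A, hA⟩ : ∃ A, A = p * k ^ (-p - 1) := ⟨_, rfl⟩
  obtain ⟨D, hD⟩ : ∃ D, D = p * ((p + 1) * k ^ (-p - 2)) := ⟨_, rfl⟩
  have hA0 : 0 ≤ A := by rw [hA]; have := Real.rpow_pos_of_pos hk0 (-p - 1); positivity
  have hD0 : 0 ≤ D := by rw [hD]; have := Real.rpow_pos_of_pos hk0 (-p - 2); positivity
  have hP := Real.rpow_pos_of_pos hm (-p)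
  have hAK : 0 ≤ A * K := by positivity
  have hDK : 0 ≤ D * K * K := by positivity
  refine ⟨m ^ (-p) + A * K + D * K * K, by positivity, ?_⟩
  intro h a b c d hh hKh ha hb hc hd ⟨_, ⟨b1, b2, b3, b4⟩, c1⟩
  rw [← hk] at hKh
  have lip : ∀ x y, k ≤ x → k ≤ y → |y ^ (-p) - x ^ (-p)| ≤ A * |y - x| := by
    intro x y hx hy; rw [hA]; exact rpow_neg_lip (by linarith) hk0 hx hy
  have bd : ∀ x, m ≤ x → |x ^ (-p)| ≤ m ^ (-p) + A * K + D * K * K := by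
    intro x hx
    rw [abs_of_pos (Real.rpow_pos_of_pos (hm.trans_le hx) _)]
    have := Real.rpow_le_rpow_of_nonpos hm hx (by linarith : -p ≤ 0)
    linarith
  have fd : ∀ x y, m ≤ x → m ≤ y → |y - x| ≤ K * h → |y ^ (-p) - x ^ (-p)| ≤ (m ^ (-p) + A * K + D * K * K) * h := by
    intro x y hx hy hxy
    refine (lip x y (by linarith) (by linarith)).trans ?_
    have := mul_le_mul_of_nonneg_left hxy hA0
    have := mul_nonneg hP.le hh
    have := mul_nonneg hDK hh
    linarith
  refine ⟨⟨bd a ha, bd d hd⟩, ⟨fd _ _ ha hb b1, fd _ _ ha hc b2, fd _ _ hb hd b3, fd _ _ hc hd b4⟩, ?_⟩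
  have hca := abs_le.1 b2
  have e1 : |d ^ (-p) - (b + (c - a)) ^ (-p)| ≤ A * (K * h ^ 2) := by
    refine (lip _ _ (by linarith) (by linarith)).trans (mul_le_mul_of_nonneg_left ?_ hA0)
    rw [show d - (b + (c - a)) = d - b - c + a by ring]; exact c1
  have e2 := rpow_neg_second (q := p) (c := k) (b := a) (s := b - a) (t := c - a) (by linarith) hk0 (by linarith) (by linarith) (by linarith) (by linarith)
  rw [← hD, show a + (b - a) + (c - a) = b + (c - a) by ring, show a + (b - a) = b by ring, show a + (c - a) = c by ring] at e2
  have e3 : D * |c - a| * |b - a| ≤ D * (K * h) * (K * h) :=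
    mul_le_mul (mul_le_mul_of_nonneg_left b2 hD0) b1 (abs_nonneg _) (by positivity)
  have e4 : d ^ (-p) - b ^ (-p) - c ^ (-p) + a ^ (-p) = (d ^ (-p) - (b + (c - a)) ^ (-p)) + ((b + (c - a)) ^ (-p) - b ^ (-p) - (c ^ (-p) - a ^ (-p))) := by ring
  rw [e4]
  refine (abs_add_le _ _).trans ?_
  have : 0 ≤ m ^ (-p) * h ^ 2 := by positivity
  linarith

lemma grad_bd {h ρ A B : ℝ} (hh : 0 < h) (hhρ : h ≤ ρ) (hA : 0 < A) (hB : 0 ≤ B) (V : Lt n → ℝ)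
    (c : Lt n) (e : Dr n) (hV : ∀ x, dsq h x c ≤ (4 * ρ) ^ 2 → |V x| ≤ A)
    (hlap : ∀ x, dsq h x c ≤ (4 * ρ) ^ 2 → |lapD h V x| ≤ B) :
    |Dd h e V c| ≤ B * ρ + (n + 2) * (2 * A) / ρ := by
  rw [Dd_le_iff hh, mul_comm]
  refine grad_est hh hhρ (by linarith) hB V c e ?_ hlap
  intro x y hx hy
  have h1 := abs_le.1 (hV x hx)
  have h2 := abs_le.1 (hV y hy)
  linarith

lemma lapD_congr {h : ℝ} (f g : Lt n → ℝ) (x : Lt n) (h0 : f x = g x) (h1 : ∀ e, f (x + st e) = g (x + st e)) : lapD h f x = lapD h g x := by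
  unfold lapD; refine Finset.sum_congr rfl (fun e _ => ?_); rw [h0, h1 e]

lemma lap_u {h p : ℝ} (u : Lt n → ℝ → ℝ) (x : Lt n) (t : ℝ) (hx : 0 < u x t) :
    lapD h (fun y => u y t) x = wf h p u x t * u x t ^ (-p) := by
  unfold wf; rw [Real.rpow_neg hx.le]; have := Real.rpow_pos_of_pos hx p; field_simp

lemma lap_w {h p : ℝ} (u : Lt n → ℝ → ℝ) (x : Lt n) (t : ℝ) (hx : 0 < u x t) :
    lapD h (fun y => wf h p u y t) x = (zf h p u x t + (-1) * Gf h p u x t) * u x t ^ (-p) := by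
  unfold zf; rw [Real.rpow_neg hx.le]; have := Real.rpow_pos_of_pos hx p; field_simp; ring

lemma LB.rpow {p m K N a b : ℝ} (hp : 1 ≤ p) (hm : 0 < m) (ha : m ≤ a) (hb : m ≤ b) (hK : 0 ≤ K) (hN : 0 ≤ N) (h : |b - a| ≤ K * N) :
    LB (m ^ (-p) + p * m ^ (-p - 1) * K) N (a ^ (-p)) (b ^ (-p)) := by
  have hP := Real.rpow_pos_of_pos hm (-p)
  have hQ := Real.rpow_pos_of_pos hm (-p - 1)
  have hA0 : 0 ≤ p * m ^ (-p - 1) := by positivity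
  have bd : ∀ x, m ≤ x → |x ^ (-p)| ≤ m ^ (-p) + p * m ^ (-p - 1) * K := by
    intro x hx
    rw [abs_of_pos (Real.rpow_pos_of_pos (hm.trans_le hx) _)]
    have := Real.rpow_le_rpow_of_nonpos hm hx (by linarith : -p ≤ 0)
    have := mul_nonneg hA0 hK
    linarith
  refine ⟨bd a ha, bd b hb, ?_⟩
  refine (rpow_neg_lip (by linarith) hm ha hb).trans ?_
  have := mul_le_mul_of_nonneg_left h hA0
  have := mul_nonneg hP.le hN
  linarith

/-- step 6: second differences of `u` and `w` -/
lemma L6 (n : ℕ) {p m C ρ : ℝ} (hp : 1 ≤ p) (hm : 0 < m) (hC : 0 < C) (hρ : 0 < ρ) : ∃ C', 0 < C' ∧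
    ∀ (h t : ℝ) (x0 : Lt n) (u : Lt n → ℝ → ℝ), 0 < h → h ≤ ρ →
    (∀ x, dsq h x x0 ≤ (8 * ρ) ^ 2 → m ≤ u x t ∧ (∀ e, |Dd h e (fun y => u y t) x| ≤ C) ∧ |wf h p u x t| ≤ C ∧
      (∀ e, |Dd h e (fun y => wf h p u y t) x| ≤ C) ∧ |zf h p u x t| ≤ C ∧ (∀ e, |Dd h e (fun y => zf h p u y t) x| ≤ C)) →
    ∀ x, dsq h x x0 ≤ (2 * ρ) ^ 2 → ∀ e f, |Dd h f (fun y => Dd h e (fun y => u y t) y) x| ≤ C' ∧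
      |Dd h f (fun y => Dd h e (fun y => wf h p u y t) y) x| ≤ C' := by
  obtain ⟨K, hK, HK⟩ := G_LB p m C hm hC.le
  obtain ⟨A, hA⟩ : ∃ A, A = m ^ (-p) + p * m ^ (-p - 1) * C := ⟨_, rfl⟩
  have hA0 : 0 < A := by rw [hA]; have := Real.rpow_pos_of_pos hm (-p); have := Real.rpow_pos_of_pos hm (-p - 1); positivity
  obtain ⟨B, hB⟩ : ∃ B, B = 2 * (C * A) + 2 * ((C + 2 * (|(-1:ℝ)| * K)) * A) := ⟨_, rfl⟩
  have hb1 : 0 ≤ 2 * (C * A) := by positivity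
  have hb2 : 0 ≤ 2 * ((C + 2 * (|(-1:ℝ)| * K)) * A) := by positivity
  refine ⟨B * ρ + (n + 2) * (2 * C) / ρ, ?_, ?_⟩
  · have : 0 ≤ B * ρ := mul_nonneg (by linarith) hρ.le
    have : 0 < (n + 2) * (2 * C) / ρ := by positivity
    linarith
  intro h t x0 u hh hhρ H x hx e f
  have hx1 : ∀ y, dsq h y x ≤ (4 * ρ) ^ 2 → dsq h y x0 ≤ (8 * ρ) ^ 2 := fun y hy =>
    (dsq_tri (by positivity) (by positivity) hy hx).trans (pow_le_pow_left₀ (by positivity) (by linarith) 2)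
  have hx2 : ∀ y, dsq h y x ≤ (4 * ρ) ^ 2 → dsq h (y + st e) x0 ≤ (8 * ρ) ^ 2 := fun y hy =>
    (dsq_step_le hh.le (by positivity) (dsq_tri (by positivity) (by positivity) hy hx) e).trans (pow_le_pow_left₀ (by positivity) (by linarith) 2)
  constructor
  · refine grad_bd hh hhρ hC (by linarith) _ x f (fun y hy => (H y (hx1 y hy)).2.1 e) ?_
    intro y hy
    obtain ⟨m1, d1, w1, dw1, z1, dz1⟩ := H y (hx1 y hy)
    obtain ⟨m2, d2, w2, dw2, z2, dz2⟩ := H _ (hx2 y hy)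
    rw [Dd_lapD_comm]
    have d1 := (Dd_le_iff hh _ _ _ _).1 (d1 e)
    have dw1 := (Dd_le_iff hh _ _ _ _).1 (dw1 e)
    have hl := LB.mul (N := h) ⟨w1, w2, dw1⟩ (LB.rpow hp hm m1 m2 hC.le hh.le d1) hh.le
    rw [← hA, ← lap_u (h := h) u y t (hm.trans_le m1), ← lap_u (h := h) u _ t (hm.trans_le m2)] at hl
    have := D_from_LB hh e (fun y => lapD h (fun y => u y t) y) y (N := 1) (by rw [one_mul]; exact hl)
    linarith
  · refine grad_bd hh hhρ hC (by linarith) _ x f (fun y hy => (H y (hx1 y hy)).2.2.2.1 e) ?_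
    intro y hy
    obtain ⟨m1, d1, w1, dw1, z1, dz1⟩ := H y (hx1 y hy)
    obtain ⟨m2, d2, w2, dw2, z2, dz2⟩ := H _ (hx2 y hy)
    rw [Dd_lapD_comm]
    have d1 := (Dd_le_iff hh _ _ _ _).1 (d1 e)
    have dw1 := (Dd_le_iff hh _ _ _ _).1 (dw1 e)
    have dz1 := (Dd_le_iff hh _ _ _ _).1 (dz1 e)
    have hG := HK _ _ _ _ h hh.le m1 m2 d1 ⟨w1, w2, dw1⟩
    have hl := LB.mul (N := h) (LB.add ⟨z1, z2, dz1⟩ ((LB.const (-1) hh.le).mul hG hh.le)) (LB.rpow hp hm m1 m2 hC.le hh.le d1) hh.le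
    have g1 := lap_w (h := h) (p := p) u y t (hm.trans_le m1)
    have g2 := lap_w (h := h) (p := p) u (y + st e) t (hm.trans_le m2)
    unfold Gf at g1 g2
    rw [← hA, ← g1, ← g2] at hl
    have := D_from_LB hh e (fun y => lapD h (fun y => wf h p u y t) y) y (N := 1) (by rw [one_mul]; exact hl)
    linarith

lemma DD_eq {h : ℝ} (hh : 0 < h) (e f : Dr n) (g : Lt n → ℝ) (x : Lt n) :
    Dd h f (fun y => Dd h e g y) x = (g (x + st f + st e) - g (x + st f) - g (x + st e) + g x) / h ^ 2 := by
  unfold Dd; field_simp; ring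

lemma QB_of {h C : ℝ} (hh : 0 < h) (hC : 0 ≤ C) (e f : Dr n) (g : Lt n → ℝ) (x : Lt n) (h1 : |g x| ≤ C) (h2 : |g (x + st f + st e)| ≤ C)
    (d1 : |Dd h f g x| ≤ C) (d2 : |Dd h e g x| ≤ C) (d3 : |Dd h e g (x + st f)| ≤ C) (d4 : |Dd h f g (x + st e)| ≤ C)
    (dd : |Dd h f (fun y => Dd h e g y) x| ≤ C) : QB C h (g x) (g (x + st f)) (g (x + st e)) (g (x + st f + st e)) := by
  rw [Dd_le_iff hh] at d1 d2 d3 d4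
  rw [DD_eq hh, abs_div, abs_of_pos (by positivity : 0 < h ^ 2), div_le_iff₀ (by positivity)] at dd
  rw [add_right_comm] at d4
  exact ⟨⟨h1, h2⟩, ⟨d1, d2, d3, d4⟩, dd⟩

/-- step 7: third differences of `u` -/
lemma L7 (n : ℕ) {p m M C ρ : ℝ} (hp : 1 ≤ p) (hm : 0 < m) (hMC : M ≤ C) (hC : 0 < C) (hρ : 0 < ρ) : ∃ C', 0 < C' ∧
    ∀ (h t : ℝ) (x0 : Lt n) (u : Lt n → ℝ → ℝ), 0 < h → h ≤ ρ → C * h ≤ m / 2 →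
    (∀ x, dsq h x x0 ≤ (8 * ρ) ^ 2 → m ≤ u x t ∧ u x t ≤ M ∧ (∀ e, |Dd h e (fun y => u y t) x| ≤ C) ∧ |wf h p u x t| ≤ C ∧
      (∀ e, |Dd h e (fun y => wf h p u y t) x| ≤ C) ∧ (∀ e f, |Dd h f (fun y => Dd h e (fun y => u y t) y) x| ≤ C ∧
      |Dd h f (fun y => Dd h e (fun y => wf h p u y t) y) x| ≤ C)) →
    ∀ e f g, |Dd h g (fun y => Dd h f (fun y => Dd h e (fun y => u y t) y) y) x0| ≤ C' := by
  obtain ⟨L, hL, HL⟩ := QB.rpow hp hm hC.le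
  refine ⟨4 * (C * L) * ρ + (n + 2) * (2 * C) / ρ, by positivity, ?_⟩
  intro h t x0 u hh hhρ hCh H e f g
  have hx1 : ∀ y, dsq h y x0 ≤ (4 * ρ) ^ 2 → dsq h y x0 ≤ (8 * ρ) ^ 2 := fun y hy =>
    hy.trans (pow_le_pow_left₀ (by positivity) (by linarith) 2)
  have hx2 : ∀ y, dsq h y x0 ≤ (4 * ρ) ^ 2 → ∀ e, dsq h (y + st e) x0 ≤ (5 * ρ) ^ 2 := fun y hy e =>
    (dsq_step_le hh.le (by positivity) hy e).trans (pow_le_pow_left₀ (by positivity) (by linarith) 2)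
  have hx3 : ∀ y, dsq h y x0 ≤ (5 * ρ) ^ 2 → dsq h y x0 ≤ (8 * ρ) ^ 2 := fun y hy =>
    hy.trans (pow_le_pow_left₀ (by positivity) (by linarith) 2)
  have hx4 : ∀ y, dsq h y x0 ≤ (5 * ρ) ^ 2 → ∀ e, dsq h (y + st e) x0 ≤ (8 * ρ) ^ 2 := fun y hy e =>
    (dsq_step_le hh.le (by positivity) hy e).trans (pow_le_pow_left₀ (by positivity) (by linarith) 2)
  refine grad_bd hh hhρ hC (by positivity) _ x0 g (fun y hy => ((H y (hx1 y hy)).2.2.2.2.2 e f).1) ?_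
  intro y hy
  obtain ⟨m1, M1, d1, w1, dw1, dd1⟩ := H y (hx1 y hy)
  obtain ⟨m2, M2, d2, w2, dw2, dd2⟩ := H _ (hx3 _ (hx2 y hy e))
  obtain ⟨m3, M3, d3, w3, dw3, dd3⟩ := H _ (hx3 _ (hx2 y hy f))
  obtain ⟨m4, M4, d4, w4, dw4, dd4⟩ := H _ (hx4 _ (hx2 y hy f) e)
  rw [Dd_lapD_comm, show (fun y => lapD h (fun y => Dd h e (fun y => u y t) y) y) = (fun y => Dd h e (fun y => lapD h (fun y => u y t) y) y) from
    funext (fun y => Dd_lapD_comm h e _ y)]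
  have hab : ∀ v, m ≤ v → v ≤ M → |v| ≤ C := fun v h1 h2 => abs_le.2 ⟨by linarith, by linarith⟩
  have q1 := QB_of hh hC.le e f (fun y => u y t) y (hab _ m1 M1) (hab _ m4 M4) (d1 f) (d1 e) (d3 e) (d2 f) (dd1 e f).1
  have q2 := QB_of hh hC.le e f (fun y => wf h p u y t) y w1 w4 (dw1 f) (dw1 e) (dw3 e) (dw2 f) (dd1 e f).2
  beta_reduce at q1 q2
  have q3 := HL h _ _ _ _ hh.le hCh m1 m3 m2 m4 q1
  have q4 := QB.mul hh.le q2 q3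
  rw [DD_eq hh, abs_div, abs_of_pos (by positivity : 0 < h ^ 2), div_le_iff₀ (by positivity)]
  rw [lap_u (h := h) (p := p) u y t (hm.trans_le m1), lap_u (h := h) (p := p) u _ t (hm.trans_le m2), lap_u (h := h) (p := p) u _ t (hm.trans_le m3),
    lap_u (h := h) (p := p) u _ t (hm.trans_le m4)]
  exact q4
end Ell

open Real Set MeasureTheory Metric Filter

section Comb
variable {n : ℕ}

lemma Reg.sub {h p m M η Mb : ℝ} {u : Lt n → ℝ → ℝ} {x0 : Lt n} {r t0 t1 r' t0' t1' : ℝ} (hR : Reg h p m M η Mb u x0 r t0 t1)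
    (h0 : 0 ≤ r') (h1 : r' ≤ r) (h2 : t0 ≤ t0') (h3 : t1' ≤ t1) : Reg h p m M η Mb u x0 r' t0' t1' := by
  have hx : ∀ x, dsq h x x0 ≤ r' ^ 2 → dsq h x x0 ≤ r ^ 2 := fun x hx => hx.trans (pow_le_pow_left₀ h0 h1 2)
  have ht : ∀ t, t ∈ Icc t0' t1' → t ∈ Icc t0 t1 := fun t ht => ⟨h2.trans ht.1, ht.2.trans h3⟩
  exact ⟨fun x a t b => hR.du x (hx x a) t (ht t b), fun x a t b => hR.dw x (hx x a) t (ht t b), fun x a t b => hR.dz x (hx x a) t (ht t b),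
    fun x a t b => hR.lo x (hx x a) t (ht t b), fun x a t b => hR.hi x (hx x a) t (ht t b), fun x a t b => hR.os x (hx x a) t (ht t b)⟩

lemma dsub {h a b : ℝ} {x x0 : Lt n} (hx : dsq h x x0 ≤ a ^ 2) (ha : 0 ≤ a) (hab : a ≤ b) : dsq h x x0 ≤ b ^ 2 :=
  hx.trans (pow_le_pow_left₀ ha hab 2)

lemma Reg_bounds (n : ℕ) {p m M : ℝ} (hp : 1 ≤ p) (hm : 0 < m) (hmM : m ≤ M) : ∃ η, 0 < η ∧ ∀ R : ℝ, 0 < R → ∃ C hb, 0 < C ∧ 0 < hb ∧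
    ∀ (h tc Mb : ℝ) (x0 : Lt n) (u : Lt n → ℝ → ℝ), 0 < h → h ≤ hb → Reg h p m M η Mb u x0 R (tc - R) tc →
    (∀ e, |Dd h e (fun y => u y tc) x0| ≤ C) ∧ |wf h p u x0 tc| ≤ C ∧ |zf h p u x0 tc| ≤ C ∧
    (∀ e f, |Dd h f (fun y => Dd h e (fun y => u y tc) y) x0| ≤ C) ∧
    (∀ e f g, |Dd h g (fun y => Dd h f (fun y => Dd h e (fun y => u y tc) y) y) x0| ≤ C) := by
  have hM : 0 < M := hm.trans_le hmM
  obtain ⟨η, hη, H1⟩ := gradU n hp hm hmM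
  refine ⟨η, hη, ?_⟩
  intro R hR
  obtain ⟨C1, hC1, H1⟩ := H1 (R / 2) R (by positivity) hR
  obtain ⟨B1, hB1⟩ : ∃ B, B = C1 + 1 := ⟨_, rfl⟩
  obtain ⟨C2, hC2, H2⟩ := L2 n (C := B1) (r := R / 8) (τ := R / 2) hp hm hmM (by linarith) (by positivity) (by positivity)
  obtain ⟨B2, hB2⟩ : ∃ B, B = B1 + C2 := ⟨_, rfl⟩
  obtain ⟨C3, hC3, H3⟩ := L3 n (C := B2) (r := R / 32) (τ := R / 4) hp hm hmM (by linarith) (by positivity) (by positivity)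
  obtain ⟨B3, hB3⟩ : ∃ B, B = B2 + C3 := ⟨_, rfl⟩
  obtain ⟨C4, hC4, H4⟩ := L4 n (C := B3) (r := R / 128) (τ := R / 8) hp hm hmM (by linarith) (by positivity) (by positivity)
  obtain ⟨B4, hB4⟩ : ∃ B, B = B3 + C4 := ⟨_, rfl⟩
  obtain ⟨C5, hC5, H5⟩ := L5 n (C := B4) (r := R / 512) (τ := R / 16) hp hm hmM (by linarith) (by positivity) (by positivity)
  obtain ⟨B5, hB5⟩ : ∃ B, B = B4 + C5 := ⟨_, rfl⟩
  obtain ⟨C6, hC6, H6⟩ := L6 n (C := B5) (ρ := R / 8192) hp hm (by linarith) (by positivity)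
  obtain ⟨B6, hB6⟩ : ∃ B, B = B5 + C6 + M := ⟨_, rfl⟩
  obtain ⟨C7, hC7, H7⟩ := L7 n (M := M) (C := B6) (ρ := R / 32768) hp hm (by linarith) (by linarith) (by positivity)
  have hB60 : 0 < B6 := by linarith
  refine ⟨B6 + C7, min (R / 32768) (m / (2 * B6)), by linarith, lt_min (by positivity) (by positivity), ?_⟩
  intro h tc Mb x0 u hh hhb hReg
  have hhR : h ≤ R / 32768 := hhb.trans (min_le_left _ _)
  have hhm : B6 * h ≤ m / 2 := by
    have h1 : h ≤ m / (2 * B6) := hhb.trans (min_le_right _ _)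
    rw [le_div_iff₀ (by positivity)] at h1
    linarith
  -- step 1
  have G1 : ∀ x, dsq h x x0 ≤ (R / 4) ^ 2 → ∀ t ∈ Icc (tc - R / 2) tc, ∀ e, |Dd h e (fun y => u y t) x| ≤ B1 := by
    intro x hx t ht e
    have h1 := H1 h (tc - R) Mb x0 u hh (by linarith) ?_ x (dsub hx (by positivity) (by linarith)) t ⟨by linarith [ht.1], by linarith [ht.2]⟩
    · have h2 := Finset.single_le_sum (f := fun e => (Dd h e (fun y => u y t) x) ^ 2) (fun e _ => sq_nonneg _) (Finset.mem_univ e)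
      have h3 := h2.trans h1
      beta_reduce at h3
      exact abs_le_of_sq_le_sq (by rw [hB1]; nlinarith) (by linarith)
    · intro x hx t ht
      have hx' := dsub hx (by positivity) (by linarith : 2 * (R / 2) ≤ R)
      have ht' : t ∈ Icc (tc - R) tc := ⟨ht.1, by linarith [ht.2]⟩
      exact ⟨hReg.du x hx' t ht', hReg.lo x hx' t ht', hReg.hi x hx' t ht', hReg.os x hx' t ht'⟩
  -- step 2
  have G2 : ∀ x, dsq h x x0 ≤ (R / 16) ^ 2 → ∀ t ∈ Icc (tc - R / 4) tc, |wf h p u x t| ≤ C2 := by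
    intro x hx t ht
    refine H2 h (tc - R / 2) η Mb x0 u hh (by linarith) (hReg.sub (by positivity) (by linarith) (by linarith) (by linarith)) ?_ x
      (dsub hx (by positivity) (by linarith)) t ⟨by linarith [ht.1], by linarith [ht.2]⟩
    intro x hx t ht
    exact G1 x (dsub hx (by positivity) (by linarith)) t ⟨ht.1, by linarith [ht.2]⟩
  have G3 : ∀ x, dsq h x x0 ≤ (R / 64) ^ 2 → ∀ t ∈ Icc (tc - R / 8) tc, ∀ e, |Dd h e (fun y => wf h p u y t) x| ≤ C3 := by
    intro x hx t ht
    refine H3 h (tc - R / 4) η Mb x0 u hh (by linarith) (hReg.sub (by positivity) (by linarith) (by linarith) (by linarith)) ?_ x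
      (dsub hx (by positivity) (by linarith)) t ⟨by linarith [ht.1], by linarith [ht.2]⟩
    intro x hx t ht
    have ht2 : t ≤ tc := by linarith [ht.2]
    exact ⟨fun e => (G1 x (dsub hx (by positivity) (by linarith)) t ⟨by linarith [ht.1], ht2⟩ e).trans (by linarith),
      (G2 x (dsub hx (by positivity) (by linarith)) t ⟨by linarith [ht.1], ht2⟩).trans (by linarith)⟩
  have G4 : ∀ x, dsq h x x0 ≤ (R / 256) ^ 2 → ∀ t ∈ Icc (tc - R / 16) tc, |zf h p u x t| ≤ C4 := by
    intro x hx t ht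
    refine H4 h (tc - R / 8) η Mb x0 u hh (by linarith) (hReg.sub (by positivity) (by linarith) (by linarith) (by linarith)) ?_ x
      (dsub hx (by positivity) (by linarith)) t ⟨by linarith [ht.1], by linarith [ht.2]⟩
    intro x hx t ht
    have ht2 : t ≤ tc := by linarith [ht.2]
    exact ⟨fun e => (G1 x (dsub hx (by positivity) (by linarith)) t ⟨by linarith [ht.1], ht2⟩ e).trans (by linarith),
      (G2 x (dsub hx (by positivity) (by linarith)) t ⟨by linarith [ht.1], ht2⟩).trans (by linarith),
      fun e => (G3 x (dsub hx (by positivity) (by linarith)) t ⟨by linarith [ht.1], ht2⟩ e).trans (by linarith)⟩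
  have G5 : ∀ x, dsq h x x0 ≤ (R / 1024) ^ 2 → ∀ e, |Dd h e (fun y => zf h p u y tc) x| ≤ C5 := by
    intro x hx
    refine H5 h (tc - R / 16) η Mb x0 u hh (by linarith) (hReg.sub (by positivity) (by linarith) (by linarith) (by linarith)) ?_ x
      (dsub hx (by positivity) (by linarith)) tc ⟨by linarith, by linarith⟩
    intro x hx t ht
    have ht2 : t ≤ tc := by linarith [ht.2]
    exact ⟨fun e => (G1 x (dsub hx (by positivity) (by linarith)) t ⟨by linarith [ht.1], ht2⟩ e).trans (by linarith),
      (G2 x (dsub hx (by positivity) (by linarith)) t ⟨by linarith [ht.1], ht2⟩).trans (by linarith),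
      fun e => (G3 x (dsub hx (by positivity) (by linarith)) t ⟨by linarith [ht.1], ht2⟩ e).trans (by linarith),
      (G4 x (dsub hx (by positivity) (by linarith)) t ⟨by linarith [ht.1], ht2⟩).trans (by linarith)⟩
  have itc : ∀ s, 0 ≤ s → tc ∈ Icc (tc - s) tc := fun s hs => ⟨by linarith, le_rfl⟩
  have G6 : ∀ x, dsq h x x0 ≤ (R / 4096) ^ 2 → ∀ e f, |Dd h f (fun y => Dd h e (fun y => u y tc) y) x| ≤ C6 ∧
      |Dd h f (fun y => Dd h e (fun y => wf h p u y tc) y) x| ≤ C6 := by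
    intro x hx
    refine H6 h tc x0 u hh (by linarith) ?_ x (dsub hx (by positivity) (by linarith))
    intro x hx
    exact ⟨hReg.lo x (dsub hx (by positivity) (by linarith)) tc (itc _ hR.le),
      fun e => (G1 x (dsub hx (by positivity) (by linarith)) tc (itc _ (by positivity)) e).trans (by linarith),
      (G2 x (dsub hx (by positivity) (by linarith)) tc (itc _ (by positivity))).trans (by linarith),
      fun e => (G3 x (dsub hx (by positivity) (by linarith)) tc (itc _ (by positivity)) e).trans (by linarith),
      (G4 x (dsub hx (by positivity) (by linarith)) tc (itc _ (by positivity))).trans (by linarith),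
      fun e => (G5 x (dsub hx (by positivity) (by linarith)) e).trans (by linarith)⟩
  have hs : ∀ s : ℝ, dsq h x0 x0 ≤ s ^ 2 := fun s => by rw [dsq_self]; positivity
  refine ⟨fun e => (G1 x0 (hs _) tc (itc _ (by positivity)) e).trans (by linarith), (G2 x0 (hs _) tc (itc _ (by positivity))).trans (by linarith),
    (G4 x0 (hs _) tc (itc _ (by positivity))).trans (by linarith), fun e f => (G6 x0 (hs _) e f).1.trans (by linarith), ?_⟩
  intro e f g
  refine (H7 h tc x0 u hh hhR hhm ?_ e f g).trans (by linarith)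
  intro x hx
  exact ⟨hReg.lo x (dsub hx (by positivity) (by linarith)) tc (itc _ hR.le), hReg.hi x (dsub hx (by positivity) (by linarith)) tc (itc _ hR.le),
      fun e => (G1 x (dsub hx (by positivity) (by linarith)) tc (itc _ (by positivity)) e).trans (by linarith),
      (G2 x (dsub hx (by positivity) (by linarith)) tc (itc _ (by positivity))).trans (by linarith),
      fun e => (G3 x (dsub hx (by positivity) (by linarith)) tc (itc _ (by positivity)) e).trans (by linarith),
      fun e f => ⟨(G6 x (dsub hx (by positivity) (by linarith)) e f).1.trans (by linarith), (G6 x (dsub hx (by positivity) (by linarith)) e f).2.trans (by linarith)⟩⟩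

/-- local regularity: final form -/
lemma loc_reg (n : ℕ) {p m M C1 ρ : ℝ} (hp : 1 ≤ p) (hm : 0 < m) (hmM : m ≤ M) (hC1 : 0 ≤ C1) (hρ : 0 < ρ) :
    ∃ C hb, 0 < C ∧ 0 < hb ∧ ∀ (h tc : ℝ) (x0 : Lt n) (u : Lt n → ℝ → ℝ), 0 < h → h ≤ hb → Cyl h p m M C1 u x0 tc ρ →
    (∀ e, |Dd h e (fun y => u y tc) x0| ≤ C) ∧ |wf h p u x0 tc| ≤ C ∧ |zf h p u x0 tc| ≤ C ∧
    (∀ e f, |Dd h f (fun y => Dd h e (fun y => u y tc) y) x0| ≤ C) ∧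
    (∀ e f g, |Dd h g (fun y => Dd h f (fun y => Dd h e (fun y => u y tc) y) y) x0| ≤ C) := by
  have hM : 0 < M := hm.trans_le hmM
  obtain ⟨η, hη, H1⟩ := Reg_bounds n hp hm hmM
  obtain ⟨ε, ρ0, εh, hε, hε1, hρ0, hεh, H2⟩ := small_osc n hp hm hM hC1 hη
  obtain ⟨q, hq⟩ : ∃ q, q = min ρ ρ0 := ⟨_, rfl⟩
  have hq0 : 0 < q := by rw [hq]; exact lt_min hρ hρ0
  have hqρ : q ≤ ρ := by rw [hq]; exact min_le_left _ _
  have hqρ0 : q ≤ ρ0 := by rw [hq]; exact min_le_right _ _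
  have hεq : 0 < ε * q := by positivity
  have hεq1 : ε * q ≤ q := by nlinarith
  obtain ⟨R, hR⟩ : ∃ R, R = min (ε * q / 2) (4 * (ε * q) ^ 2) := ⟨_, rfl⟩
  have hR0 : 0 < R := by rw [hR]; exact lt_min (by positivity) (by positivity)
  have hR1 : R ≤ ε * q / 2 := by rw [hR]; exact min_le_left _ _
  have hR2 : R ≤ 4 * (ε * q) ^ 2 := by rw [hR]; exact min_le_right _ _
  obtain ⟨C, hb, hC, hhb, H3⟩ := H1 R hR0
  refine ⟨C, min hb (min (q / 2) (εh * q)), hC, lt_min hhb (lt_min (by positivity) (by positivity)), ?_⟩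
  intro h tc x0 u hh hhh hCyl
  have hh1 : h ≤ hb := hhh.trans (min_le_left _ _)
  have hh2 : h ≤ q / 2 := hhh.trans ((min_le_right _ _).trans (min_le_left _ _))
  have hh3 : h ≤ εh * q := hhh.trans ((min_le_right _ _).trans (min_le_right _ _))
  have hCq := hCyl.sub hq0.le hqρ
  obtain ⟨Mb, hMb⟩ := H2 h q tc u x0 hh hq0 hqρ0 hh3 hCq
  have hsq : 4 * (ε * q) ^ 2 ≤ 4 * q ^ 2 := by have := pow_le_pow_left₀ hεq.le hεq1 2; linarith
  have ht1 : ∀ t ∈ Icc (tc - R) tc, t ∈ Icc (tc - 4 * q ^ 2) (tc + 4 * q ^ 2) := fun t ht =>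
    ⟨by linarith [ht.1], by linarith [ht.2, sq_nonneg q]⟩
  have ht2 : ∀ t ∈ Icc (tc - R) tc, t ∈ Icc (tc - 4 * (ε * q) ^ 2) (tc + 4 * (ε * q) ^ 2) := fun t ht =>
    ⟨by linarith [ht.1], by linarith [ht.2, sq_nonneg (ε * q)]⟩
  have hx1 : ∀ x, dsq h x x0 ≤ R ^ 2 → dsq h x x0 ≤ q ^ 2 := fun x hx => dsub hx hR0.le (by linarith)
  have hx2 : ∀ x, dsq h x x0 ≤ R ^ 2 → ∀ e, dsq h (x + st e) x0 ≤ q ^ 2 := fun x hx e =>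
    (dsq_step_le hh.le hR0.le hx e).trans (pow_le_pow_left₀ (by linarith) (by linarith) 2)
  have hdu : ∀ x, ∀ t ∈ Icc (tc - R) tc, HasDerivAt (u x) (wf h p u x t) t := fun x t ht => hCq.hd x t (ht1 t ht)
  have hdw : ∀ x, dsq h x x0 ≤ q ^ 2 → ∀ t ∈ Icc (tc - R) tc, HasDerivAt (wf h p u x) (zf h p u x t) t := fun x hx t ht =>
    wf_deriv hp u x t (fun y => hdu y t ht) (hm.trans_le (hCq.lo x hx t (ht1 t ht)))
  refine H3 h tc Mb x0 u hh hh1 ⟨fun x _ => hdu x, fun x hx => hdw x (hx1 x hx), ?_, fun x hx t ht => hCq.lo x (hx1 x hx) t (ht1 t ht),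
    fun x hx t ht => hCq.hi x t (ht1 t ht), fun x hx t ht => hMb x (dsub hx hR0.le (by linarith)) t (ht2 t ht)⟩
  intro x hx t ht
  exact zf_deriv hp u x t (hdu x t ht) (fun e => hdw _ (hx2 x hx e) t ht) (hdw x (hx1 x hx) t ht) (hm.trans_le (hCq.lo x (hx1 x hx) t (ht1 t ht)))
end Comb

open Real Set MeasureTheory Metric Filter

section Lim
variable {n : ℕ}

abbrev En (n : ℕ) := EuclideanSpace ℝ (Fin n)

noncomputable def hk (k : ℕ) : ℝ := 1 / ((k : ℝ) + 1)
lemma hk_pos (k : ℕ) : 0 < hk k := by unfold hk; positivity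
lemma hk_tendsto : Tendsto hk atTop (nhds 0) := tendsto_one_div_add_atTop_nhds_zero_nat

noncomputable abbrev HF : Filter ℕ := (hyperfilter ℕ : Filter ℕ)
lemma HF_le : HF ≤ atTop := Nat.hyperfilter_le_atTop
lemma HF_ev {P : ℕ → Prop} {k0 : ℕ} (h : ∀ k ≥ k0, P k) : ∀ᶠ k in HF, P k := HF_le (eventually_atTop.2 ⟨k0, h⟩)
lemma hk_HF : Tendsto hk HF (nhds 0) := hk_tendsto.mono_left HF_le

noncomputable def ul (a : ℕ → ℝ) : ℝ := limUnder HF a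

lemma ul_tendsto {a : ℕ → ℝ} {C : ℝ} (h : ∀ᶠ k in HF, |a k| ≤ C) : Tendsto a HF (nhds (ul a)) := by
  have h1 : ((hyperfilter ℕ).map a : Filter ℝ) ≤ Filter.principal (Icc (-C) C) := by
    rw [Filter.le_principal_iff]
    exact Filter.mem_map.2 (h.mono fun k hk => abs_le.1 hk)
  obtain ⟨x, _, hx⟩ := isCompact_Icc.ultrafilter_le_nhds _ h1
  exact tendsto_nhds_limUnder ⟨x, hx⟩

lemma ul_eq {a : ℕ → ℝ} {l : ℝ} (h : Tendsto a HF (nhds l)) : ul a = l := h.limUnder_eq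

noncomputable def pt (h : ℝ) (x : Lt n) : En n := WithLp.toLp 2 (fun i => h * (x i : ℝ))
lemma pt_apply (h : ℝ) (x : Lt n) (i : Fin n) : pt h x i = h * x i := rfl

lemma dsq_pt (h : ℝ) (x y : Lt n) : dsq h x y = ‖pt h x - pt h y‖ ^ 2 := by
  rw [EuclideanSpace.norm_sq_eq]
  unfold dsq
  refine Finset.sum_congr rfl (fun i _ => ?_)
  rw [PiLp.sub_apply, pt_apply, pt_apply, Real.norm_eq_abs, sq_abs]; ring

lemma pt_zero (h : ℝ) : pt h (0 : Lt n) = 0 := by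
  ext i; rw [pt_apply]; simp

noncomputable def fl (k : ℕ) (x : En n) : Lt n := fun i => ⌊x i / hk k⌋

lemma fl_coord (k : ℕ) (x : En n) (i : Fin n) : |hk k * (fl k x i : ℝ) - x i| ≤ hk k := by
  have h0 := hk_pos k
  have h1 := Int.floor_le (x i / hk k)
  have h2 := Int.lt_floor_add_one (x i / hk k)
  rw [le_div_iff₀ h0] at h1
  rw [div_lt_iff₀ h0] at h2
  unfold fl
  rw [abs_le]; constructor <;> linarith

lemma pt_fl (k : ℕ) (x : En n) : ‖pt (hk k) (fl k x) - x‖ ≤ n * hk k := by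
  have h0 := hk_pos k
  have h1 : ‖pt (hk k) (fl k x) - x‖ ^ 2 ≤ (n * hk k) ^ 2 := by
    rw [EuclideanSpace.norm_sq_eq]
    have : ∀ i ∈ (Finset.univ : Finset (Fin n)), ‖(pt (hk k) (fl k x) - x) i‖ ^ 2 ≤ hk k ^ 2 := by
      intro i _
      rw [PiLp.sub_apply, pt_apply, Real.norm_eq_abs]
      exact pow_le_pow_left₀ (abs_nonneg _) (fl_coord k x i) 2
    refine (Finset.sum_le_sum this).trans ?_
    rw [Finset.sum_const, Finset.card_univ, Fintype.card_fin, nsmul_eq_mul, mul_pow]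
    refine mul_le_mul_of_nonneg_right ?_ (by positivity)
    rcases Nat.eq_zero_or_pos n with h | h
    · subst h; simp
    · have : (1:ℝ) ≤ n := by exact_mod_cast h
      nlinarith
  exact (le_abs_self _).trans (abs_le_of_sq_le_sq h1 (by positivity))

lemma fl_tendsto (x : En n) (i : Fin n) : Tendsto (fun k => hk k * (fl k x i : ℝ)) HF (nhds (x i)) := by
  rw [tendsto_iff_norm_sub_tendsto_zero]
  exact squeeze_zero (fun _ => norm_nonneg _) (fun k => fl_coord k x i) hk_HF

lemma pt_fl_tendsto (x : En n) : Tendsto (fun k => pt (hk k) (fl k x)) HF (nhds x) := by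
  rw [tendsto_iff_norm_sub_tendsto_zero]
  refine squeeze_zero (fun _ => norm_nonneg _) (fun k => pt_fl k x) ?_
  simpa using hk_HF.const_mul (n : ℝ)

lemma dsq_fl (k : ℕ) (x y : En n) : dsq (hk k) (fl k y) (fl k x) ≤ (‖y - x‖ + 2 * n * hk k) ^ 2 := by
  rw [dsq_pt]
  refine pow_le_pow_left₀ (norm_nonneg _) ?_ 2
  have e : pt (hk k) (fl k y) - pt (hk k) (fl k x) = (pt (hk k) (fl k y) - y) + (y - x) - (pt (hk k) (fl k x) - x) := by abel
  rw [e]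
  have h1 := norm_sub_le ((pt (hk k) (fl k y) - y) + (y - x)) (pt (hk k) (fl k x) - x)
  have h2 := norm_add_le (pt (hk k) (fl k y) - y) (y - x)
  have h3 := pt_fl k x
  have h4 := pt_fl k y
  linarith

lemma dsq_fl_zero (k : ℕ) (x : En n) : dsq (hk k) (fl k x) 0 ≤ (‖x‖ + n * hk k) ^ 2 := by
  rw [dsq_pt, pt_zero, sub_zero]
  refine pow_le_pow_left₀ (norm_nonneg _) ?_ 2
  have h1 := norm_add_le (pt (hk k) (fl k x) - x) x
  rw [sub_add_cancel] at h1
  have h3 := pt_fl k x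
  linarith

lemma hk_le_one (k : ℕ) : hk k ≤ 1 := by
  unfold hk; rw [div_le_one (by positivity)]; have : (0:ℝ) ≤ k := Nat.cast_nonneg k; linarith

/-- locally uniformly bounded lattice sequences -/
def LBd (f : ℕ → Lt n → ℝ) : Prop := ∀ R : ℝ, 0 < R → ∃ C, 0 < C ∧ ∃ k0, ∀ k ≥ k0, ∀ x, dsq (hk k) x 0 ≤ R ^ 2 → |f k x| ≤ C

noncomputable def DS (e : Dr n) (f : ℕ → Lt n → ℝ) : ℕ → Lt n → ℝ := fun k x => Dd (hk k) e (f k) x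
noncomputable def VL (f : ℕ → Lt n → ℝ) (x : En n) : ℝ := ul (fun k => f k (fl k x))

lemma VL_tendsto {f : ℕ → Lt n → ℝ} (hf : LBd f) (x : En n) : Tendsto (fun k => f k (fl k x)) HF (nhds (VL f x)) := by
  obtain ⟨C, _, k0, H⟩ := hf (‖x‖ + n + 1) (by positivity)
  refine ul_tendsto (C := C) (HF_ev (k0 := k0) (fun k hk => H k hk _ ?_))
  refine (dsq_fl_zero k x).trans (pow_le_pow_left₀ (by have := hk_pos k; positivity) ?_ 2)
  have := mul_le_mul_of_nonneg_left (hk_le_one k) (Nat.cast_nonneg n : (0:ℝ) ≤ n)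
  linarith

lemma LBd_all {f : Dr n → ℕ → Lt n → ℝ} (hf : ∀ e, LBd (f e)) {R : ℝ} (hR : 0 < R) :
    ∃ C, 0 < C ∧ ∃ k0, ∀ k ≥ k0, ∀ x, dsq (hk k) x 0 ≤ R ^ 2 → ∀ e, |f e k x| ≤ C := by
  choose C hC k0 H using fun e => hf e R hR
  refine ⟨1 + ∑ e, C e, ?_, Finset.univ.sup k0, ?_⟩
  · have := Finset.sum_nonneg (fun e (_ : e ∈ Finset.univ) => (hC e).le); linarith
  · intro k hk x hx e
    have h1 := H e k ((Finset.le_sup (Finset.mem_univ e)).trans hk) x hx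
    have h2 := Finset.single_le_sum (f := C) (fun e _ => (hC e).le) (Finset.mem_univ e)
    linarith

/-- discrete Lipschitz bound -/
lemma lat_lip {h R C r : ℝ} (hh : 0 < h) (hC : 0 ≤ C) (hr : 0 ≤ r) (f : Lt n → ℝ) (a b : Lt n)
    (H : ∀ x, dsq h x 0 ≤ R ^ 2 → ∀ e, |Dd h e f x| ≤ C) (ha : ∀ z, dsq h z a ≤ r ^ 2 → dsq h z 0 ≤ R ^ 2)
    (hb : dsq h b a ≤ r ^ 2) : |f b - f a| ≤ C * (n * r) := by
  refine path_center hh hr hC f a b hb (fun z e hz => ?_)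
  have := (Dd_le_iff hh e f z C).1 (H z (ha z hz) e)
  linarith

lemma VL_lip {f : ℕ → Lt n → ℝ} (hf : LBd f) (hD : ∀ e, LBd (DS e f)) (A : ℝ) (hA : 0 < A) :
    ∃ C, 0 < C ∧ ∀ x y, ‖x‖ ≤ A → ‖y‖ ≤ A → |VL f y - VL f x| ≤ C * (n * ‖y - x‖) := by
  obtain ⟨C, hC, k0, H⟩ := LBd_all hD (R := 3 * A + 3 * n + 1) (by positivity)
  refine ⟨C, hC, ?_⟩
  intro x y hx hy
  have h1 := ((VL_tendsto hf y).sub (VL_tendsto hf x)).abs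
  have h2 : Tendsto (fun k => C * (n * (‖y - x‖ + 2 * n * hk k))) HF (nhds (C * (n * (‖y - x‖ + 2 * n * 0)))) :=
    ((hk_HF.const_mul (2 * n : ℝ)).const_add ‖y - x‖).const_mul (n : ℝ) |>.const_mul C
  have h3 := le_of_tendsto_of_tendsto h1 h2 (HF_ev (k0 := k0) (fun k hk' => ?_))
  · simpa using h3
  · have hk0 := hk_pos k
    have hn1 : n * hk k ≤ n := by have := mul_le_mul_of_nonneg_left (hk_le_one k) (Nat.cast_nonneg n : (0:ℝ) ≤ n); linarith
    have hyx : ‖y - x‖ ≤ 2 * A := (norm_sub_le y x).trans (by linarith)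
    refine lat_lip (R := 3 * A + 3 * n + 1) hk0 hC.le (by positivity) (f k) _ _ (H k hk') ?_ (dsq_fl k x y)
    intro z hz
    refine (dsq_tri (by positivity) (by positivity) hz (dsq_fl_zero k x)).trans (pow_le_pow_left₀ (by positivity) (by linarith) 2)

lemma VL_cont {f : ℕ → Lt n → ℝ} (hf : LBd f) (hD : ∀ e, LBd (DS e f)) : Continuous (VL f) := by
  rw [continuous_iff_continuousAt]
  intro x
  obtain ⟨C, hC, H⟩ := VL_lip hf hD (‖x‖ + 1) (by positivity)
  rw [ContinuousAt, tendsto_iff_norm_sub_tendsto_zero]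
  have h1 : Tendsto (fun y => C * (n * ‖y - x‖)) (nhds x) (nhds 0) := by
    have : Continuous (fun y : En n => C * (n * ‖y - x‖)) := by fun_prop
    have h2 := this.tendsto x
    simpa using h2
  refine squeeze_zero' (Eventually.of_forall (fun _ => norm_nonneg _)) ?_ h1
  filter_upwards [ball_mem_nhds x one_pos] with y hy
  rw [mem_ball, dist_eq_norm] at hy
  refine H x y (by linarith) ?_
  have := norm_add_le (y - x) x
  rw [sub_add_cancel] at this
  linarith

lemma st_apply_true (i j : Fin n) : (st ((i, true) : Dr n) j : ℝ) = if j = i then 1 else 0 := by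
  simp [st, sgn, Pi.single_apply]

lemma lin_step (h : ℝ) (c : Fin n → ℝ) (z : Lt n) (i : Fin n) :
    ∑ j, c j * (h * ((z + st ((i, true) : Dr n)) j : ℝ)) = ∑ j, c j * (h * (z j : ℝ)) + c i * h := by
  have : ∀ j, c j * (h * (((z + st ((i, true) : Dr n)) j : ℤ) : ℝ)) = c j * (h * (z j : ℝ)) + (if j = i then c j * h else 0) := by
    intro j
    rw [Pi.add_apply]; push_cast; rw [st_apply_true]; split_ifs <;> ring
  rw [Finset.sum_congr rfl (fun j _ => this j), Finset.sum_add_distrib]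
  simp

/-- discrete Taylor bound -/
lemma lat_taylor {h R C r : ℝ} (hh : 0 < h) (hC : 0 ≤ C) (hr : 0 ≤ r) (f : Lt n → ℝ) (a b : Lt n)
    (H : ∀ x, dsq h x 0 ≤ R ^ 2 → ∀ e e', |Dd h e' (fun y => Dd h e f y) x| ≤ C)
    (ha : ∀ z, dsq h z a ≤ (r + h) ^ 2 → dsq h z 0 ≤ R ^ 2)
    (hb : dsq h b a ≤ r ^ 2) :
    |f b - f a - ∑ i, Dd h (i, true) f a * (h * (b i : ℝ) - h * (a i : ℝ))| ≤ C * (n * (r + h)) * (n * r) := by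
  obtain ⟨c, hc⟩ : ∃ c : Fin n → ℝ, c = fun i => Dd h (i, true) f a := ⟨_, rfl⟩
  have hL : 0 ≤ C * (n * (r + h)) := by positivity
  have key : ∀ z i, dsq h z a ≤ (r + h) ^ 2 → |Dd h (i, true) f z - c i| ≤ C * (n * (r + h)) := by
    intro z i hz
    rw [hc]
    exact lat_lip (R := R) hh hC (by positivity) (fun y => Dd h (i, true) f y) a z (fun x hx e => H x hx _ _) ha hz
  have stp : ∀ z i, dsq h z a ≤ (r + h) ^ 2 →
      |(f (z + st (i, true)) - ∑ j, c j * (h * ((z + st ((i, true) : Dr n)) j : ℝ))) - (f z - ∑ j, c j * (h * (z j : ℝ)))| ≤ h * (C * (n * (r + h))) := by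
    intro z i hz
    rw [lin_step]
    have h1 := key z i hz
    have e : (f (z + st (i, true)) - (∑ j, c j * (h * (z j : ℝ)) + c i * h)) - (f z - ∑ j, c j * (h * (z j : ℝ))) = h * (Dd h (i, true) f z - c i) := by
      obtain ⟨S, hS⟩ : ∃ S, S = ∑ j, c j * (h * (z j : ℝ)) := ⟨_, rfl⟩
      rw [← hS]
      unfold Dd; field_simp; ring
    rw [e, abs_mul, abs_of_pos hh]
    exact mul_le_mul_of_nonneg_left h1 hh.le
  have h2 := path_center hh hr hL (fun z => f z - ∑ j, c j * (h * (z j : ℝ))) a b hb ?_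
  · have e : f b - f a - ∑ i, Dd h (i, true) f a * (h * (b i : ℝ) - h * (a i : ℝ)) = (f b - ∑ j, c j * (h * (b j : ℝ))) - (f a - ∑ j, c j * (h * (a j : ℝ))) := by
      rw [hc]; simp only [mul_sub, Finset.sum_sub_distrib]; ring
    rw [e]; exact h2
  · rintro z ⟨i, b⟩ hz
    cases b
    · have hz' := dsq_step_le hh.le hr hz (i, false)
      have := stp _ i hz'
      have e : z + st ((i, false) : Dr n) + st (i, true) = z := by rw [st_neg]; abel
      rw [e, abs_sub_comm] at this
      exact this
    · exact stp z i (hz.trans (pow_le_pow_left₀ hr (by linarith) 2))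

lemma VL_deriv {f : ℕ → Lt n → ℝ} (hf : LBd f) (hD : ∀ e, LBd (DS e f)) (hDD : ∀ e e', LBd (DS e' (DS e f))) (x : En n) :
    HasFDerivAt (VL f) (∑ i, VL (DS (i, true) f) x • (EuclideanSpace.proj i : En n →L[ℝ] ℝ)) x := by
  obtain ⟨R, hR⟩ : ∃ R : ℝ, R = 2 * ‖x‖ + 3 * n + 3 := ⟨_, rfl⟩
  have hR0 : 0 < R := by rw [hR]; positivity
  choose C hC k0 H using fun e => LBd_all (hDD e) hR0
  obtain ⟨K, hK⟩ : ∃ K, K = ∑ e, C e := ⟨_, rfl⟩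
  have hCK : ∀ e, C e ≤ K := fun e => by rw [hK]; exact Finset.single_le_sum (f := C) (fun e _ => (hC e).le) (Finset.mem_univ e)
  have hK0 : 0 ≤ K := by rw [hK]; exact Finset.sum_nonneg (fun e _ => (hC e).le)
  have main : ∀ y, ‖y - x‖ ≤ 1 → |VL f y - VL f x - ∑ i, VL (DS (i, true) f) x * (y i - x i)| ≤ K * n * n * ‖y - x‖ ^ 2 := by
    intro y hy
    have h1 : Tendsto (fun k => |f k (fl k y) - f k (fl k x) - ∑ i, DS (i, true) f k (fl k x) * (hk k * (fl k y i : ℝ) - hk k * (fl k x i : ℝ))|) HF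
        (nhds |VL f y - VL f x - ∑ i, VL (DS (i, true) f) x * (y i - x i)|) :=
      (((VL_tendsto hf y).sub (VL_tendsto hf x)).sub (tendsto_finsetSum _ (fun i _ =>
        (VL_tendsto (hD (i, true)) x).mul ((fl_tendsto y i).sub (fl_tendsto x i))))).abs
    have h2a : Tendsto (fun k => ‖y - x‖ + 2 * n * hk k) HF (nhds (‖y - x‖ + 2 * n * 0)) := (hk_HF.const_mul (2 * n : ℝ)).const_add ‖y - x‖
    have h2 := (((h2a.add hk_HF).const_mul (n : ℝ)).const_mul K).mul (h2a.const_mul (n : ℝ))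
    have h3 := le_of_tendsto_of_tendsto h1 h2 (HF_ev (k0 := Finset.univ.sup k0) (fun k hk' => ?_))
    · refine h3.trans (le_of_eq ?_); ring
    · have hk0 := hk_pos k
      have hn1 : n * hk k ≤ n := by have := mul_le_mul_of_nonneg_left (hk_le_one k) (Nat.cast_nonneg n : (0:ℝ) ≤ n); linarith
      have hk1 := hk_le_one k
      refine lat_taylor (R := R) hk0 hK0 (by positivity) (f k) _ _ ?_ ?_ (dsq_fl k x y)
      · intro z hz e e'
        exact (H e k ((Finset.le_sup (Finset.mem_univ e)).trans hk') z hz e').trans (hCK e)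
      · intro z hz
        refine (dsq_tri (by positivity) (by positivity) hz (dsq_fl_zero k x)).trans (pow_le_pow_left₀ (by positivity) ?_ 2)
        have := norm_nonneg x
        rw [hR]; linarith
  rw [hasFDerivAt_iff_isLittleO_nhds_zero]
  have h5 : (fun d : En n => VL f (x + d) - VL f x - (∑ i, VL (DS (i, true) f) x • (EuclideanSpace.proj i : En n →L[ℝ] ℝ)) d) =O[nhds 0] (fun d => ‖d‖ ^ 2) := by
    refine Asymptotics.IsBigO.of_bound (K * n * n) ?_
    filter_upwards [ball_mem_nhds (0 : En n) one_pos] with d hd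
    rw [mem_ball, dist_zero_right] at hd
    have := main (x + d) (by rw [add_sub_cancel_left]; exact hd.le)
    rw [add_sub_cancel_left] at this
    rw [Real.norm_eq_abs, Real.norm_eq_abs, abs_of_nonneg (by positivity : 0 ≤ ‖d‖ ^ 2)]
    convert this using 3
    simp
  refine h5.trans_isLittleO ?_
  exact Asymptotics.isLittleO_norm_pow_id one_lt_two
end Lim

open Real Set MeasureTheory Metric Filter

section Lim2
variable {n : ℕ}

lemma VL_C1 {f : ℕ → Lt n → ℝ} (hf : LBd f) (hD : ∀ e, LBd (DS e f)) (hDD : ∀ e e', LBd (DS e' (DS e f))) :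
    ContDiff ℝ 1 (VL f) := by
  rw [contDiff_one_iff_fderiv]
  refine ⟨fun x => (VL_deriv hf hD hDD x).differentiableAt, ?_⟩
  have e : fderiv ℝ (VL f) = fun x => ∑ i, VL (DS (i, true) f) x • (EuclideanSpace.proj i : En n →L[ℝ] ℝ) :=
    funext fun x => (VL_deriv hf hD hDD x).fderiv
  rw [e]
  exact continuous_finsetSum _ (fun i _ => (VL_cont (hD (i, true)) (fun e' => hDD _ e')).smul continuous_const)

lemma VL_C2 {f : ℕ → Lt n → ℝ} (hf : LBd f) (hD : ∀ e, LBd (DS e f)) (hDD : ∀ e e', LBd (DS e' (DS e f)))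
    (hDDD : ∀ e e' e'', LBd (DS e'' (DS e' (DS e f)))) : ContDiff ℝ 2 (VL f) := by
  have h2 : (2 : WithTop ℕ∞) = 1 + 1 := by norm_num
  rw [h2, contDiff_succ_iff_fderiv]
  refine ⟨fun x => (VL_deriv hf hD hDD x).differentiableAt, by simp, ?_⟩
  have e : fderiv ℝ (VL f) = fun x => ∑ i, VL (DS (i, true) f) x • (EuclideanSpace.proj i : En n →L[ℝ] ℝ) :=
    funext fun x => (VL_deriv hf hD hDD x).fderiv
  rw [e]
  exact ContDiff.sum (fun i _ => (VL_C1 (hD (i, true)) (fun e' => hDD _ e') (fun e' e'' => hDDD _ e' e'')).smul contDiff_const)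

lemma VL_fderiv_single {f : ℕ → Lt n → ℝ} (hf : LBd f) (hD : ∀ e, LBd (DS e f)) (hDD : ∀ e e', LBd (DS e' (DS e f)))
    (x : En n) (i : Fin n) : fderiv ℝ (VL f) x (EuclideanSpace.single i 1) = VL (DS (i, true) f) x := by
  rw [(VL_deriv hf hD hDD x).fderiv]
  simp

lemma VL_lap {f : ℕ → Lt n → ℝ} (hf : LBd f) (hD : ∀ e, LBd (DS e f)) (hDD : ∀ e e', LBd (DS e' (DS e f)))
    (hDDD : ∀ e e' e'', LBd (DS e'' (DS e' (DS e f)))) (x : En n) :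
    Tendsto (fun k => lapD (hk k) (f k) (fl k x)) HF (nhds (lap (VL f) x)) := by
  have e : lap (VL f) x = ∑ i, VL (DS (i, true) (DS (i, true) f)) x := by
    unfold lap
    refine Finset.sum_congr rfl (fun i _ => ?_)
    have e1 : (fun y => fderiv ℝ (VL f) y (EuclideanSpace.single i 1)) = VL (DS (i, true) f) :=
      funext fun y => VL_fderiv_single hf hD hDD y i
    rw [e1]
    exact VL_fderiv_single (hD _) (fun e' => hDD _ e') (fun e' e'' => hDDD _ e' e'') x i
  rw [e]
  have e2 : (fun k => lapD (hk k) (f k) (fl k x)) = fun k => ∑ i, (DS (i, true) (DS (i, true) f) k (fl k x)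
      + hk k * DS (i, false) (DS (i, true) (DS (i, true) f)) k (fl k x)) := by
    funext k
    have hk0 := (hk_pos k).ne'
    rw [lapD_second hk0, ← Finset.sum_neg_distrib]
    refine Finset.sum_congr rfl (fun i _ => ?_)
    unfold DS Dd
    beta_reduce
    rw [st_neg, show fl k x + -st (i, true) + st (i, true) = fl k x by abel]
    field_simp
    ring
  rw [e2]
  refine tendsto_finsetSum _ (fun i _ => ?_)
  have h1 := (VL_tendsto (hDD (i, true) (i, true)) x).add (hk_HF.mul (VL_tendsto (hDDD (i, true) (i, true) (i, false)) x))
  rw [zero_mul, add_zero] at h1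
  exact h1
end Lim2

open Real Set MeasureTheory Metric Filter

section GB
variable {n : ℕ}

structure Sq (p M : ℝ) (u₀ : En n → ℝ) (U : ℕ → Lt n → ℝ → ℝ) : Prop where
  sol : ∀ k, ∃ S, LatSol n (hk k) p M k S (U k)
  ini : ∀ k x, dsq (hk k) x 0 < ((k : ℝ) + 1) ^ 2 → U k x 0 = u₀ (pt (hk k) x)
  ini0 : ∀ k x, ¬ dsq (hk k) x 0 < ((k : ℝ) + 1) ^ 2 → U k x 0 = 0

lemma Sq_exists {p M : ℝ} (hp : 1 ≤ p) (hM : 0 ≤ M) {u₀ : En n → ℝ} (h0 : ∀ x, 0 ≤ u₀ x) (h1 : ∀ x, u₀ x ≤ M) :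
    ∃ U, Sq p M u₀ U := by
  classical
  have H : ∀ k : ℕ, ∃ u : Lt n → ℝ → ℝ, LatSol n (hk k) p M k (lball (hk_pos k) 0 ((k : ℝ) + 1)) u ∧
      ∀ x, u x 0 = if x ∈ lball (hk_pos k) (0 : Lt n) ((k : ℝ) + 1) then u₀ (pt (hk k) x) else 0 := by
    intro k
    refine latsol_exists (hk_pos k) hp hM k (Nat.cast_nonneg k) _ _ ?_ ?_ ?_
    · intro x; split_ifs
      · exact h0 _
      · exact le_rfl
    · intro x; split_ifs
      · exact h1 _
      · exact hM
    · intro x hx; rw [if_neg hx]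
  choose U hU hU0 using H
  refine ⟨U, fun k => ⟨_, hU k⟩, ?_, ?_⟩
  · intro k x hx
    rw [hU0, if_pos ((mem_lball _ _ _ _).2 hx)]
  · intro k x hx
    rw [hU0, if_neg (fun h => hx ((mem_lball _ _ _ _).1 h))]

lemma norm_pt_le {h R : ℝ} {x : Lt n} (hR : 0 ≤ R) (hx : dsq h x 0 ≤ R ^ 2) : ‖pt h x‖ ≤ R := by
  rw [dsq_pt, pt_zero, sub_zero] at hx
  exact (le_abs_self _).trans (abs_le_of_sq_le_sq hx hR)

variable {p M : ℝ} {u₀ : En n → ℝ} {U : ℕ → Lt n → ℝ → ℝ}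

lemma Sq.low (hp : 1 ≤ p) (hM : 0 < M) (hc : Continuous u₀) (h0 : ∀ x, 0 < u₀ x) (h1 : ∀ x, u₀ x ≤ M) (hU : Sq p M u₀ U)
    (R T : ℝ) (hR : 0 < R) (hT : 0 < T) :
    ∃ m k0, 0 < m ∧ m ≤ M ∧ ∀ k ≥ k0, ∀ x t, dsq (hk k) x 0 ≤ R ^ 2 → 0 ≤ t → t ≤ T → m ≤ U k x t := by
  obtain ⟨z, _, hz⟩ := (isCompact_closedBall (0 : En n) (R + 1)).exists_isMinOn (nonempty_closedBall.2 (by positivity)) hc.continuousOn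
  obtain ⟨k0, hk0⟩ := exists_nat_ge (R + 1 + T)
  obtain ⟨a, ha⟩ : ∃ a, a = u₀ z := ⟨_, rfl⟩
  have ha0 : 0 < a := ha ▸ h0 z
  obtain ⟨l, hl⟩ : ∃ l, l = 2 * n * a * M ^ (p - 1) := ⟨_, rfl⟩
  have hl0 : 0 ≤ l := by rw [hl]; have := Real.rpow_nonneg hM.le (p - 1); positivity
  refine ⟨a * Real.exp (-l * T), k0, by positivity, ?_, ?_⟩
  · have : Real.exp (-l * T) ≤ 1 := by rw [Real.exp_le_one_iff]; nlinarith
    have h2 : a ≤ M := ha ▸ h1 z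
    nlinarith
  intro k hk' x t hx ht htT
  have hkk : (k0 : ℝ) ≤ k := by exact_mod_cast hk'
  obtain ⟨S, hS⟩ := hU.sol k
  have h3 := hS.lower (hk_pos k) hp hM.le x (R := 1) (ε := a) ha0.le ?_ x ht (by linarith)
  · rw [dsq_self, ← hl] at h3
    have h4 : Real.exp (-l * T) ≤ Real.exp (-l * t) := Real.exp_le_exp.2 (by nlinarith)
    have h5 := mul_le_mul_of_nonneg_left h4 ha0.le
    linarith
  · intro y hy
    have h4 : dsq (hk k) y 0 ≤ (R + 1) ^ 2 := by
      have := dsq_tri (h := hk k) zero_le_one hR.le (by linarith : dsq (hk k) y x ≤ 1 ^ 2) hx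
      rwa [add_comm] at this
    rw [hU.ini k y (h4.trans_lt (pow_lt_pow_left₀ (by linarith) (by positivity) two_ne_zero))]
    have h5 := hz (mem_closedBall_zero_iff.2 (norm_pt_le (by positivity) h4))
    have : u₀ z ≤ u₀ (pt (hk k) y) := h5
    rw [ha]; linarith

structure GBd (p m C : ℝ) (R τ T : ℝ) (k0 : ℕ) (U : ℕ → Lt n → ℝ → ℝ) : Prop where
  lo : ∀ k ≥ k0, ∀ x t, dsq (hk k) x 0 ≤ R ^ 2 → τ ≤ t → t ≤ T → m ≤ U k x t
  d1 : ∀ k ≥ k0, ∀ x t, dsq (hk k) x 0 ≤ R ^ 2 → τ ≤ t → t ≤ T → HasDerivAt (U k x) (wf (hk k) p (U k) x t) t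
  d2 : ∀ k ≥ k0, ∀ x t, dsq (hk k) x 0 ≤ R ^ 2 → τ ≤ t → t ≤ T → HasDerivAt (wf (hk k) p (U k) x) (zf (hk k) p (U k) x t) t
  bd : ∀ k ≥ k0, ∀ x t, dsq (hk k) x 0 ≤ R ^ 2 → τ ≤ t → t ≤ T →
    (∀ e, |Dd (hk k) e (fun y => U k y t) x| ≤ C) ∧ |wf (hk k) p (U k) x t| ≤ C ∧ |zf (hk k) p (U k) x t| ≤ C ∧
    (∀ e f, |Dd (hk k) f (fun y => Dd (hk k) e (fun y => U k y t) y) x| ≤ C) ∧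
    (∀ e f g, |Dd (hk k) g (fun y => Dd (hk k) f (fun y => Dd (hk k) e (fun y => U k y t) y) y) x| ≤ C)

lemma Sq.gb (hp : 1 ≤ p) (hM : 0 < M) (hc : Continuous u₀) (h0 : ∀ x, 0 < u₀ x) (h1 : ∀ x, u₀ x ≤ M) (hU : Sq p M u₀ U)
    (R τ T : ℝ) (hR : 0 < R) (hτ : 0 < τ) (hT : 0 < T) :
    ∃ m C k0, 0 < m ∧ 0 < C ∧ GBd p m C R τ T k0 U := by
  obtain ⟨m, k1, hm, hmM, hlo⟩ := hU.low hp hM hc h0 h1 (R + 1) (T + 1) (by positivity) (by positivity)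
  obtain ⟨ρ, hρ⟩ : ∃ ρ, ρ = min (1 / 2) (τ / 8) := ⟨_, rfl⟩
  have hρ0 : 0 < ρ := by rw [hρ]; exact lt_min (by norm_num) (by positivity)
  have hρ1 : ρ ≤ 1 / 2 := by rw [hρ]; exact min_le_left _ _
  have hρ2 : ρ ≤ τ / 8 := by rw [hρ]; exact min_le_right _ _
  obtain ⟨C, hb, hC, hhb, H⟩ := loc_reg n (p := p) (m := m) (M := M) (C1 := M / (τ / 2)) (ρ := ρ) hp hm hmM (by positivity) hρ0
  have hev : ∀ᶠ k in atTop, hk k < hb := hk_tendsto.eventually (gt_mem_nhds hhb)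
  obtain ⟨k2, hk2⟩ := eventually_atTop.1 hev
  obtain ⟨k3, hk3⟩ := exists_nat_ge (T + 1)
  have q1 : 4 * ρ ^ 2 ≤ 1 := by nlinarith
  have q2 : 4 * ρ ^ 2 ≤ τ / 2 := by nlinarith
  have hd1 : ∀ k ≥ max k1 (max k2 k3), ∀ x t, 0 ≤ t → t ≤ T + 1 → HasDerivAt (U k x) (wf (hk k) p (U k) x t) t := by
    intro k hk' x t ht htT
    have b3 : (k3 : ℝ) ≤ k := by exact_mod_cast ((le_max_right _ _).trans (le_max_right _ _)).trans hk'
    obtain ⟨S, hS⟩ := hU.sol k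
    exact hS.hd x t ht (by linarith)
  refine ⟨m, C, max k1 (max k2 k3), hm, hC, ?_, ?_, ?_, ?_⟩
  · intro k hk' x t hx ht htT
    exact hlo k ((le_max_left _ _).trans hk') x t (hx.trans (pow_le_pow_left₀ hR.le (by linarith) 2)) (by linarith) (by linarith)
  · intro k hk' x t hx ht htT
    exact hd1 k hk' x t (by linarith) (by linarith)
  · intro k hk' x t hx ht htT
    refine wf_deriv hp (U k) x t (fun y => hd1 k hk' y t (by linarith) (by linarith)) (hm.trans_le ?_)
    exact hlo k ((le_max_left _ _).trans hk') x t (hx.trans (pow_le_pow_left₀ hR.le (by linarith) 2)) (by linarith) (by linarith)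
  · intro k hk' x t hx ht htT
    have b3 : (k3 : ℝ) ≤ k := by exact_mod_cast ((le_max_right _ _).trans (le_max_right _ _)).trans hk'
    have b2 : k2 ≤ k := ((le_max_left _ _).trans (le_max_right _ _)).trans hk'
    obtain ⟨S, hS⟩ := hU.sol k
    refine H (hk k) t x (U k) (hk_pos k) (hk2 k b2).le ⟨?_, ?_, ?_, ?_, ?_⟩
    · intro y s hs
      exact hd1 k hk' y s (by linarith [hs.1]) (by linarith [hs.2])
    · intro y hy s hs
      refine hlo k ((le_max_left _ _).trans hk') y s ?_ (by linarith [hs.1]) (by linarith [hs.2])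
      exact (dsq_tri hρ0.le hR.le hy hx).trans (pow_le_pow_left₀ (by positivity) (by linarith) 2)
    · intro y s hs
      exact hS.nonneg y s (by linarith [hs.1]) (by linarith [hs.2])
    · intro y s hs
      exact hS.le y s (by linarith [hs.1]) (by linarith [hs.2])
    · intro y s s' hs hss hs'
      exact hS.quasi hp y (τ := τ / 2) (by positivity) (by linarith) hss (by linarith)
end GB

open Real Set MeasureTheory Metric Filter

section LimSol
variable {n : ℕ} {p M : ℝ} {u₀ : En n → ℝ} {U : ℕ → Lt n → ℝ → ℝ}

noncomputable def vl (U : ℕ → Lt n → ℝ → ℝ) (x : En n) (t : ℝ) : ℝ := VL (fun k y => U k y t) x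

lemma fl_in (k : ℕ) (x : En n) : dsq (hk k) (fl k x) 0 ≤ (‖x‖ + n + 1) ^ 2 := by
  have := hk_pos k
  refine (dsq_fl_zero k x).trans (pow_le_pow_left₀ (by positivity) ?_ 2)
  have := mul_le_mul_of_nonneg_left (hk_le_one k) (Nat.cast_nonneg n : (0:ℝ) ≤ n)
  linarith

lemma taylor1 {g w z : ℝ → ℝ} {a b C t s : ℝ} (h1 : ∀ r ∈ Icc a b, HasDerivAt g (w r) r) (h2 : ∀ r ∈ Icc a b, HasDerivAt w (z r) r)
    (h3 : ∀ r ∈ Icc a b, |z r| ≤ C) (ht : t ∈ Icc a b) (hs : s ∈ Icc a b) : |g s - g t - w t * (s - t)| ≤ C * (s - t) ^ 2 := by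
  have hC : 0 ≤ C := (abs_nonneg _).trans (h3 t ht)
  have hsub : uIcc t s ⊆ Icc a b := uIcc_subset_Icc ht hs
  have hw : ∀ r ∈ uIcc t s, |w r - w t| ≤ C * |s - t| := by
    intro r hr
    have := (convex_Icc a b).norm_image_sub_le_of_norm_hasDerivWithin_le (f := w) (f' := z) (C := C)
      (fun y hy => (h2 y hy).hasDerivWithinAt) (fun y hy => h3 y hy) ht (hsub hr)
    refine this.trans (mul_le_mul_of_nonneg_left ?_ hC)
    rw [Real.norm_eq_abs]
    exact abs_sub_left_of_mem_uIcc hr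
  have h5 := (convex_uIcc t s).norm_image_sub_le_of_norm_hasDerivWithin_le (f := fun r => g r - w t * r) (f' := fun r => w r - w t * 1) (C := C * |s - t|)
      (fun y hy => ((h1 y (hsub hy)).sub ((hasDerivAt_id y).const_mul (w t))).hasDerivWithinAt)
      (fun y hy => by rw [mul_one]; exact hw y hy) left_mem_uIcc right_mem_uIcc
  rw [Real.norm_eq_abs, Real.norm_eq_abs, mul_assoc, abs_mul_abs_self] at h5
  have e : g s - g t - w t * (s - t) = g s - w t * s - (g t - w t * t) := by ring
  rw [e, sq]; exact h5


lemma Sq.LB0 (hU : Sq p M u₀ U) {t : ℝ} (ht : 0 ≤ t) : LBd (fun k y => U k y t) := by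
  intro R hR
  obtain ⟨k0, hk0⟩ := exists_nat_ge t
  refine ⟨|M| + 1, by positivity, k0, ?_⟩
  intro k hk' x _
  have : (k0 : ℝ) ≤ k := by exact_mod_cast hk'
  obtain ⟨S, hS⟩ := hU.sol k
  rw [abs_of_nonneg (hS.nonneg x t ht (by linarith))]
  have := hS.le x t ht (by linarith)
  have := le_abs_self M
  linarith

lemma Sq.vt (hU : Sq p M u₀ U) {t : ℝ} (ht : 0 ≤ t) (x : En n) : Tendsto (fun k => U k (fl k x) t) HF (nhds (vl U x t)) :=
  VL_tendsto (hU.LB0 ht) x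


lemma Sq.LB1 (hp : 1 ≤ p) (hM : 0 < M) (hc : Continuous u₀) (h0 : ∀ x, 0 < u₀ x) (h1 : ∀ x, u₀ x ≤ M) (hU : Sq p M u₀ U) {t : ℝ} (ht : 0 < t) (e : Dr n) : LBd (DS e (fun k y => U k y t)) := by
  intro R hR
  obtain ⟨m, C, k0, _, hC, H⟩ := hU.gb hp hM hc h0 h1 R t t hR ht ht
  exact ⟨C, hC, k0, fun k hk' x hx => (H.bd k hk' x t hx le_rfl le_rfl).1 e⟩

lemma Sq.LB2 (hp : 1 ≤ p) (hM : 0 < M) (hc : Continuous u₀) (h0 : ∀ x, 0 < u₀ x) (h1 : ∀ x, u₀ x ≤ M) (hU : Sq p M u₀ U) {t : ℝ} (ht : 0 < t) (e f : Dr n) : LBd (DS f (DS e (fun k y => U k y t))) := by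
  intro R hR
  obtain ⟨m, C, k0, _, hC, H⟩ := hU.gb hp hM hc h0 h1 R t t hR ht ht
  exact ⟨C, hC, k0, fun k hk' x hx => (H.bd k hk' x t hx le_rfl le_rfl).2.2.2.1 e f⟩

lemma Sq.LB3 (hp : 1 ≤ p) (hM : 0 < M) (hc : Continuous u₀) (h0 : ∀ x, 0 < u₀ x) (h1 : ∀ x, u₀ x ≤ M) (hU : Sq p M u₀ U) {t : ℝ} (ht : 0 < t) (e f g : Dr n) : LBd (DS g (DS f (DS e (fun k y => U k y t)))) := by
  intro R hR
  obtain ⟨m, C, k0, _, hC, H⟩ := hU.gb hp hM hc h0 h1 R t t hR ht ht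
  exact ⟨C, hC, k0, fun k hk' x hx => (H.bd k hk' x t hx le_rfl le_rfl).2.2.2.2 e f g⟩

lemma Sq.C2 (hp : 1 ≤ p) (hM : 0 < M) (hc : Continuous u₀) (h0 : ∀ x, 0 < u₀ x) (h1 : ∀ x, u₀ x ≤ M) (hU : Sq p M u₀ U) {t : ℝ} (ht : 0 < t) : ContDiff ℝ 2 (fun y => vl U y t) :=
  VL_C2 (hU.LB0 ht.le) (hU.LB1 hp hM hc h0 h1 ht) (hU.LB2 hp hM hc h0 h1 ht) (hU.LB3 hp hM hc h0 h1 ht)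

lemma Sq.pos (hp : 1 ≤ p) (hM : 0 < M) (hc : Continuous u₀) (h0 : ∀ x, 0 < u₀ x) (h1 : ∀ x, u₀ x ≤ M) (hU : Sq p M u₀ U) {t : ℝ} (ht : 0 < t) (x : En n) : 0 < vl U x t := by
  obtain ⟨m, C, k0, hm, hC, H⟩ := hU.gb hp hM hc h0 h1 (‖x‖ + n + 1) t t (by positivity) ht ht
  exact hm.trans_le (ge_of_tendsto (hU.vt ht.le x) (HF_ev (k0 := k0) (fun k hk' => H.lo k hk' _ t (fl_in k x) le_rfl le_rfl)))

lemma Sq.wt (hp : 1 ≤ p) (hM : 0 < M) (hc : Continuous u₀) (h0 : ∀ x, 0 < u₀ x) (h1 : ∀ x, u₀ x ≤ M) (hU : Sq p M u₀ U) {t : ℝ} (ht : 0 < t) (x : En n) :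
    Tendsto (fun k => wf (hk k) p (U k) (fl k x) t) HF (nhds (vl U x t ^ p * lap (fun y => vl U y t) x)) := by
  have h3 := VL_lap (hU.LB0 ht.le) (hU.LB1 hp hM hc h0 h1 ht) (hU.LB2 hp hM hc h0 h1 ht) (hU.LB3 hp hM hc h0 h1 ht) x
  have h4 := (hU.vt ht.le x).rpow_const (p := p) (Or.inr (by linarith))
  exact h4.mul h3

lemma Sq.tay (hp : 1 ≤ p) (hM : 0 < M) (hc : Continuous u₀) (h0 : ∀ x, 0 < u₀ x) (h1 : ∀ x, u₀ x ≤ M) (hU : Sq p M u₀ U) {t : ℝ} (ht : 0 < t) (x : En n) :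
    HasDerivAt (fun s => vl U x s) (vl U x t ^ p * lap (fun y => vl U y t) x) t := by
  obtain ⟨m, C, k0, hm, hC, H⟩ := hU.gb hp hM hc h0 h1 (‖x‖ + n + 1) (t / 2) (2 * t) (by positivity) (by positivity) (by positivity)
  obtain ⟨L, hL⟩ : ∃ L, L = vl U x t ^ p * lap (fun y => vl U y t) x := ⟨_, rfl⟩
  have hw := hU.wt hp hM hc h0 h1 ht x
  rw [← hL] at hw ⊢
  have key : ∀ s ∈ Icc (t / 2) (2 * t), |vl U x s - vl U x t - L * (s - t)| ≤ C * (s - t) ^ 2 := by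
    intro s hs
    have h3 := (((hU.vt (t := s) (by linarith [hs.1]) x).sub (hU.vt ht.le x)).sub (hw.mul_const (s - t))).abs
    refine le_of_tendsto h3 (HF_ev (k0 := k0) (fun k hk' => ?_))
    exact taylor1 (a := t / 2) (b := 2 * t) (fun r hr => H.d1 k hk' _ r (fl_in k x) hr.1 hr.2) (fun r hr => H.d2 k hk' _ r (fl_in k x) hr.1 hr.2)
      (fun r hr => (H.bd k hk' _ r (fl_in k x) hr.1 hr.2).2.2.1) ⟨by linarith, by linarith⟩ hs
  rw [hasDerivAt_iff_isLittleO_nhds_zero]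
  have h5 : (fun d : ℝ => vl U x (t + d) - vl U x t - d • L) =O[nhds 0] (fun d => ‖d‖ ^ 2) := by
    refine Asymptotics.IsBigO.of_bound C ?_
    filter_upwards [ball_mem_nhds (0 : ℝ) (half_pos ht)] with d hd
    rw [mem_ball, dist_zero_right, Real.norm_eq_abs, abs_lt] at hd
    have := key (t + d) ⟨by linarith, by linarith⟩
    rw [add_sub_cancel_left] at this
    rw [Real.norm_eq_abs, Real.norm_eq_abs, Real.norm_eq_abs, sq_abs, abs_of_nonneg (sq_nonneg d), smul_eq_mul, mul_comm d]
    exact this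
  exact h5.trans_isLittleO (Asymptotics.isLittleO_norm_pow_id one_lt_two)

lemma Sq.contPos (hp : 1 ≤ p) (hM : 0 < M) (hc : Continuous u₀) (h0 : ∀ x, 0 < u₀ x) (h1 : ∀ x, u₀ x ≤ M) (hU : Sq p M u₀ U) {t : ℝ} (ht : 0 < t) (x : En n) : ContinuousAt (fun z : En n × ℝ => vl U z.1 z.2) (x, t) := by
  obtain ⟨m, C, k0, hm, hC, H⟩ := hU.gb hp hM hc h0 h1 (‖x‖ + 1 + n + 1) (t / 2) (2 * t) (by positivity) (by positivity) (by positivity)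
  have key : ∀ y, ‖y‖ ≤ ‖x‖ + 1 → ∀ s ∈ Icc (t / 2) (2 * t), |vl U y s - vl U y t| ≤ C * |s - t| := by
    intro y hy s hs
    have h3 := ((hU.vt (t := s) (by linarith [hs.1]) y).sub (hU.vt ht.le y)).abs
    refine le_of_tendsto h3 (HF_ev (k0 := k0) (fun k hk' => ?_))
    have hfl : dsq (hk k) (fl k y) 0 ≤ (‖x‖ + 1 + n + 1) ^ 2 := (fl_in k y).trans (pow_le_pow_left₀ (by positivity) (by linarith) 2)
    exact (convex_Icc (t / 2) (2 * t)).norm_image_sub_le_of_norm_hasDerivWithin_le (f := U k (fl k y)) (f' := wf (hk k) p (U k) (fl k y)) (C := C)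
      (fun r hr => (H.d1 k hk' _ r hfl hr.1 hr.2).hasDerivWithinAt) (fun r hr => (H.bd k hk' _ r hfl hr.1 hr.2).2.1) ⟨by linarith, by linarith⟩ hs
  have hcx : Continuous (fun y => vl U y t) := VL_cont (hU.LB0 ht.le) (hU.LB1 hp hM hc h0 h1 ht)
  rw [ContinuousAt, tendsto_iff_norm_sub_tendsto_zero]
  have h2 : Tendsto (fun z : En n × ℝ => C * |z.2 - t| + |vl U z.1 t - vl U x t|) (nhds (x, t)) (nhds 0) := by
    have : Continuous (fun z : En n × ℝ => C * |z.2 - t| + |vl U z.1 t - vl U x t|) := by fun_prop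
    have h3 := this.tendsto (x, t)
    simpa using h3
  refine squeeze_zero' (Eventually.of_forall (fun _ => norm_nonneg _)) ?_ h2
  have n1 : ball x 1 ×ˢ Icc (t / 2) (2 * t) ∈ nhds (x, t) :=
    prod_mem_nhds (ball_mem_nhds x one_pos) (Icc_mem_nhds (by linarith) (by linarith))
  filter_upwards [n1] with z hz
  have hz1 : ‖z.1‖ ≤ ‖x‖ + 1 := by
    have h3 := hz.1
    rw [mem_ball, dist_eq_norm] at h3
    have := norm_add_le (z.1 - x) x
    rw [sub_add_cancel] at this
    linarith
  have h3 := key z.1 hz1 z.2 hz.2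
  have h4 := abs_sub_le (vl U z.1 z.2) (vl U z.1 t) (vl U x t)
  rw [Real.norm_eq_abs]
  linarith

lemma Sq.ini_est (hp : 1 ≤ p) (hM : 0 < M) (hc : Continuous u₀) (h0 : ∀ x, 0 < u₀ x) (h1 : ∀ x, u₀ x ≤ M) (hU : Sq p M u₀ U) (x0 : En n) {ε : ℝ} (hε : 0 < ε) (hε0 : ε ≤ u₀ x0) :
    ∃ C, 0 < C ∧ ∀ x t, 0 ≤ t → |vl U x t - u₀ x0| ≤ ε + C * ‖x - x0‖ ^ 2 + 2 * n * C * M ^ p * t := by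
  obtain ⟨δ, hδ, Hδ⟩ := Metric.continuous_iff.1 hc x0 ε hε
  obtain ⟨C, hCd⟩ : ∃ C, C = 4 * M / δ ^ 2 := ⟨_, rfl⟩
  have hC : 0 < C := by rw [hCd]; positivity
  have hC2 : C * (δ / 2) ^ 2 = M := by rw [hCd]; field_simp; norm_num
  refine ⟨C, hC, ?_⟩
  intro x t ht
  obtain ⟨k1, hk1⟩ := exists_nat_ge (t + (δ / 2 + (‖x0‖ + n + 1)))
  have hev : ∀ᶠ k in atTop, n * hk k < δ / 2 := by
    have := hk_tendsto.const_mul (n : ℝ)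
    rw [mul_zero] at this
    exact this.eventually (gt_mem_nhds (by positivity))
  obtain ⟨k2, hk2⟩ := eventually_atTop.1 hev
  have hlim : Tendsto (fun k => ε + C * (‖x - x0‖ + 2 * n * hk k) ^ 2 + 2 * n * C * M ^ p * t) HF (nhds (ε + C * (‖x - x0‖ + 2 * n * 0) ^ 2 + 2 * n * C * M ^ p * t)) :=
    ((((hk_HF.const_mul (2 * n : ℝ)).const_add ‖x - x0‖).pow 2).const_mul C).const_add ε |>.add_const _
  have h3 := ((hU.vt ht x).sub_const (u₀ x0)).abs
  have h4 := le_of_tendsto_of_tendsto h3 hlim (HF_ev (k0 := max k1 k2) (fun k hk' => ?_))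
  · simpa using h4
  have b1 : (k1 : ℝ) ≤ k := by exact_mod_cast (le_max_left _ _).trans hk'
  have b2 := hk2 k ((le_max_right _ _).trans hk')
  have hnx := norm_nonneg x0
  have hnn : (0:ℝ) ≤ n := Nat.cast_nonneg n
  obtain ⟨S, hS⟩ := hU.sol k
  have hkt : t ≤ k := by linarith
  have hk00 : (0:ℝ) ≤ k := Nat.cast_nonneg k
  have near : ∀ z, dsq (hk k) z (fl k x0) < (δ / 2) ^ 2 → |u₀ (pt (hk k) z) - u₀ x0| < ε := by
    intro z hz
    refine Hδ _ ?_
    rw [dsq_pt] at hz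
    have h5 := abs_lt_of_sq_lt_sq hz (by positivity)
    have h6 := pt_fl k x0
    rw [abs_of_nonneg (norm_nonneg _)] at h5
    rw [dist_eq_norm]
    have h7 := norm_add_le (pt (hk k) z - pt (hk k) (fl k x0)) (pt (hk k) (fl k x0) - x0)
    rw [sub_add_sub_cancel] at h7
    linarith
  have inb : ∀ z, dsq (hk k) z (fl k x0) < (δ / 2) ^ 2 → dsq (hk k) z 0 < ((k : ℝ) + 1) ^ 2 := by
    intro z hz
    refine (dsq_tri (by positivity) (by positivity) hz.le (fl_in k x0)).trans_lt (pow_lt_pow_left₀ (by linarith) (by positivity) two_ne_zero)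
  have far : ∀ z, ¬ dsq (hk k) z (fl k x0) < (δ / 2) ^ 2 → M ≤ C * dsq (hk k) z (fl k x0) := by
    intro z hz
    rw [← hC2]
    exact mul_le_mul_of_nonneg_left (not_lt.1 hz) hC.le
  have up := hS.init_upper (hk_pos k) hp (fl k x0) (A := u₀ x0 + ε) (C := C) (by linarith [h0 x0]) hC.le hM.le ?_ (fl k x) ht hkt
  have lw := hS.init_lower (hk_pos k) hp (fl k x0) (A := u₀ x0 - ε) (C := C) (by linarith [h0 x0]) hC hM.le ?_ (fl k x) ht hkt
  · have h8 := mul_le_mul_of_nonneg_left (dsq_fl k x0 x) hC.le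
    rw [abs_le]
    constructor <;> linarith
  · intro z
    by_cases hz : dsq (hk k) z (fl k x0) < (δ / 2) ^ 2
    · rw [hU.ini k z (inb z hz)]
      have h9 := (abs_lt.1 (near z hz)).1
      have h10 := mul_nonneg hC.le (dsq_nonneg (hk k) z (fl k x0))
      linarith
    · have h9 := far z hz
      have h10 := hS.nonneg z 0 le_rfl hk00
      have h11 := h1 x0
      linarith
  · intro z
    have h10 := mul_nonneg hC.le (dsq_nonneg (hk k) z (fl k x0))
    by_cases hz : dsq (hk k) z (fl k x0) < (δ / 2) ^ 2
    · rw [hU.ini k z (inb z hz)]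
      have h9 := (abs_lt.1 (near z hz)).2
      linarith
    · have h9 := far z hz
      have h10 := hS.le z 0 le_rfl hk00
      have h11 := h0 x0
      linarith

lemma Sq.v0 (hp : 1 ≤ p) (hM : 0 < M) (hc : Continuous u₀) (h0 : ∀ x, 0 < u₀ x) (h1 : ∀ x, u₀ x ≤ M) (hU : Sq p M u₀ U) (x : En n) : vl U x 0 = u₀ x := by
  by_contra hne
  have h2 : 0 < |vl U x 0 - u₀ x| := abs_pos.2 (sub_ne_zero.2 hne)
  obtain ⟨C, hC, H⟩ := hU.ini_est hp hM hc h0 h1 x (ε := min (u₀ x) (|vl U x 0 - u₀ x| / 2)) (lt_min (h0 x) (by positivity)) (min_le_left _ _)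
  have h3 := H x 0 le_rfl
  rw [sub_self, norm_zero] at h3
  have h4 := min_le_right (u₀ x) (|vl U x 0 - u₀ x| / 2)
  rw [zero_pow two_ne_zero, mul_zero, mul_zero, add_zero, add_zero] at h3
  linarith

lemma Sq.contZero (hp : 1 ≤ p) (hM : 0 < M) (hc : Continuous u₀) (h0 : ∀ x, 0 < u₀ x) (h1 : ∀ x, u₀ x ≤ M) (hU : Sq p M u₀ U) (x : En n) : ContinuousWithinAt (fun z : En n × ℝ => vl U z.1 z.2) {z | 0 ≤ z.2} (x, 0) := by
  rw [Metric.continuousWithinAt_iff]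
  intro η hη
  obtain ⟨C, hC, H⟩ := hU.ini_est hp hM hc h0 h1 x (ε := min (u₀ x) (η / 2)) (lt_min (h0 x) (by positivity)) (min_le_left _ _)
  have h4 := min_le_right (u₀ x) (η / 2)
  have hcn : Continuous (fun z : En n × ℝ => C * ‖z.1 - x‖ ^ 2 + 2 * n * C * M ^ p * z.2) := by fun_prop
  obtain ⟨δ, hδ, Hδ⟩ := Metric.continuous_iff.1 hcn (x, 0) (η / 2) (by positivity)
  refine ⟨δ, hδ, ?_⟩
  intro z hz hzd
  have h5 := Hδ z hzd
  rw [Real.dist_eq] at h5 ⊢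
  have h6 := (abs_lt.1 h5).2
  have h7 := H z.1 z.2 hz
  simp only [sub_self, norm_zero] at h6
  norm_num at h6
  show |vl U z.1 z.2 - vl U x 0| < η
  rw [hU.v0 hp hM hc h0 h1 x]
  linarith

lemma Sq.isSol (hp : 1 ≤ p) (hM : 0 < M) (hc : Continuous u₀) (h0 : ∀ x, 0 < u₀ x) (h1 : ∀ x, u₀ x ≤ M) (hU : Sq p M u₀ U) (T : ℝ) : IsSolOn n p u₀ (vl U) T := by
  refine ⟨?_, hU.v0 hp hM hc h0 h1, fun x t ht _ => hU.pos hp hM hc h0 h1 ht x, fun t ht _ => hU.C2 hp hM hc h0 h1 ht,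
    fun x t ht _ => hU.tay hp hM hc h0 h1 ht x⟩
  rintro ⟨x, t⟩ ⟨ht, htT⟩
  simp only at ht htT
  rcases ht.eq_or_lt with h | h
  · subst h
    exact (hU.contZero hp hM hc h0 h1 x).mono (fun z hz => hz.1)
  · exact (hU.contPos hp hM hc h0 h1 h x).continuousWithinAt
end LimSol

open Real Set MeasureTheory Metric Filter

section Fin0
variable {n : ℕ} {p M : ℝ} {u₀ : En n → ℝ} {U : ℕ → Lt n → ℝ → ℝ}

lemma Sq.dec (hn : 1 ≤ n) (hp : 1 ≤ p) (hM : 0 < M) (hU : Sq p M u₀ U) {t R : ℝ} (ht : 1 ≤ t) (hR : 0 < R) (hR2 : 6 ≤ R ^ 2)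
    (hMR : M ^ p ≤ 2 * R ^ 2) (htail : ∀ x, R ≤ ‖x‖ → u₀ x ^ p * (1 + 2 * t) ^ (20 * n : ℕ) * t ≤ 1) (x : En n) :
    (1 + t) * vl U x t ^ p ≤ 4 * R ^ 2 := by
  have h3 := ((hU.vt (by linarith : 0 ≤ t) x).rpow_const (p := p) (Or.inr (by linarith))).const_mul (1 + t)
  have hev : ∀ᶠ k in atTop, 4 * hk k < R := by
    have := hk_tendsto.const_mul (4 : ℝ)
    rw [mul_zero] at this
    exact this.eventually (gt_mem_nhds hR)
  obtain ⟨k2, hk2⟩ := eventually_atTop.1 hev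
  obtain ⟨k1, hk1⟩ := exists_nat_gt (2 * t)
  refine le_of_tendsto h3 (HF_ev (k0 := max k1 k2) (fun k hk' => ?_))
  have b1 : (k1 : ℝ) ≤ k := by exact_mod_cast (le_max_left _ _).trans hk'
  have b2 := hk2 k ((le_max_right _ _).trans hk')
  obtain ⟨S, hS⟩ := hU.sol k
  refine hS.decay hn (hk_pos k) hp hM.le ht (by linarith) hR hR2 hMR b2.le ?_ (fl k x)
  intro z hz
  by_cases hz2 : dsq (hk k) z 0 < ((k : ℝ) + 1) ^ 2
  · rw [hU.ini k z hz2]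
    refine htail _ ?_
    rw [dsq_pt, pt_zero, sub_zero] at hz
    have := abs_le_of_sq_le_sq hz (norm_nonneg _)
    exact (le_abs_self R).trans this
  · rw [hU.ini0 k z hz2, Real.zero_rpow (by linarith)]
    norm_num

lemma tail_est (n : ℕ) {p c₀ α β L t r K : ℝ} (hp : 1 ≤ p) (hc₀ : 0 < c₀) (hα : 0 < α) (hβ : 0 < β) (ht : 3 ≤ t) (hL : L = Real.log t)
    (hK : K = (40 * n + 2) / (α * p)) (hc : c₀ ^ p ≤ t) (hr : (K * L) ^ (1 / β) ≤ r) {a : ℝ} (ha : 0 ≤ a)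
    (har : a ≤ c₀ * Real.exp (-α * r ^ β)) : a ^ p * (1 + 2 * t) ^ (20 * n : ℕ) * t ≤ 1 := by
  have hp0 : 0 < p := by linarith
  have ht0 : 0 < t := by linarith
  have hL0 : 0 ≤ L := by rw [hL]; exact Real.log_nonneg (by linarith)
  have hK0 : 0 ≤ K := by rw [hK]; positivity
  have hKL : 0 ≤ K * L := mul_nonneg hK0 hL0
  have h1 : K * L ≤ r ^ β := by
    have h2 := Real.rpow_le_rpow (Real.rpow_nonneg hKL (1 / β)) hr hβ.le
    rwa [← Real.rpow_mul hKL, one_div_mul_cancel hβ.ne', Real.rpow_one] at h2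
  have h2 : a ^ p ≤ t * Real.exp (-((40 * n + 2) * L)) := by
    refine (Real.rpow_le_rpow ha har hp0.le).trans ?_
    rw [Real.mul_rpow hc₀.le (Real.exp_pos _).le, ← Real.exp_mul]
    refine mul_le_mul hc (Real.exp_le_exp.2 ?_) (Real.exp_pos _).le ht0.le
    have h3 : α * p * (K * L) ≤ α * p * r ^ β := mul_le_mul_of_nonneg_left h1 (by positivity)
    have h4 : α * p * (K * L) = (40 * n + 2) * L := by rw [hK]; field_simp
    linarith
  have htL : t = Real.exp L := by rw [hL, Real.exp_log ht0]
  have h5 : (1 + 2 * t) ^ (20 * n : ℕ) ≤ Real.exp (40 * n * L) := by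
    have h6 : 1 + 2 * t ≤ t ^ 2 := by nlinarith
    refine (pow_le_pow_left₀ (by positivity) h6 _).trans ?_
    rw [← pow_mul, htL, ← Real.exp_nat_mul]
    refine Real.exp_le_exp.2 (le_of_eq ?_)
    push_cast; ring
  calc a ^ p * (1 + 2 * t) ^ (20 * n : ℕ) * t ≤ (t * Real.exp (-((40 * n + 2) * L))) * Real.exp (40 * n * L) * t := by
        refine mul_le_mul_of_nonneg_right (mul_le_mul h2 h5 (by positivity) (by positivity)) ht0.le
    _ = Real.exp (L + -((40 * n + 2) * L) + 40 * n * L + L) := by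
        rw [Real.exp_add, Real.exp_add, Real.exp_add, ← htL]
    _ ≤ 1 := by
        rw [Real.exp_le_one_iff]; apply le_of_eq; ring

lemma final_alg {p β K L t v δ : ℝ} (hp : 1 ≤ p) (hβ : 0 < β) (hK : 0 < K) (hL : 1 ≤ L) (ht : 0 < t) (hδ : 0 < δ) (hv : 0 ≤ v)
    (h : (1 + t) * v ^ p ≤ 4 * ((K * L) ^ (1 / β)) ^ 2) :
    v ≤ (4 * K ^ (2 / β)) ^ (1 / p) * t ^ (-(1:ℝ) / p) * L ^ (2 / (p * β) + δ) := by
  have hp0 : 0 < p := by linarith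
  have hL0 : 0 < L := by linarith
  have e1 : ((K * L) ^ (1 / β)) ^ 2 = K ^ (2 / β) * L ^ (2 / β) := by
    rw [← Real.rpow_natCast, ← Real.rpow_mul (by positivity), ← Real.mul_rpow hK.le hL0.le]
    congr 1; push_cast; ring
  have hvp : 0 ≤ v ^ p := Real.rpow_nonneg hv p
  have h2 : v ^ p ≤ (4 * K ^ (2 / β)) * L ^ (2 / β) * t⁻¹ := by
    rw [← div_eq_mul_inv, le_div_iff₀ ht]
    rw [e1] at h
    nlinarith
  have h3 := Real.rpow_le_rpow hvp h2 (by positivity : 0 ≤ 1 / p)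
  rw [← Real.rpow_mul hv, mul_one_div_cancel hp0.ne', Real.rpow_one, Real.mul_rpow (by positivity) (by positivity),
    Real.mul_rpow (by positivity) (by positivity), ← Real.rpow_mul hL0.le, Real.inv_rpow ht.le, ← Real.rpow_neg ht.le] at h3
  have e2 : 2 / β * (1 / p) = 2 / (p * β) := by field_simp
  have e3 : -(1 / p) = -(1:ℝ) / p := by ring
  rw [e2, e3] at h3
  refine h3.trans ?_
  have h4 : L ^ (2 / (p * β)) ≤ L ^ (2 / (p * β) + δ) := Real.rpow_le_rpow_of_exponent_le hL (by linarith)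
  have h5 := mul_le_mul_of_nonneg_left h4 (by positivity : 0 ≤ (4 * K ^ (2 / β)) ^ (1 / p) * t ^ (-(1:ℝ) / p))
  linarith
end Fin0

theorem stmt_10 (n : ℕ) (hn : 1 ≤ n)
    (p c₀ α β : ℝ) (hp : 1 ≤ p) (hc₀ : 0 < c₀) (hα : 0 < α) (hβ : 0 < β)
    (u₀ : EuclideanSpace ℝ (Fin n) → ℝ)
    (hu₀cont : Continuous u₀) (hu₀pos : ∀ x, 0 < u₀ x)
    (hu₀dec : ∀ x, u₀ x ≤ c₀ * Real.exp (-α * ‖x‖ ^ β))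
    (u : EuclideanSpace ℝ (Fin n) → ℝ → ℝ)
    (hu : IsMinimalSol n p u₀ u) :
    ∀ δ > (0:ℝ), ∃ t₀ > (0:ℝ), ∃ C > (0:ℝ), ∀ t ≥ t₀, ∀ x,
      u x t ≤ C * t ^ (-(1:ℝ)/p) * Real.log t ^ (2/(p*β) + δ) := by
  intro δ hδ
  have hp0 : 0 < p := by linarith
  have h1 : ∀ x, u₀ x ≤ c₀ := by
    intro x
    refine (hu₀dec x).trans ?_
    have h2 : Real.exp (-α * ‖x‖ ^ β) ≤ 1 := by
      rw [Real.exp_le_one_iff]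
      have := Real.rpow_nonneg (norm_nonneg x) β
      nlinarith
    nlinarith
  obtain ⟨U, hU⟩ := Sq_exists (u₀ := u₀) hp hc₀.le (fun x => (hu₀pos x).le) h1
  have hsol := hU.isSol hp hc₀ hu₀cont hu₀pos h1
  obtain ⟨K, hK⟩ : ∃ K : ℝ, K = (40 * n + 2) / (α * p) := ⟨_, rfl⟩
  have hK0 : 0 < K := by rw [hK]; positivity
  have hKL : Tendsto (fun t => (K * Real.log t) ^ (1 / β)) atTop atTop :=
    (tendsto_rpow_atTop (by positivity)).comp (Real.tendsto_log_atTop.const_mul_atTop hK0)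
  have hev : ∀ᶠ t in atTop, 3 ≤ t ∧ c₀ ^ p ≤ t ∧ 1 ≤ Real.log t ∧ 3 ≤ (K * Real.log t) ^ (1 / β) ∧ c₀ ^ p ≤ (K * Real.log t) ^ (1 / β) :=
    (eventually_ge_atTop 3).and ((eventually_ge_atTop _).and ((Real.tendsto_log_atTop.eventually_ge_atTop 1).and
      ((hKL.eventually_ge_atTop 3).and (hKL.eventually_ge_atTop _))))
  obtain ⟨t₀, ht₀⟩ := eventually_atTop.1 hev
  refine ⟨max t₀ 1, by positivity, (4 * K ^ (2 / β)) ^ (1 / p), by positivity, ?_⟩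
  intro t ht x
  obtain ⟨g1, g2, g3, g4, g5⟩ := ht₀ t ((le_max_left _ _).trans ht)
  have hut := hu.2 (t + 1) (by linarith) (vl U) (hsol (t + 1)) x t (by linarith) (by linarith)
  refine hut.trans ?_
  refine final_alg hp hβ hK0 g3 (by linarith) hδ (hU.pos hp hc₀ hu₀cont hu₀pos h1 (by linarith) x).le ?_
  refine hU.dec hn hp hc₀ (by linarith) (by linarith) (by nlinarith) (by nlinarith) ?_ x
  intro y hy
  exact tail_est n hp hc₀ hα hβ g1 rfl hK g2 hy (hu₀pos y).le (hu₀dec y)
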